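/- There exists β₀ > 0 such that for every β ≥ β₀ the following holds for the Discrete Gaussian model on Λ_L = {1,…,L}² with zero boundary conditions at inverse-temperature β, conditioned on the floor event {η_x ≥ 0 for all x}. There is a sequence of positive integers M* = M*(L) satisfying M*(L)/(((1+√2)/(2√(πβ))) · √(log L · log log L)) → 1 as L → ∞, such that the maximum X*_L = max_{x∈Λ_L} η_x satisfies ϖ_{Λ_L}(X*_L ∈ {M*(L), M*(L)+1, M*(L)+2}) → 1 as L → ∞. -/

import Mathlib

open Filter Topology Classical

noncomputable section

abbrev Site : Type := ℤ × ℤ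

/-- Nearest-neighbor adjacency in `ℤ²`. -/
def adjP (x y : Site) : Prop := |x.1 - y.1| + |x.2 - y.2| = 1

/-- The Discrete Gaussian Hamiltonian `H(η) = ∑_{x∼y} (η_x - η_y)²`, the sum running over
unordered nearest-neighbor pairs (each ordered pair is counted once, whence the factor 1/2). -/
def dgH (η : Site → ℤ) : ℝ :=
  (1 / 2) * ∑' p : Site × Site, if adjP p.1 p.2 then ((η p.1 - η p.2 : ℤ) : ℝ) ^ 2 else 0

/-- Unnormalized weight of the event `A` for the DG model on `Λ` with zero boundary conditions. -/
def dgW (β : ℝ) (Λ : Finset Site) (A : (Site → ℤ) → Prop) : ℝ :=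
  ∑' η : Site → ℤ, if (∀ x ∉ Λ, η x = 0) ∧ A η then Real.exp (-β * dgH η) else 0

/-- `π_Λ(A)`: probability of the event `A` under the DG measure on `Λ`. -/
def dgProb (β : ℝ) (Λ : Finset Site) (A : (Site → ℤ) → Prop) : ℝ :=
  dgW β Λ A / dgW β Λ (fun _ => True)

/-- `ϖ_Λ(A)`: DG measure conditioned on the floor event `η ≥ 0`. -/
def dgProbFloor (β : ℝ) (Λ : Finset Site) (A : (Site → ℤ) → Prop) : ℝ :=
  dgW β Λ (fun η => A η ∧ ∀ x, 0 ≤ η x) / dgW β Λ (fun η => ∀ x, 0 ≤ η x)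

/-- The box `Λ_L = {1,…,L}²`. -/
def box (L : ℕ) : Finset Site := Finset.Icc (1 : ℤ) (L : ℤ) ×ˢ Finset.Icc (1 : ℤ) (L : ℤ)

/-- The lattice ball `B_r = {x ∈ ℤ² : |x| ≤ r}`. -/
def ball (r : ℝ) : Finset Site :=
  ((Finset.Icc (-⌈r⌉) ⌈r⌉) ×ˢ (Finset.Icc (-⌈r⌉) ⌈r⌉)).filter
    fun x => ((x.1 : ℝ) ^ 2 + (x.2 : ℝ) ^ 2 ≤ r ^ 2)


open scoped ENNReal NNReal
open scoped FinsetFamily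

abbrev Om : Type := Site → ℤ
abbrev Edge : Type := Site × Bool
def tg (e : Edge) : Site := if e.2 then (e.1.1 + 1, e.1.2) else (e.1.1, e.1.2 + 1)
def gr (η : Om) (e : Edge) : ℤ := η (tg e) - η e.1
def ed (W : Finset Site) : Finset Edge :=
  W ×ˢ Finset.univ ∪ W.image (fun x => ((x.1 - 1, x.2), true)) ∪
    W.image (fun x => ((x.1, x.2 - 1), false))
lemma mem_ed {W : Finset Site} {e : Edge} : e ∈ ed W ↔ e.1 ∈ W ∨ tg e ∈ W := by
  obtain ⟨⟨x, y⟩, c⟩ := e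
  cases c <;> simp only [ed, tg, Finset.mem_union, Finset.mem_product, Finset.mem_univ, Finset.mem_image, and_true,
    Prod.mk.injEq, Bool.false_eq_true, reduceCtorEq, and_false, exists_false, or_false, Prod.exists, if_true, if_false]
  all_goals refine or_congr Iff.rfl ⟨?_, fun h => ⟨_, _, h, by simp⟩⟩
  all_goals rintro ⟨a, c, h, rfl, rfl⟩; simpa using h
def en (F : Finset Edge) (η : Om) : ℝ := ∑ e ∈ F, (gr η e : ℝ) ^ 2
def wt (b : ℝ) (F : Finset Edge) (η : Om) : ℝ≥0∞ := ENNReal.ofReal (Real.exp (-b * en F η))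
def S (b : ℝ) (W : Finset Site) (ζ : Om) (f : Om → ℝ≥0∞) : ℝ≥0∞ :=
  ∑' η : Om, if ∀ x ∉ W, η x = ζ x then f η * wt b (ed W) η else 0
/-- indicator -/
def ii (A : Set Om) : Om → ℝ≥0∞ := A.indicator 1
variable {b : ℝ} {W V Λ : Finset Site} {ζ ξ η : Om} {f g : Om → ℝ≥0∞} {A B I J E : Set Om}

lemma S_mono (h : ∀ η, (∀ x ∉ W, η x = ζ x) → f η ≤ g η) : S b W ζ f ≤ S b W ζ g := by
  refine ENNReal.tsum_le_tsum fun η => ?_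
  split_ifs with h1
  · exact mul_le_mul_left (h η h1) _
  · exact le_rfl
lemma S_congr (h : ∀ η, (∀ x ∉ W, η x = ζ x) → f η = g η) : S b W ζ f = S b W ζ g :=
  le_antisymm (S_mono fun η h1 => (h η h1).le) (S_mono fun η h1 => (h η h1).ge)
lemma S_smul (c : ℝ≥0∞) : S b W ζ (fun η => c * f η) = c * S b W ζ f := by
  simp only [S, ← ENNReal.tsum_mul_left]
  congr 1; ext η; split_ifs <;> simp [mul_assoc]
lemma S_sum {ι : Type*} (s : Finset ι) (F : ι → Om → ℝ≥0∞) :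
    S b W ζ (fun η => ∑ i ∈ s, F i η) = ∑ i ∈ s, S b W ζ (F i) := by
  simp only [S]
  rw [← Summable.tsum_finsetSum (fun _ _ => ENNReal.summable)]
  congr 1; ext η; split_ifs <;> simp [Finset.sum_mul]
lemma S_add : S b W ζ (fun η => f η + g η) = S b W ζ f + S b W ζ g := by
  simp only [S]
  rw [← ENNReal.tsum_add]
  congr 1; ext η; split_ifs <;> simp [add_mul]
lemma ii_le {η' : Om} (h : η ∈ A → η' ∈ B) : ii A η ≤ ii B η' := by
  by_cases hA : η ∈ A <;> simp [ii, hA, h]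
lemma S_ii_mono (h : ∀ η, (∀ x ∉ W, η x = ζ x) → η ∈ A → η ∈ B) :
    S b W ζ (ii A) ≤ S b W ζ (ii B) := S_mono fun η h1 => ii_le (h η h1)
lemma S_union {ι : Type*} (s : Finset ι) (F : ι → Set Om)
    (h : ∀ η, (∀ x ∉ W, η x = ζ x) → η ∈ A → ∃ i ∈ s, η ∈ F i) :
    S b W ζ (ii A) ≤ ∑ i ∈ s, S b W ζ (ii (F i)) := by
  rw [← S_sum]
  refine S_mono fun η h1 => ?_
  by_cases hA : η ∈ A
  · obtain ⟨i, hi, h2⟩ := h η h1 hA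
    refine le_trans ?_ (Finset.single_le_sum (f := fun i => ii (F i) η) (fun _ _ => zero_le) hi)
    simp [ii, hA, h2]
  · simp [ii, hA]
lemma S_or (h : ∀ η, (∀ x ∉ W, η x = ζ x) → η ∈ A → η ∈ B ∨ η ∈ E) :
    S b W ζ (ii A) ≤ S b W ζ (ii B) + S b W ζ (ii E) := by
  rw [← S_add]
  refine S_mono fun η h1 => ?_
  by_cases hA : η ∈ A
  · rcases h η h1 hA with h | h <;> simp [ii, hA, h]
  · simp [ii, hA]
/-- transport along an injective map -/
lemma S_mapf (T : Om → Om) {ζ' : Om} {W' : Finset Site}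
    (hT : ∀ η η', (∀ x ∉ W, η x = ζ x) → (∀ x ∉ W, η' x = ζ x) → f η ≠ 0 → f η' ≠ 0 → T η = T η' → η = η')
    (hs : ∀ η, (∀ x ∉ W, η x = ζ x) → f η ≠ 0 → (∀ x ∉ W', T η x = ζ' x) ∧
      f η * wt b (ed W) η ≤ g (T η) * wt b (ed W') (T η)) : S b W ζ f ≤ S b W' ζ' g := by
  set D : Set Om := {η | (∀ x ∉ W, η x = ζ x) ∧ f η ≠ 0}
  set G : Om → ℝ≥0∞ := fun η => if ∀ x ∉ W', η x = ζ' x then g η * wt b (ed W') η else 0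
  have : S b W ζ f ≤ ∑' η : D, G (T η) := by
    rw [S, tsum_subtype D (fun η => G (T η))]
    refine ENNReal.tsum_le_tsum fun η => ?_
    by_cases hA : η ∈ D
    · obtain ⟨h1, h3⟩ := hs η hA.1 hA.2
      simp only [G, Set.indicator_of_mem hA]; rw [if_pos h1, if_pos hA.1]; exact h3
    · split_ifs with h
      · have : f η = 0 := by by_contra h2; exact hA ⟨h, h2⟩
        simp [this]
      · exact zero_le
  exact this.trans (ENNReal.tsum_comp_le_tsum_of_injective (f := fun η : D => T η)
    (fun x y h => Subtype.ext (hT x y x.2.1 y.2.1 x.2.2 y.2.2 h)) G)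
lemma S_map (T : Om → Om) (c : ℝ≥0∞) {ζ' : Om} (hT : Set.InjOn T A)
    (hs : ∀ η ∈ A, (∀ x ∉ W, η x = ζ x) → (∀ x ∉ W, T η x = ζ' x) ∧ T η ∈ B ∧
      c * wt b (ed W) η ≤ wt b (ed W) (T η)) : c * S b W ζ (ii A) ≤ S b W ζ' (ii B) := by
  rw [← S_smul]
  have hm : ∀ η, c * ii A η ≠ 0 → η ∈ A := fun η h => by
    by_contra h2; simp [ii, h2] at h
  refine S_mapf T (fun η η' _ _ h h' => hT (hm η h) (hm η' h')) fun η h h' => ?_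
  obtain ⟨h1, h2, h3⟩ := hs η (hm η h') h
  exact ⟨h1, by simpa [ii, hm η h', h2] using h3⟩

open scoped Real
open Real (exp log sqrt arctan exp_add exp_pos exp_le_exp exp_nat_mul exp_neg add_one_le_exp pi_gt_three log_nonneg log_le_log log_natCast_nonneg rpow_add rpow_one)
open ENNReal (ofReal ofReal_mul ofReal_le_ofReal ofReal_add)
open Finset (mem_filter sum_congr sum_le_sum sum_add_distrib mem_powerset mem_product sum_insert filter_subset sum_product sum_nonneg sum_le_sum_of_subset_of_nonneg)

def Ad (x y : Site) : Prop := ∃ e : Edge, (e.1 = x ∧ tg e = y) ∨ (e.1 = y ∧ tg e = x)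
lemma Ad.symm {x y : Site} (h : Ad x y) : Ad y x := by
  obtain ⟨e, h⟩ := h; exact ⟨e, h.symm⟩
def gl (W : Finset Site) (ζ ω : Om) : Om := fun x => if x ∈ W then ω x else ζ x
lemma wt_mul {F G : Finset Edge} (h : Disjoint F G) : wt b (F ∪ G) η = wt b F η * wt b G η := by
  rw [wt, wt, wt, ← ofReal_mul (exp_pos _).le, ← exp_add, en, Finset.sum_union h,
    mul_add]; rfl
lemma wt_congr {F : Finset Edge} {η η' : Om} (h : ∀ e ∈ F, gr η e = gr η' e) : wt b F η = wt b F η' := by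
  rw [wt, wt, en, en, sum_congr rfl fun e he => by rw [h e he]]
lemma ed_mono (h : W ⊆ Λ) : ed W ⊆ ed Λ := fun e he => by
  rw [mem_ed] at *; exact he.imp (@h _) (@h _)
lemma S_bc {ζ' : Om} (h : ∀ x ∈ W, ∀ y ∉ W, Ad x y → ζ y = ζ' y)
    (hf : ∀ η, (∀ x ∉ W, η x = ζ x) → f η ≤ g (gl W ζ' η)) : S b W ζ f ≤ S b W ζ' g := by
  refine S_mapf (gl W ζ') (fun η η' h1 h2 _ _ h3 => ?_) fun η h1 _ => ⟨fun x hx => by simp [gl, hx], ?_⟩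
  · ext x
    by_cases hx : x ∈ W
    · simpa [gl, hx] using congrFun h3 x
    · rw [h1 x hx, h2 x hx]
  · refine mul_le_mul' (hf η h1) (wt_congr fun e he => ?_).le
    have key : ∀ x y, x ∈ W → Ad x y → η y = gl W ζ' η y := fun x y hx ha => by
      by_cases hy : y ∈ W
      · simp [gl, hy]
      · simp [gl, hy, h1 y hy, h x hx y hy ha]
    rw [mem_ed] at he
    have h0 : ∀ x ∈ W, η x = gl W ζ' η x := fun x hx => by simp [gl, hx]
    rcases he with he | he
    · rw [gr, gr, key _ _ he ⟨e, .inl ⟨rfl, rfl⟩⟩, h0 _ he]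
    · rw [gr, gr, key _ e.1 he ⟨e, .inr ⟨rfl, rfl⟩⟩, h0 _ he]
lemma fiber (hW : W ⊆ Λ) (h : ∀ ξ, (∀ x ∉ Λ, ξ x = ζ x) → S b W ξ f ≤ S b W ξ g) :
    S b Λ ζ f ≤ S b Λ ζ g := by
  have key : ∀ f : Om → ℝ≥0∞, S b Λ ζ f = ∑' ξ : Om, (if (∀ x ∉ Λ, ξ x = ζ x) ∧ ∀ x ∈ W, ξ x =0 then
      wt b (ed Λ \ ed W) ξ * S b W ξ f else 0) := by
    intro f
    calc S b Λ ζ f = ∑' η : Om, ∑' ξ : Om, if ξ = gl W 0 0 + gl W η 0 then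
          (if ∀ x ∉ Λ, η x = ζ x then f η * wt b (ed Λ) η else 0) else 0 := by
          simp only [tsum_ite_eq]; rfl
      _ = _ := by
          rw [ENNReal.tsum_comm]; congr 1; ext ξ
          split_ifs with h1
          · rw [S, ← ENNReal.tsum_mul_left]; congr 1; ext η
            by_cases h2 : ∀ x ∉ W, η x = ξ x
            · rw [if_pos h2, if_pos, if_pos]
              · rw [← Finset.union_sdiff_of_subset (ed_mono hW), wt_mul Finset.disjoint_sdiff,
                  Finset.union_sdiff_of_subset (ed_mono hW),
                  wt_congr (η := η) (η' := ξ) (F := ed Λ \ ed W)]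
                · ring
                · intro e he
                  rw [Finset.mem_sdiff, mem_ed, mem_ed] at he
                  push Not at he
                  rw [gr, gr, h2 _ he.2.1, h2 _ he.2.2]
              · intro x hx; rw [h2 x (fun h => hx (hW h)), h1.1 x hx]
              · ext x; by_cases hx : x ∈ W <;> simp [gl, hx, h1.2, h2]
            · rw [if_neg h2, if_neg, mul_zero]
              rintro rfl; apply h2; intro x hx; simp [gl, hx]
          · rw [ENNReal.tsum_eq_zero]; intro η
            split_ifs with h2 h3
            · exfalso; apply h1; subst h2
              refine ⟨fun x hx => ?_, fun x hx => by simp [gl, hx]⟩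
              have : x ∉ W := fun h => hx (hW h)
              simp [gl, this, h3 x hx]
            · rfl
            · rfl
  rw [key, key]
  refine ENNReal.tsum_le_tsum fun ξ => ?_
  split_ifs with h1
  · exact mul_le_mul_right (h ξ h1.1) _
  · exact le_rfl
lemma four {f₁ f₂ f₃ f₄ : Om → ℝ≥0} (h : ∀ a c, f₁ a * f₂ c ≤ f₃ (a ⊓ c) * f₄ (a ⊔ c)) :
    (∑' a, (f₁ a : ℝ≥0∞)) * ∑' a, (f₂ a : ℝ≥0∞) ≤ (∑' a, (f₃ a : ℝ≥0∞)) * ∑' a, (f₄ a : ℝ≥0∞) := by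
  rw [ENNReal.tsum_eq_iSup_sum, ENNReal.iSup_mul]
  refine iSup_le fun s => ?_
  rw [ENNReal.tsum_eq_iSup_sum, ENNReal.mul_iSup]
  refine iSup_le fun t => ?_
  have := four_functions_theorem f₁ f₂ f₃ f₄ (fun _ => zero_le) (fun _ => zero_le)
    (fun _ => zero_le) (fun _ => zero_le) h s t
  refine le_trans ?_ (mul_le_mul' (ENNReal.sum_le_tsum (s ⊼ t)) (ENNReal.sum_le_tsum (s ⊻ t)))
  exact_mod_cast this
lemma wt_four (hb : 0 ≤ b) (F : Finset Edge) (η η' : Om) :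
    wt b F η * wt b F η' ≤ wt b F (η ⊓ η') * wt b F (η ⊔ η') := by
  simp only [wt]
  rw [← ofReal_mul (exp_pos _).le, ← ofReal_mul (exp_pos _).le,
    ← exp_add, ← exp_add]
  refine ofReal_le_ofReal (exp_le_exp.2 ?_)
  have : en F (η ⊓ η') + en F (η ⊔ η') ≤ en F η + en F η' := by
    simp only [en, ← sum_add_distrib]
    refine sum_le_sum fun e _ => ?_
    simp only [gr, Pi.inf_apply, Pi.sup_apply]
    norm_cast
    rcases le_total (η (tg e)) (η' (tg e)) with h | h <;> rcases le_total (η e.1) (η' e.1) with h' | h' <;>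
      simp only [h, h', inf_of_le_left, inf_of_le_right, sup_of_le_left, sup_of_le_right] <;>
      nlinarith [mul_nonneg (sub_nonneg.2 h) (sub_nonneg.2 h')]
  nlinarith
/-- Holley inequality with ordered boundary conditions -/
lemma LOC0 (hb : 0 ≤ b) {ζ' : Om} (h : ζ ≤ ζ')
    (hA : ∀ η η', η ∈ I → η ∈ E → η' ∈ J → η ⊓ η' ∈ I ∧ η ⊔ η' ∈ J ∧ η ⊔ η' ∈ E) :
    S b W ζ (ii (I ∩ E)) * S b W ζ' (ii J) ≤ S b W ζ (ii I) * S b W ζ' (ii (J ∩ E)) := by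
  have key : ∀ (ζ : Om) A, S b W ζ (ii A) = ∑' η : Om, ((if (∀ x ∉ W, η x = ζ x) ∧ η ∈ A then
      (exp (-b * en (ed W) η)).toNNReal else 0 : ℝ≥0) : ℝ≥0∞) := by
    intro ζ A; rw [S]; congr 1; ext η
    by_cases h1 : η ∈ A
    · split_ifs with h2 h3 h3 <;> simp_all [-Prod.forall, ii, wt, ofReal]
    · simp [-Prod.forall, h1, ii]
  simp only [key]
  refine four fun a c => ?_
  by_cases h1 : (∀ x ∉ W, a x = ζ x) ∧ a ∈ I ∩ E
  · by_cases h2 : (∀ x ∉ W, c x = ζ' x) ∧ c ∈ J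
    · obtain ⟨h3, h4, h5⟩ := hA a c h1.2.1 h1.2.2 h2.2
      rw [if_pos h1, if_pos h2, if_pos, if_pos]
      · have := wt_four hb (ed W) a c
        simp only [wt, ofReal] at this; exact_mod_cast this
      · exact ⟨fun x hx => by simp [h1.1 x hx, h2.1 x hx, h x], h4, h5⟩
      · exact ⟨fun x hx => by simp [h1.1 x hx, h2.1 x hx, h x], h3⟩
    · rw [if_neg h2, mul_zero]; exact zero_le
  · rw [if_neg h1, zero_mul]; exact zero_le
/-- event depending only on W -/
def On (W : Finset Site) (A : Set Om) : Prop := ∀ η η', (∀ x ∈ W, η x = η' x) → η ∈ A → η' ∈ A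
lemma S_bcii {ζ' : Om} (h : ∀ x ∈ W, ∀ y ∉ W, Ad x y → ζ y = ζ' y) (hA : On W A) :
    S b W ζ (ii A) = S b W ζ' (ii A) :=
  le_antisymm (S_bc h fun η _ => ii_le fun h1 => hA η _ (fun x hx => by simp [gl, hx]) h1)
    (S_bc (fun x hx y hy ha => (h x hx y hy ha).symm)
      fun η _ => ii_le fun h1 => hA η _ (fun x hx => by simp [gl, hx]) h1)
lemma On.inter (h : On W A) (h' : On W B) : On W (A ∩ B) :=
  fun η η' h1 h2 => ⟨h η η' h1 h2.1, h' η η' h1 h2.2⟩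
lemma LOC (hb : 0 ≤ b) {ζ' : Om} (h : ∀ x ∈ W, ∀ y ∉ W, Ad x y → ζ y ≤ ζ' y)
    (hI : On W I) (hJ : On W J) (hE : On W E)
    (hA : ∀ η η', η ∈ I → η ∈ E → η' ∈ J → η ⊓ η' ∈ I ∧ η ⊔ η' ∈ J ∧ η ⊔ η' ∈ E) :
    S b W ζ (ii (I ∩ E)) * S b W ζ' (ii J) ≤ S b W ζ (ii I) * S b W ζ' (ii (J ∩ E)) := by
  have h1 : ∀ x ∈ W, ∀ y ∉ W, Ad x y → ζ y = (ζ ⊓ ζ') y := fun x hx y hy ha => by simp [h x hx y hy ha]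
  have h2 : ∀ x ∈ W, ∀ y ∉ W, Ad x y → ζ' y = (ζ ⊔ ζ') y := fun x hx y hy ha => by simp [h x hx y hy ha]
  rw [S_bcii h1 hI, S_bcii h1 (hI.inter hE), S_bcii h2 hJ, S_bcii h2 (hJ.inter hE)]
  exact LOC0 hb (inf_le_left.trans le_sup_left) hA

inductive Kx (P : ℤ → Prop) (D : Finset Site) (η : Om) : Site → Prop
  | base (z : Site) : z ∉ D → P (η z) → Kx P D η z
  | step (y z : Site) : Kx P D η y → Ad y z → z ∈ D → P (η z) → Kx P D η z
def Vx (P : ℤ → Prop) (D : Finset Site) (η : Om) : Finset Site :=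
  D.filter fun y => ¬ Kx P D η y ∧ ∀ z, Ad y z → ¬ Kx P D η z
variable {P : ℤ → Prop} {D : Finset Site}
lemma Vx_sub : Vx P D η ⊆ D := filter_subset _ _
lemma Vx_eq {η' : Om} (h : ∀ z, (z ∈ D ∨ ∃ y ∈ D, Ad y z) → z ∉ Vx P D η → η' z = η z) :
    Vx P D η' = Vx P D η := by
  have h1 : ∀ z, Kx P D η z → (z ∈ D ∨ ∃ y ∈ D, Ad y z) → Kx P D η' z := by
    intro z hz
    induction hz with
    | base z hD hP => exact fun hn => .base z hD (by rwa [h z hn fun hh => hD (Vx_sub hh)])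
    | step y z hy ha hD hP ih =>
      refine fun hn => .step y z (ih (.inr ⟨z, hD, ha.symm⟩)) ha hD ?_
      rwa [h z hn]; intro hh; exact (mem_filter.1 hh).2.2 y ha.symm hy
  have h2 : ∀ z, Kx P D η' z → (z ∈ D ∨ ∃ y ∈ D, Ad y z) → Kx P D η z := by
    intro z hz
    induction hz with
    | base z hD hP => exact fun hn => .base z hD (by rwa [← h z hn fun hh => hD (Vx_sub hh)])
    | step y z hy ha hD hP ih =>
      have := ih (.inr ⟨z, hD, ha.symm⟩)
      refine fun hn => .step y z this ha hD ?_
      rwa [← h z hn]; intro hh; exact (mem_filter.1 hh).2.2 y ha.symm this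
  ext y
  simp only [Vx, mem_filter]
  refine and_congr_right fun hy => and_congr (not_congr ⟨fun h => h2 y h (.inl hy), fun h => h1 y h (.inl hy)⟩)
    (forall_congr' fun z => imp_congr_right fun ha => not_congr
      ⟨fun h => h2 z h (.inr ⟨y, hy, ha⟩), fun h => h1 z h (.inr ⟨y, hy, ha⟩)⟩)
lemma Vx_bd {x y : Site} (hx : x ∈ Vx P D η) (hy : y ∉ Vx P D η) (ha : Ad x y) : ¬ P (η y) := by
  intro hP
  obtain ⟨h1, h2, h3⟩ := mem_filter.1 hx
  by_cases hD : y ∈ D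
  · apply hy
    refine mem_filter.2 ⟨hD, h3 y ha, fun z hz hk => h3 y ha (.step z y hk hz.symm hD hP)⟩
  · exact h3 y ha (.base y hD hP)
lemma expl (hD : D ⊆ Λ)
    (h : ∀ ξ, (∀ x ∉ Λ, ξ x = ζ x) → S b (Vx P D ξ) ξ f ≤ S b (Vx P D ξ) ξ g) : S b Λ ζ f ≤ S b Λ ζ g := by
  have key : ∀ f, S b Λ ζ f = ∑ V ∈ D.powerset, S b Λ ζ (fun η => if Vx P D η = V then f η else 0) := by
    intro f; rw [← S_sum]; congr 1; ext η; rw [Finset.sum_ite_eq, if_pos (mem_powerset.2 Vx_sub)]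
  rw [key, key]
  refine sum_le_sum fun V hV => fiber ((mem_powerset.1 hV).trans hD) fun ξ hξ => ?_
  by_cases hv : Vx P D ξ = V
  · have : ∀ f, S b V ξ (fun η => if Vx P D η = V then f η else 0) = S b V ξ f := fun f =>
      S_congr fun η hη => if_pos (by rw [← hv]; exact Vx_eq fun z _ hz => hη z (hv ▸ hz))
    rw [this, this]; have := h ξ hξ; rwa [hv] at this
  · refine (S_mono (g := fun _ => 0) fun η hη => ?_).trans (S_mono fun _ _ => zero_le)
    rw [if_neg]; intro hv'; apply hv; rw [← hv']
    exact Vx_eq fun z _ hz => (hη z (hv' ▸ hz)).symm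

def row (x : Site) (i : ℕ) : Edge := ((x.1 + i, x.2), true)
lemma ray (hη : ∀ x ∉ W, η x =0) (x : Site) : ∃ s ⊆ ed W, η x = - ∑ e ∈ s, gr η e := by
  have hk : ∀ k : ℕ, η (x.1 + k, x.2) - η x = ∑ i ∈ Finset.range k, gr η (row x i) := by
    intro k; induction k with
    | zero => simp
    | succ k ih => rw [Finset.sum_range_succ, ← ih]; simp [gr, row, tg, add_assoc]
  obtain ⟨k, hk2⟩ : ∃ k : ℕ, (x.1 + (k : ℤ), x.2) ∉ W := by
    by_contra! h
    exact Set.infinite_of_injective_forall_mem (f := fun k : ℕ => ((x.1 + (k : ℤ), x.2) : Site))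
      (fun a c h => by simpa using h) h W.finite_toSet
  refine ⟨((Finset.range k).image (row x)).filter (· ∈ ed W), fun _ h => (mem_filter.1 h).2, ?_⟩
  have := hk k
  rw [hη _ hk2] at this
  rw [Finset.sum_filter_of_ne, Finset.sum_image, ← this]; · ring
  · intro a _ c _ h; simpa [row] using h
  · intro e _ he; by_contra h; apply he; rw [mem_ed] at h; push Not at h
    simp [gr, hη _ h.1, hη _ h.2]
lemma abs_le_en (hη : ∀ x ∉ W, η x =0) (x : Site) : |(η x : ℝ)| ≤ en (ed W) η := by
  obtain ⟨s, hs, h⟩ := ray hη x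
  rw [h]; push_cast; rw [abs_neg]
  refine (Finset.abs_sum_le_sum_abs _ _).trans ((sum_le_sum_of_subset_of_nonneg hs fun _ _ _ => abs_nonneg _).trans
    (sum_le_sum fun e _ => ?_))
  norm_cast; rw [← sq_abs]; nlinarith [abs_nonneg (gr η e), Int.le_self_sq |gr η e|]
lemma pi_fin (r : ℤ → ℝ≥0∞) (hr : ∑' n, r n ≠ ⊤) (W : Finset Site) :
    ∑' η : Om, (if ∀ x ∉ W, η x =0 then ∏ x ∈ W, r (η x) else 0) ≠ ⊤ := by
  induction W using Finset.induction_on with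
  | empty =>
    rw [tsum_eq_single (0 : Om)]
    · split_ifs <;> simp
    · intro η hη; rw [if_neg]; intro h; exact hη (funext fun x => h x (by simp))
  | insert a W ha ih =>
    refine ne_top_of_le_ne_top (ENNReal.mul_ne_top ih hr) ?_
    rw [← ENNReal.tsum_mul_right]
    simp_rw [← ENNReal.tsum_mul_left]
    rw [← ENNReal.tsum_prod' (f := fun p : Om × ℤ => (if ∀ x ∉ W, p.1 x =0 then ∏ x ∈ W, r (p.1 x) else 0) * r p.2)]
    refine le_trans (ENNReal.tsum_le_tsum fun η => ?_) (ENNReal.tsum_comp_le_tsum_of_injective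
      (f := fun η : Om => (Function.update η a 0, η a)) (fun η η' h => ?_) _)
    · split_ifs with h1 h2 h2
      · rw [Finset.prod_insert ha, mul_comm]
        refine mul_le_mul' (Finset.prod_congr rfl fun x hx => ?_).le le_rfl
        simp only; rw [Function.update_of_ne (ne_of_mem_of_not_mem hx ha)]
      · exfalso; apply h2; intro x hx
        by_cases hxa : x = a
        · subst hxa; simp
        · simp only; rw [Function.update_of_ne hxa]; exact h1 x (by simp [hx, hxa])
      all_goals exact zero_le
    · simp only [Prod.mk.injEq] at h
      ext x; by_cases hxa : x = a
      · rw [hxa, h.2]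
      · simpa [Function.update_of_ne hxa] using congrFun h.1 x
lemma geo_fin {c : ℝ} (hc : 0 < c) : ∑' n : ℤ, ofReal (exp (-c * |(n : ℝ)|)) ≠ ⊤ := by
  have h1 : Summable fun n : ℕ => exp (-c * n) := by
    refine (summable_geometric_of_lt_one (exp_pos (-c)).le (by simpa using hc)).congr fun n => ?_
    rw [← exp_nat_mul, mul_comm]
  have : Summable fun n : ℤ => exp (-c * |(n : ℝ)|) := by
    refine Summable.of_nat_of_neg ?_ ?_ <;> simpa using h1
  rw [← ENNReal.ofReal_tsum_of_nonneg (fun _ => (exp_pos _).le) this]; simp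
lemma S_fin (hb : 0 < b) : S b W 0 (fun _ => 1) ≠ ⊤ := by
  rcases W.eq_empty_or_nonempty with rfl | hW
  · rw [S, tsum_eq_single (0 : Om)]
    · split_ifs <;> simp [wt]
    · intro η hη; rw [if_neg]; intro h; exact hη (funext fun x => h x (by simp))
  have hc : (0:ℝ) < W.card := by exact_mod_cast hW.card_pos
  refine ne_top_of_le_ne_top (pi_fin _ (geo_fin (div_pos hb hc)) W) (ENNReal.tsum_le_tsum fun η => ?_)
  simp only [Pi.zero_apply, one_mul]
  split_ifs with h
  · rw [← ENNReal.ofReal_prod_of_nonneg (fun _ _ => (exp_pos _).le), ← Real.exp_sum, wt]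
    refine ofReal_le_ofReal (exp_le_exp.2 ?_)
    rw [← Finset.mul_sum]
    have : ∑ x ∈ W, |(η x : ℝ)| ≤ W.card * en (ed W) η := by
      rw [← nsmul_eq_mul]; exact Finset.sum_le_card_nsmul _ _ _ fun x _ => abs_le_en h x
    rw [neg_mul, neg_mul, neg_le_neg_iff, div_mul_eq_mul_div, div_le_iff₀ hc]; nlinarith
  · exact le_rfl
lemma S_pos (hζ : η ∈ A) (h : ∀ x ∉ W, η x = ζ x) : S b W ζ (ii A) ≠ 0 := by
  intro h0
  have := ENNReal.tsum_eq_zero.1 h0 η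
  rw [if_pos h] at this; simp [ii, hζ, wt] at this
  exact absurd this (not_le.2 (exp_pos _))
lemma S_fin' (hb : 0 < b) : S b W 0 (ii A) ≠ ⊤ :=
  ne_top_of_le_ne_top (S_fin hb) (S_mono fun η _ => by by_cases h : η ∈ A <;> simp [ii, h])

section grif
variable {ι κ : Type} [Fintype ι] [DecidableEq ι]
lemma grif (Q : Finset (ℤ × ℤ)) (ψ : ι → ℤ × ℤ → ℝ)
    (h : ∀ z (m n : ℕ), 0 ≤ ∑ p ∈ Q, ψ z p * ((p.1 + p.2 : ℝ) ^ m * (p.1 - p.2 : ℝ) ^ n))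
    (F : Finset κ) (u v : κ → ι) {c : ℝ} (hc : 0 ≤ c) :
    0 ≤ ∑ t ∈ Fintype.piFinset fun _ : ι => Q, (∏ z, ψ z (t z)) *
      exp (∑ e ∈ F, 2 * c * ((t (u e)).1 * (t (v e)).1 + (t (u e)).2 * (t (v e)).2)) := by
  set s : (ι → ℤ × ℤ) → ι → ℝ := fun t z => (t z).1 + (t z).2
  set d : (ι → ℤ × ℤ) → ι → ℝ := fun t z => (t z).1 - (t z).2
  set Pos : ((ι → ℤ × ℤ) → ℝ) → Prop := fun Φ => ∀ m n : ι → ℕ, 0 ≤ ∑ t ∈ Fintype.piFinset fun _ : ι => Q,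
    (∏ z, ψ z (t z) * (s t z ^ m z * d t z ^ n z)) * Φ t with hPos
  have p1 : Pos fun _ => 1 := fun m n => by
    simp only [mul_one]
    rw [← Finset.prod_univ_sum (fun _ : ι => Q) fun z p => ψ z p * ((p.1 + p.2 : ℝ) ^ m z * (p.1 - p.2 : ℝ) ^ n z)]
    exact Finset.prod_nonneg fun z _ => h z _ _
  have e1 : ∀ (x : ι → ℝ) (m : ι → ℕ) a, ∏ z, x z ^ (m + Pi.single a 1 : ι → ℕ) z = (∏ z, x z ^ m z) * x a := fun x m a => by
    simp only [Pi.add_apply, pow_add, Finset.prod_mul_distrib]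
    congr 1
    rw [Finset.prod_eq_single a] <;> simp +contextual [Pi.single_apply]
  have ps : ∀ Φ a, Pos Φ → Pos fun t => s t a * Φ t := fun Φ a hΦ m n => by
    refine (hΦ (m + Pi.single a 1) n).trans_eq (sum_congr rfl fun t _ => ?_)
    simp only [Finset.prod_mul_distrib, e1]; ring
  have pd : ∀ Φ a, Pos Φ → Pos fun t => d t a * Φ t := fun Φ a hΦ m n => by
    refine (hΦ m (n + Pi.single a 1)).trans_eq (sum_congr rfl fun t _ => ?_)
    simp only [Finset.prod_mul_distrib, e1]; ring
  set Jf : (ι → ℤ × ℤ) → ℝ := fun t => ∑ e ∈ F, c * (s t (u e) * s t (v e) + d t (u e) * d t (v e)) with hJ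
  have pJ : ∀ Φ, Pos Φ → Pos fun t => Jf t * Φ t := fun Φ hΦ m n => by
    have := sum_nonneg fun e (_ : e ∈ F) => mul_nonneg hc
      (add_nonneg (ps _ (u e) (ps _ (v e) hΦ) m n) (pd _ (u e) (pd _ (v e) hΦ) m n))
    refine this.trans_eq ?_
    simp only [hJ, ← sum_add_distrib, Finset.mul_sum, Finset.sum_mul]
    rw [Finset.sum_comm]
    refine sum_congr rfl fun t _ => sum_congr rfl fun e _ => by ring
  have pk : ∀ k : ℕ, Pos fun t => Jf t ^ k := fun k => by
    induction k with
    | zero => simpa using p1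
    | succ k ih => simpa [pow_succ, mul_comm] using pJ _ ih
  have he : HasSum (fun k : ℕ => ∑ t ∈ Fintype.piFinset fun _ : ι => Q, (∏ z, ψ z (t z)) * (Jf t ^ k / k.factorial))
      (∑ t ∈ Fintype.piFinset fun _ : ι => Q, (∏ z, ψ z (t z)) * exp (Jf t)) := by
    refine hasSum_sum fun t _ => HasSum.mul_left _ ?_
    rw [Real.exp_eq_exp_ℝ]; exact NormedSpace.expSeries_div_hasSum_exp (Jf t)
  have := he.nonneg fun k => by
    have h2 := div_nonneg (pk k 0 0) (Nat.cast_nonneg (α := ℝ) k.factorial)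
    simp only [Pi.zero_apply, pow_zero, mul_one, Finset.sum_div, mul_div_assoc] at h2; exact h2
  refine this.trans_eq (sum_congr rfl fun t _ => ?_)
  congr 2; rw [hJ]; refine sum_congr rfl fun e _ => ?_
  simp only [s, d]; ring
lemma sgl {Q : Finset (ℤ × ℤ)} (hσ : ∀ p ∈ Q, (p.2, p.1) ∈ Q) (hν : ∀ p ∈ Q, (-p.2, -p.1) ∈ Q) {ψ : ℤ × ℤ → ℝ} {ε : ℝ}
    (h1 : ∀ p, ψ (p.2, p.1) = ε * ψ p) (h2 : ∀ p, ψ (-p.2, -p.1) = ε * ψ p)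
    (h3 : ε =1 ∧ (∀ p, 0 ≤ ψ p) ∨ ε = -1 ∧ ∀ p, 0 ≤ ψ p * ((p.1 + p.2) * (p.1 - p.2) : ℝ)) (m n : ℕ) :
    0 ≤ ∑ p ∈ Q, ψ p * ((p.1 + p.2 : ℝ) ^ m * (p.1 - p.2 : ℝ) ^ n) := by
  set X := ∑ p ∈ Q, ψ p * ((p.1 + p.2 : ℝ) ^ m * (p.1 - p.2 : ℝ) ^ n) with hX
  have e1 : X = ε * (-1) ^ n * X := by
    rw [hX, Finset.mul_sum]
    refine Finset.sum_nbij' (fun p => (p.2, p.1)) (fun p => (p.2, p.1)) hσ hσ (by simp) (by simp) fun p _ => ?_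
    have : ε * ε =1 := by rcases h3 with h | h <;> simp [h.1]
    have h4 : ψ p = ε * ψ (p.2, p.1) := by rw [h1, ← mul_assoc, this, one_mul]
    rw [h4]; simp only
    rw [show ((p.1:ℝ) - p.2) = -1 * (p.2 - p.1) by ring, mul_pow, add_comm (p.1 : ℝ)]; ring
  have e2 : X = ε * (-1) ^ m * X := by
    rw [hX, Finset.mul_sum]
    refine Finset.sum_nbij' (fun p => (-p.2, -p.1)) (fun p => (-p.2, -p.1)) hν hν (by simp) (by simp) fun p _ => ?_
    have : ε * ε =1 := by rcases h3 with h | h <;> simp [h.1]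
    have h4 : ψ p = ε * ψ (-p.2, -p.1) := by rw [h2, ← mul_assoc, this, one_mul]
    rw [h4]; simp only
    push_cast
    rw [show ((p.1:ℝ) + p.2) = -1 * (-p.2 + -p.1) by ring, mul_pow, show (-(p.2:ℝ) - -p.1) = p.1 - p.2 by ring]; ring
  rcases h3 with ⟨rfl, h3⟩ | ⟨rfl, h3⟩
  · rcases Nat.even_or_odd n with hn | hn
    · rcases Nat.even_or_odd m with hm | hm
      · exact sum_nonneg fun p _ => mul_nonneg (h3 p) (mul_nonneg (hm.pow_nonneg _) (hn.pow_nonneg _))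
      · rw [hm.neg_one_pow] at e2; linarith
    · rw [hn.neg_one_pow] at e1; linarith
  · rcases Nat.even_or_odd n with hn | hn
    · rw [hn.neg_one_pow] at e1; linarith
    · rcases Nat.even_or_odd m with hm | hm
      · rw [hm.neg_one_pow] at e2; linarith
      · obtain ⟨i, rfl⟩ := hn; obtain ⟨k, rfl⟩ := hm
        refine sum_nonneg fun p _ => ?_
        have := mul_nonneg (h3 p) (mul_nonneg (sq_nonneg ((p.1 + p.2 : ℝ) ^ k)) (sq_nonneg ((p.1 - p.2 : ℝ) ^ i)))
        refine this.trans_eq ?_; ring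
/-- `1{|t| ≥ j}` -/
def ch (j t : ℤ) : ℝ := if j ≤ |t| then 1 else 0
lemma ch_mul (i j t t' : ℤ) : 0 ≤ (ch i t - ch i t') * (ch j t - ch j t') := by
  simp only [ch]; split_ifs <;> first | (norm_num; done) | (exfalso; omega)
lemma ch_sq (i t t' : ℤ) : 0 ≤ (ch i t - ch i t') * ((t + t') * (t - t') : ℝ) := by
  have : ((t : ℝ) + t') * (t - t') = |(t:ℝ)| ^2 - |(t':ℝ)| ^2 := by rw [sq_abs, sq_abs]; ring
  rw [this]; simp only [ch]
  have h0 := abs_nonneg (t : ℝ); have h1 := abs_nonneg (t' : ℝ)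
  split_ifs with h h' h'
  · simp
  · have : |(t':ℝ)| ≤ |(t:ℝ)| := by norm_cast; omega
    nlinarith
  · have : |(t:ℝ)| ≤ |(t':ℝ)| := by norm_cast; omega
    nlinarith
  · simp
lemma grif2 (N : ℕ) (r : ι → ℝ) (F : Finset κ) (u v : κ → ι) {c : ℝ} (hc : 0 ≤ c) (x y : ι) (i j : ℤ) :
    let T := Fintype.piFinset fun _ : ι => Finset.Icc (-(N:ℤ)) N
    let w : (ι → ℤ) → ℝ := fun t => (∏ z, exp (- r z * (t z) ^2)) * exp (∑ e ∈ F, 2 * c * (t (u e) * t (v e)))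
    (∑ t ∈ T, ch i (t x) * w t) * ∑ t ∈ T, ch j (t y) * w t ≤ (∑ t ∈ T, ch i (t x) * ch j (t y) * w t) * ∑ t ∈ T, w t := by
  intro T w
  set Q := Finset.Icc (-(N:ℤ)) N ×ˢ Finset.Icc (-(N:ℤ)) N
  have key := grif Q (fun z p => exp (- r z * p.1 ^2) * exp (- r z * p.2 ^2) *
    ((if z = x then ch i p.1 - ch i p.2 else 1) * (if z = y then ch j p.1 - ch j p.2 else 1))) (fun z => ?_) F u v hc
  · have h1 : (0:ℝ) ≤ ∑ t ∈ T, ∑ t' ∈ T, (ch i (t x) - ch i (t' x)) * (ch j (t y) - ch j (t' y)) * (w t * w t') := by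
      refine key.trans_eq ?_
      rw [← Finset.sum_product']
      refine Finset.sum_nbij' (fun t => (fun z => (t z).1, fun z => (t z).2)) (fun p z => (p.1 z, p.2 z)) ?_ ?_
        (fun _ _ => rfl) (fun _ _ => rfl) fun t _ => ?_
      · intro t ht; simp only [T, Q, Fintype.mem_piFinset, mem_product] at *
        exact ⟨fun z => (ht z).1, fun z => (ht z).2⟩
      · intro t ht; simp only [T, Q, Fintype.mem_piFinset, mem_product] at *
        exact fun z => ⟨ht.1 z, ht.2 z⟩
      · simp only [Finset.prod_mul_distrib, Finset.prod_ite_eq', Finset.mem_univ, if_true, w, mul_add,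
          sum_add_distrib, exp_add]; ring
    have h2 : ∑ t ∈ T, ∑ t' ∈ T, (ch i (t x) - ch i (t' x)) * (ch j (t y) - ch j (t' y)) * (w t * w t') =
        2 * ((∑ t ∈ T, ch i (t x) * ch j (t y) * w t) * ∑ t ∈ T, w t) -
        2 * ((∑ t ∈ T, ch i (t x) * w t) * ∑ t ∈ T, ch j (t y) * w t) := by
      have e1 : ∀ F G : (ι → ℤ) → ℝ, (∑ t ∈ T, F t) * ∑ t ∈ T, G t = ∑ t ∈ T, ∑ t' ∈ T, F t * G t' :=
        fun F G => Finset.sum_mul_sum _ _ _ _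
      have e2 : ∀ F G : (ι → ℤ) → ℝ, (∑ t ∈ T, F t) * ∑ t ∈ T, G t = ∑ t ∈ T, ∑ t' ∈ T, F t' * G t :=
        fun F G => by rw [mul_comm, Finset.sum_mul_sum]; simp only [mul_comm]
      rw [two_mul, two_mul]
      nth_rw 1 [e1]; nth_rw 1 [e2]; nth_rw 1 [e1]; nth_rw 1 [e2]
      simp only [← sum_add_distrib, ← Finset.sum_sub_distrib]
      refine sum_congr rfl fun t _ => sum_congr rfl fun t' _ => by ring
    linarith
  · have hQ1 : ∀ p ∈ Q, (p.2, p.1) ∈ Q := by simp [Q]; omega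
    have hQ2 : ∀ p ∈ Q, (-p.2, -p.1) ∈ Q := by simp [Q]; omega
    have hn : ∀ i t, ch i (-t) = ch i t := by simp [ch]
    refine sgl hQ1 hQ2 (ε := (if z = x then -1 else 1) * (if z = y then -1 else 1)) ?_ ?_ ?_
    · intro p; simp only; split_ifs <;> ring
    · intro p; simp only [hn]; push_cast; simp only [neg_sq]; split_ifs <;> ring
    · have h0 : ∀ p : ℤ × ℤ, 0 ≤ exp (- r z * p.1 ^2) * exp (- r z * p.2 ^2) := fun p => by positivity
      split_ifs
      · left; exact ⟨by norm_num, fun p => mul_nonneg (h0 p) (ch_mul _ _ _ _)⟩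
      · right; refine ⟨by norm_num, fun p => ?_⟩
        rw [mul_assoc, mul_one]; exact mul_nonneg (h0 p) (ch_sq _ _ _)
      · right; refine ⟨by norm_num, fun p => ?_⟩
        rw [mul_assoc, one_mul]; exact mul_nonneg (h0 p) (ch_sq _ _ _)
      · left; exact ⟨by norm_num, fun p => mul_nonneg (h0 p) (by norm_num)⟩
end grif
def ex (W : Finset Site) (t : W → ℤ) : Om := fun x => if h : x ∈ W then t ⟨x, h⟩ else 0
lemma ex_val (t : W → ℤ) (z : W) : ex W t z = t z := by simp [ex]
lemma ex_sum (t : W → ℤ) (p : Site) : ∑ z : W, (if p = z.1 then (1:ℝ) else 0) * (t z : ℝ) ^2 = (ex W t p : ℝ) ^2 := by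
  by_cases h : p ∈ W
  · rw [Finset.sum_eq_single ⟨p, h⟩]
    · simp [ex, h]
    · intro z _ hz; rw [if_neg, zero_mul]; rintro rfl; exact hz rfl
    · simp
  · rw [Finset.sum_eq_zero]
    · simp [ex, h]
    · intro z _; rw [if_neg, zero_mul]; rintro rfl; exact h z.2
lemma S_ex : S b W 0 f = ∑' t : W → ℤ, f (ex W t) * wt b (ed W) (ex W t) := by
  have inj : Function.Injective (ex W) := fun t t' h => by
    ext z; rw [← ex_val t, h, ex_val]
  rw [S, ← inj.tsum_eq]
  · congr 1; ext t; rw [if_pos]; intro x hx; simp [ex, hx]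
  · intro η hη
    refine ⟨fun z => η z, ?_⟩
    have : ∀ x ∉ W, η x =0 := by
      by_contra h; simp only [Function.mem_support] at hη; exact hη (if_neg h)
    ext x; by_cases hx : x ∈ W <;> simp [ex, hx, this]
lemma grifS (hb : 0 ≤ b) {x y : Site} (hx : x ∈ W) (hy : y ∈ W) (i j : ℤ) :
    S b W 0 (ii {η | i ≤ |η x|}) * S b W 0 (ii {η | j ≤ |η y|}) ≤
      S b W 0 (ii ({η | i ≤ |η x|} ∩ {η | j ≤ |η y|})) * S b W 0 (ii Set.univ) := by
  set u : Edge → W := fun e => if h : tg e ∈ W then ⟨_, h⟩ else ⟨x, hx⟩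
  set v : Edge → W := fun e => if h : e.1 ∈ W then ⟨_, h⟩ else ⟨x, hx⟩
  set F := (ed W).filter fun e => e.1 ∈ W ∧ tg e ∈ W
  set r : W → ℝ := fun z => ∑ e ∈ ed W, b * ((if tg e = z then 1 else 0) + (if e.1 = z then 1 else 0))
  set w : (W → ℤ) → ℝ := fun t => (∏ z, exp (- r z * (t z) ^2)) * exp (∑ e ∈ F, 2 * b * (t (u e) * t (v e)))
  have hw0 : ∀ t, 0 ≤ w t := fun t => by positivity
  have hw : ∀ t, wt b (ed W) (ex W t) = ofReal (w t) := fun t => by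
    rw [wt]; congr 1
    simp only [w]
    rw [← Real.exp_sum, ← exp_add]; congr 1
    have h1 : ∑ z, -r z * (t z : ℝ) ^2 = - ∑ e ∈ ed W, b * ((ex W t (tg e) : ℝ) ^2 + (ex W t e.1 : ℝ) ^2) := by
      simp only [r, neg_mul, Finset.sum_neg_distrib, Finset.sum_mul]
      rw [Finset.sum_comm]; congr 1
      refine sum_congr rfl fun e _ => ?_
      rw [← ex_sum, ← ex_sum, ← sum_add_distrib, Finset.mul_sum]
      refine sum_congr rfl fun z _ => by ring
    have h2 : ∑ e ∈ F, 2 * b * ((t (u e) : ℝ) * t (v e)) = ∑ e ∈ ed W, 2 * b * ((ex W t (tg e) : ℝ) * ex W t e.1) := by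
      rw [Finset.sum_filter]
      refine sum_congr rfl fun e _ => ?_
      split_ifs with h
      · simp only [u, v, ex, h.1, h.2, dif_pos]
      · rw [not_and_or] at h; rcases h with h | h <;> simp [ex, h]
    rw [h1, h2, en, Finset.mul_sum, ← Finset.sum_neg_distrib, ← sum_add_distrib]
    refine sum_congr rfl fun e _ => ?_
    simp only [gr]; push_cast; ring
  have hf : ∀ (A : Set Om) (c : (W → ℤ) → ℝ) (s : Finset (W → ℤ)), (∀ t, 0 ≤ c t) → (∀ t, ii A (ex W t) = ofReal (c t)) →
      ∑ t ∈ s, ii A (ex W t) * wt b (ed W) (ex W t) = ofReal (∑ t ∈ s, c t * w t) := fun A c s hc hA => by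
    rw [ENNReal.ofReal_sum_of_nonneg fun t _ => mul_nonneg (hc t) (hw0 t)]
    refine sum_congr rfl fun t _ => ?_
    rw [hA, hw, ofReal_mul (hc t)]
  have hch : ∀ i t, 0 ≤ ch i t := fun i t => by simp only [ch]; positivity
  have a1 : ∀ i x (hx : x ∈ W) t, ii {η | i ≤ |η x|} (ex W t) = ofReal (ch i (t ⟨x, hx⟩)) := fun i x hx t => by
    simp only [ii, ch, Set.indicator, Set.mem_setOf_eq, ex, hx, dif_pos]
    split_ifs <;> simp
  have a2 : ∀ t, ii ({η | i ≤ |η x|} ∩ {η | j ≤ |η y|}) (ex W t) = ofReal (ch i (t ⟨x, hx⟩) * ch j (t ⟨y, hy⟩)) := fun t => by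
    rw [ofReal_mul (hch _ _), ← a1, ← a1, ii, ii, ii, Set.inter_indicator_one]; rfl
  rw [S_ex, S_ex, S_ex, S_ex, ENNReal.tsum_eq_iSup_sum, ENNReal.iSup_mul]
  refine iSup_le fun s => ?_
  rw [ENNReal.tsum_eq_iSup_sum, ENNReal.mul_iSup]
  refine iSup_le fun s' => ?_
  obtain ⟨N, hN⟩ : ∃ N : ℕ, s ∪ s' ⊆ Fintype.piFinset fun _ : W => Finset.Icc (-(N:ℤ)) N := by
    refine ⟨∑ t ∈ s ∪ s', ∑ z, (t z).natAbs, fun t ht => ?_⟩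
    rw [Fintype.mem_piFinset]; intro z
    have h1 := Finset.single_le_sum (f := fun t : W → ℤ => ∑ z, (t z).natAbs) (fun _ _ => Nat.zero_le _) ht
    have h2 := Finset.single_le_sum (f := fun z => (t z).natAbs) (fun _ _ => Nat.zero_le _) (Finset.mem_univ z)
    rw [Finset.mem_Icc]; have := h2.trans h1; omega
  have g := grif2 N r F u v hb ⟨x, hx⟩ ⟨y, hy⟩ i j
  simp only at g
  set T := Fintype.piFinset fun _ : W => Finset.Icc (-(N:ℤ)) N
  refine (mul_le_mul' (Finset.sum_le_sum_of_subset (Finset.subset_union_left.trans hN))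
    (Finset.sum_le_sum_of_subset (Finset.subset_union_right.trans hN))).trans ?_
  refine le_trans ?_ (mul_le_mul' (ENNReal.sum_le_tsum T) (ENNReal.sum_le_tsum T))
  rw [hf _ _ T (fun t => hch i (t ⟨x, hx⟩)) (a1 i x hx), hf _ _ T (fun t => hch j (t ⟨y, hy⟩)) (a1 j y hy),
    hf _ _ T (fun t => mul_nonneg (hch i (t ⟨x, hx⟩)) (hch j (t ⟨y, hy⟩))) a2,
    hf _ (fun _ => 1) T (fun t => zero_le_one) (fun t => by simp [ii]),
    ← ofReal_mul, ← ofReal_mul]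
  · refine ofReal_le_ofReal ?_
    simp only [one_mul]; exact g
  · exact sum_nonneg fun t _ => mul_nonneg (mul_nonneg (hch _ _) (hch _ _)) (hw0 t)
  · exact sum_nonneg fun t _ => mul_nonneg (hch _ _) (hw0 t)
lemma S_ins {y : Site} (hy : y ∉ W) : S b W 0 (ii A) = S b (insert y W) 0 (ii (A ∩ {η | η y =0})) := by
  rw [S, S]; congr 1; ext η
  by_cases h : ∀ x ∉ W, η x = (0 : Om) x
  · rw [if_pos h, if_pos (fun x hx => h x (fun h' => hx (Finset.mem_insert_of_mem h')))]
    congr 1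
    · have := h y hy; by_cases hA : η ∈ A <;> simp_all [ii, Set.indicator]
    · simp only [wt, en]
      rw [Finset.sum_subset (ed_mono (Finset.subset_insert y W))]
      intro e he he'
      rw [mem_ed] at he'; push Not at he'
      simp [gr, h _ he'.1, h _ he'.2]
  · rw [if_neg h]; split_ifs with h1
    · by_cases h2 : η ∈ A ∩ {η | η y =0}
      · exfalso; apply h; intro x hx
        by_cases hxy : x = y
        · rw [hxy]; exact h2.2
        · exact h1 x (by simp [hxy, hx])
      · simp [ii, h2]
    · rfl
lemma Amono1 (hb : 0 < b) {x y : Site} (hx : x ∈ W) (hy : y ∉ W) (i : ℤ) :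
    S b W 0 (ii {η | i ≤ |η x|}) * S b (insert y W) 0 (ii Set.univ) ≤
      S b (insert y W) 0 (ii {η | i ≤ |η x|}) * S b W 0 (ii Set.univ) := by
  have g := grifS hb.le (Finset.mem_insert_of_mem (b := y) hx) (Finset.mem_insert_self y W) i 1
  rw [S_ins hy, S_ins hy, Set.univ_inter]
  have sp : ∀ A : Set Om, S b (insert y W) 0 (ii A) = S b (insert y W) 0 (ii (A ∩ {η | η y =0})) +
      S b (insert y W) 0 (ii (A ∩ {η | 1 ≤ |η y|})) := fun A => by
    rw [← S_add]; refine S_congr fun η _ => ?_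
    by_cases hA : η ∈ A <;> by_cases h0 : η y =0
    · simp [ii, hA, h0]
    · have : 1 ≤ |η y| := Int.one_le_abs h0
      simp [ii, hA, h0, this]
    · simp [ii, hA]
    · simp [ii, hA]
  have s1 := sp Set.univ; have s2 := sp {η | i ≤ |η x|}
  rw [Set.univ_inter, Set.univ_inter] at s1
  rw [s1, s2] at g ⊢
  have f1 : ∀ A, S b (insert y W) 0 (ii A) ≠ ⊤ := fun A => S_fin' hb
  generalize S b (insert y W) 0 (ii {η | η y =0}) = d at *
  have f2 := f1 {η | 1 ≤ |η y|}
  generalize S b (insert y W) 0 (ii {η | 1 ≤ |η y|}) = e at *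
  generalize S b (insert y W) 0 (ii ({η | i ≤ |η x|} ∩ {η | η y =0})) = a at *
  have f3 := f1 ({η | i ≤ |η x|} ∩ {η | 1 ≤ |η y|})
  generalize S b (insert y W) 0 (ii ({η | i ≤ |η x|} ∩ {η | 1 ≤ |η y|})) = c at *
  have h : a * e + c * e ≤ c * d + c * e := by rw [← add_mul, ← mul_add]; exact g
  have h2 : a * e ≤ c * d := (ENNReal.add_le_add_iff_right (ENNReal.mul_ne_top f3 f2)).1 h
  rw [mul_add, add_mul]; gcongr
lemma Amono2 (hb : 0 < b) {x : Site} (hx : x ∈ W) (h : W ⊆ Λ) (i : ℤ) :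
    S b W 0 (ii {η | i ≤ |η x|}) * S b Λ 0 (ii Set.univ) ≤
      S b Λ 0 (ii {η | i ≤ |η x|}) * S b W 0 (ii Set.univ) := by
  have key : ∀ V : Finset Site, S b W 0 (ii {η | i ≤ |η x|}) * S b (W ∪ V) 0 (ii Set.univ) ≤
      S b (W ∪ V) 0 (ii {η | i ≤ |η x|}) * S b W 0 (ii Set.univ) := fun V => by
    induction V using Finset.induction_on with
    | empty => simp
    | insert y V hy ih =>
      rw [Finset.union_insert]
      by_cases hy : y ∈ W ∪ V
      · rw [Finset.insert_eq_of_mem hy]; exact ih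
      · have h1 := Amono1 hb (Finset.mem_union_left V hx) hy i
        have f1 : S b (W ∪ V) 0 (ii Set.univ) ≠ ⊤ := S_fin' hb
        have f2 : S b (W ∪ V) 0 (ii Set.univ) ≠ 0 := S_pos (η := 0) trivial fun _ _ => rfl
        rw [← ENNReal.mul_le_mul_iff_right f2 f1]
        calc _ = (S b W 0 (ii {η | i ≤ |η x|}) * S b (W ∪ V) 0 (ii Set.univ)) * S b (insert y (W ∪ V)) 0 (ii Set.univ) := by ring
          _ ≤ (S b (W ∪ V) 0 (ii {η | i ≤ |η x|}) * S b W 0 (ii Set.univ)) * S b (insert y (W ∪ V)) 0 (ii Set.univ) := by gcongr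
          _ = (S b (W ∪ V) 0 (ii {η | i ≤ |η x|}) * S b (insert y (W ∪ V)) 0 (ii Set.univ)) * S b W 0 (ii Set.univ) := by ring
          _ ≤ (S b (insert y (W ∪ V)) 0 (ii {η | i ≤ |η x|}) * S b (W ∪ V) 0 (ii Set.univ)) * S b W 0 (ii Set.univ) := by gcongr
          _ = _ := by ring
  have := key Λ
  rwa [Finset.union_eq_right.2 h] at this
lemma S_neg : S b W 0 f = S b W 0 (fun η => f (-η)) := by
  have : ∀ f : Om → ℝ≥0∞, S b W 0 f ≤ S b W 0 (fun η => f (-η)) := fun f => by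
    refine S_mapf (fun η => -η) (fun η η' _ _ _ _ h => neg_injective h) fun η h _ => ⟨fun x hx => by simp [h x hx], ?_⟩
    simp only [neg_neg]; gcongr
    simp only [wt, en, gr, Pi.neg_apply]; refine le_of_eq ?_; congr 3; refine sum_congr rfl fun e _ => ?_
    push_cast; ring
  refine le_antisymm (this f) ((this _).trans_eq ?_); simp
lemma S_abs {x : Site} {i : ℤ} (hi : 1 ≤ i) : S b W 0 (ii {η | i ≤ |η x|}) =2 * S b W 0 (ii {η | i ≤ η x}) := by
  have h : S b W 0 (ii {η | i ≤ -η x}) = S b W 0 (ii {η | i ≤ η x}) := by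
    conv_rhs => rw [S_neg]
    rfl
  rw [two_mul]; nth_rw 2 [← h]; rw [← S_add]
  refine S_congr fun η _ => ?_
  simp only [ii, Set.indicator, Set.mem_setOf_eq, le_abs]
  split_ifs <;> first | (exfalso; omega) | simp
/-- domain monotonicity (A) -/
lemma Amono (hb : 0 < b) {x : Site} (hx : x ∈ W) (h : W ⊆ Λ) {i : ℤ} (hi : 1 ≤ i) :
    S b W 0 (ii {η | i ≤ η x}) * S b Λ 0 (ii Set.univ) ≤
      S b Λ 0 (ii {η | i ≤ η x}) * S b W 0 (ii Set.univ) := by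
  have := Amono2 hb hx h i
  rw [S_abs hi, S_abs hi, mul_assoc, mul_assoc] at this
  exact (ENNReal.mul_le_mul_iff_right (by norm_num) (by norm_num)).1 this

lemma amgm (a c : ℝ≥0∞) : 2 * (a * c) ≤ a * a + c * c := by
  wlog h : a ≤ c
  · rw [mul_comm a, add_comm]; exact this c a (le_of_not_ge h)
  obtain ⟨d, rfl⟩ := exists_add_of_le h
  calc 2 * (a * (a + d)) ≤2 * (a * (a + d)) + d * d := le_self_add
    _ = _ := by ring
section theta
variable {T P κ : Type} [AddCommGroup T]
/-- twisted theta function -/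
def Th (F : Finset κ) (g : T →+ (κ → ℝ)) (b : ℝ) (φ : κ → ℝ) : ℝ≥0∞ :=
  ∑' t : T, ofReal (exp (-b * ∑ e ∈ F, (g t e - φ e) ^2))
lemma pair_sum (par : T → P) (hp : ∀ u v, par u = par v ↔ ∃ w, u - v = w + w) (h2 : ∀ w : T, w + w =0 → w =0)
    (E E' : T → ℝ≥0∞) : ∑' t : T, ∑' t' : T, E (t + t') * E' (t - t') =
      ∑' p : P, (∑' u, if par u = p then E u else 0) * ∑' u, if par u = p then E' u else 0 := by
  have e1 : ∑' t : T, ∑' t' : T, E (t + t') * E' (t - t') =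
      ∑' q : T × T, if par q.1 = par q.2 then E q.1 * E' q.2 else 0 := by
    rw [← ENNReal.tsum_prod (f := fun t t' => E (t + t') * E' (t - t'))]
    have inj : Function.Injective fun q : T × T => (q.1 + q.2, q.1 - q.2) := by
      rintro ⟨a, c⟩ ⟨a', c'⟩ h
      simp only [Prod.mk.injEq] at h
      have h3 : a = a' := by
        rw [← sub_eq_zero]; apply h2
        calc a - a' + (a - a') = (a + c - (a' + c')) + (a - c - (a' - c')) := by abel
          _ =0 := by rw [h.1, h.2]; simp
      subst h3; simpa using h.1
    rw [← inj.tsum_eq (f := fun q : T × T => if par q.1 = par q.2 then E q.1 * E' q.2 else 0)]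
    · refine tsum_congr fun q => ?_
      rw [if_pos]; rw [hp]; exact ⟨q.2, by simp only; abel⟩
    · rintro ⟨u, v⟩ h
      have h : par u = par v := by by_contra h'; simp [h'] at h
      obtain ⟨w, hw⟩ := (hp _ _).1 h
      refine ⟨(v + w, w), ?_⟩
      simp only [add_sub_cancel_right, Prod.mk.injEq, and_true]
      rw [add_assoc, ← hw]; abel
  rw [e1]
  have e2 : ∀ p : P, (∑' u, if par u = p then E u else 0) * (∑' u, if par u = p then E' u else 0) =
      ∑' q : T × T, if par q.1 = p then (if par q.2 = p then E q.1 * E' q.2 else 0) else 0 := fun p => by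
    rw [ENNReal.tsum_prod', ← ENNReal.tsum_mul_right]
    refine tsum_congr fun u => ?_
    rw [← ENNReal.tsum_mul_left]
    refine tsum_congr fun v => ?_
    split_ifs <;> simp
  simp_rw [e2]
  rw [ENNReal.tsum_comm]
  refine tsum_congr fun q => ?_
  rw [tsum_eq_single (par q.1)]
  · simp [eq_comm]
  · intro p hp; rw [if_neg hp.symm]
lemma Th_sq (F : Finset κ) (g : T →+ (κ → ℝ)) (b : ℝ) (φ ψ : κ → ℝ) :
    Th F g b φ * Th F g b ψ = ∑' t : T, ∑' t' : T,
      ofReal (exp (-(b /2) * ∑ e ∈ F, (g (t + t') e - (φ e + ψ e)) ^2)) *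
      ofReal (exp (-(b /2) * ∑ e ∈ F, (g (t - t') e - (φ e - ψ e)) ^2)) := by
  rw [Th, Th, ← ENNReal.tsum_mul_right]
  refine tsum_congr fun t => ?_
  rw [← ENNReal.tsum_mul_left]
  refine tsum_congr fun t' => ?_
  rw [← ofReal_mul (exp_pos _).le, ← ofReal_mul (exp_pos _).le, ← exp_add, ← exp_add,
    Finset.mul_sum, Finset.mul_sum, Finset.mul_sum, Finset.mul_sum, ← sum_add_distrib, ← sum_add_distrib]
  congr 2; refine sum_congr rfl fun e _ => ?_
  simp only [map_add, map_sub, Pi.add_apply, Pi.sub_apply]; ring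
lemma Th_dbl (par : T → P) (hp : ∀ u v, par u = par v ↔ ∃ w, u - v = w + w) (h2 : ∀ w : T, w + w =0 → w =0)
    (F : Finset κ) (g : T →+ (κ → ℝ)) (b : ℝ) (φ : κ → ℝ) :
    2 * (Th F g b φ * Th F g b φ) ≤ Th F g b (φ + φ) * Th F g b 0 + Th F g b 0 * Th F g b 0 := by
  rw [Th_sq, Th_sq, Th_sq]
  simp only [Pi.add_apply, Pi.zero_apply, add_zero, sub_zero, sub_self]
  set G : (κ → ℝ) → T → ℝ≥0∞ := fun φ u => ofReal (exp (-(b /2) * ∑ e ∈ F, (g u e - φ e) ^2))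
  have h := fun φ ψ => pair_sum par hp h2 (G φ) (G ψ)
  have e1 := h (fun e => φ e + φ e) (fun _ => 0)
  have e2 := h (fun e => φ e + φ e) (fun e => φ e + φ e)
  have e3 := h (fun _ => 0) (fun _ => 0)
  simp only [G, sub_zero] at e1 e2 e3 ⊢
  rw [e1, e2, e3, ← ENNReal.tsum_mul_left, ← ENNReal.tsum_add]
  exact ENNReal.tsum_le_tsum fun p => amgm _ _
lemma Th_le (par : T → P) (hp : ∀ u v, par u = par v ↔ ∃ w, u - v = w + w) (h2 : ∀ w : T, w + w =0 → w =0)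
    (F : Finset κ) (g : T →+ (κ → ℝ)) {b : ℝ} (hb : 0 < b) (hf : ∀ b > 0, Th F g b 0 ≠ ⊤) (φ : κ → ℝ) :
    Th F g b φ ≤ Th F g b 0 := by
  have bd : ∀ φ, Th F g b φ ≤ ofReal (exp (b /2)) * Th F g (b /4) 0 := fun φ => by
    obtain ⟨t₀, ht₀⟩ : ∃ t₀ : T, ∀ t, ∑ e ∈ F, (g t₀ e - φ e) ^2 ≤ ∑ e ∈ F, (g t e - φ e) ^2 +1 := by
      have hbd : BddBelow (Set.range fun t : T => ∑ e ∈ F, (g t e - φ e) ^2) :=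
        ⟨0, by rintro _ ⟨t, rfl⟩; positivity⟩
      obtain ⟨t₀, h⟩ := exists_lt_of_ciInf_lt (lt_add_one (⨅ t : T, ∑ e ∈ F, (g t e - φ e) ^2))
      exact ⟨t₀, fun t => h.le.trans (by gcongr; exact ciInf_le hbd t)⟩
    rw [Th, Th, ← ENNReal.tsum_mul_left]; conv_rhs => rw [← (Equiv.subRight t₀).tsum_eq]
    refine ENNReal.tsum_le_tsum fun t => ?_
    rw [← ofReal_mul (exp_pos _).le, ← exp_add]
    refine ofReal_le_ofReal (exp_le_exp.2 ?_)
    simp only [Equiv.subRight_apply, map_sub, Pi.sub_apply, Pi.zero_apply, sub_zero]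
    have h3 : ∑ e ∈ F, (g t e - g t₀ e) ^2 ≤2 * ∑ e ∈ F, (g t e - φ e) ^2 +2 * ∑ e ∈ F, (g t₀ e - φ e) ^2 := by
      rw [Finset.mul_sum, Finset.mul_sum, ← sum_add_distrib]
      refine sum_le_sum fun e _ => ?_
      nlinarith [sq_nonneg ((g t e - φ e) + (g t₀ e - φ e))]
    have := ht₀ t
    nlinarith
  set M := ⨆ φ, Th F g b φ with hM
  have hMf : M ≠ ⊤ := ne_top_of_le_ne_top (ENNReal.mul_ne_top (by simp) (hf (b /4) (by positivity))) (iSup_le bd)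
  have hle : ∀ φ, Th F g b φ ≤ M := fun φ => le_iSup (Th F g b) φ
  refine (hle φ).trans ?_
  have h0 := hf b hb
  have key : 2 * (M * M) ≤ M * Th F g b 0 + Th F g b 0 * Th F g b 0 := by
    have : ∀ φ, Th F g b φ * Th F g b φ ≤ (M * Th F g b 0 + Th F g b 0 * Th F g b 0) /2 := fun φ => by
      rw [ENNReal.le_div_iff_mul_le (by simp) (by simp), mul_comm]
      refine (Th_dbl par hp h2 F g b φ).trans ?_
      gcongr; exact hle _
    rw [mul_comm, ← ENNReal.le_div_iff_mul_le (by simp) (by simp)]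
    nth_rw 1 [hM]; rw [hM, ENNReal.iSup_mul]
    refine iSup_le fun φ => ?_
    rw [ENNReal.mul_iSup]; refine iSup_le fun ψ => ?_
    rcases le_total (Th F g b φ) (Th F g b ψ) with h | h
    · exact (mul_le_mul' h le_rfl).trans (this ψ)
    · exact (mul_le_mul' le_rfl h).trans (this φ)
  clear_value M
  lift M to ℝ≥0 using hMf
  lift Th F g b 0 to ℝ≥0 using h0 with Z
  norm_cast at key ⊢
  have k2 : 2 * ((M : ℝ) * M) ≤ M * Z + Z * Z := by exact_mod_cast key
  rw [← NNReal.coe_le_coe]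
  nlinarith [M.2, Z.2]
end theta
lemma subG (hb : 0 < b) {x : Site} {θ : Edge → ℝ} {t : ℝ} (ht : 0 ≤ t) (hp : 0 < ∑ e ∈ ed W, θ e ^2)
    (hθ : ∀ η : Om, (∀ z ∉ W, η z =0) → ∑ e ∈ ed W, θ e * gr η e = η x) :
    S b W 0 (ii {η | t ≤ η x}) ≤ ofReal (exp (-b * t ^2 / ∑ e ∈ ed W, θ e ^2)) * S b W 0 (ii Set.univ) := by
  set g : (W → ℤ) →+ (Edge → ℝ) := { 
    toFun := fun s e => (gr (ex W s) e : ℝ)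
    map_zero' := by ext e; simp [gr, ex]
    map_add' := fun s s' => by
      ext e; simp only [gr, ex, Pi.add_apply]; split_ifs <;> push_cast <;> ring } with hg
  have hZ : ∀ b, Th (ed W) g b 0 = S b W 0 (ii Set.univ) := fun b => by
    rw [S_ex, Th]; refine tsum_congr fun s => ?_
    simp [ii, wt, en, hg]
  set N := ∑ e ∈ ed W, θ e ^2 with hN
  have := Th_le (P := W → ZMod 2) (fun s z => (s z : ZMod 2)) (fun u v => ?_) (fun w h => ?_) (ed W) g hb
    (fun b hb => by rw [hZ]; exact S_fin' hb) (fun e => t / N * θ e)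
  · rw [hZ] at this
    refine le_trans ?_ (mul_le_mul' le_rfl this)
    rw [S_ex, Th, ← ENNReal.tsum_mul_left]
    refine ENNReal.tsum_le_tsum fun s => ?_
    by_cases h : ex W s ∈ {η : Om | t ≤ η x}
    · simp only [ii, h, Set.indicator_of_mem, Pi.one_apply, one_mul, wt]
      rw [← ofReal_mul (exp_pos _).le, ← exp_add]
      refine ofReal_le_ofReal (exp_le_exp.2 ?_)
      have h1 := hθ (ex W s) fun z hz => by simp [ex, hz]
      have h2 : ∑ e ∈ ed W, (g s e - t / N * θ e) ^2 = en (ed W) (ex W s) -2 * (t / N) * ex W s x + (t / N) ^2 * N := by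
        rw [← h1, hN, en, Finset.mul_sum, Finset.mul_sum, ← Finset.sum_sub_distrib, ← sum_add_distrib]
        refine sum_congr rfl fun e _ => ?_
        simp only [hg, AddMonoidHom.coe_mk, ZeroHom.coe_mk]; ring
      rw [h2]
      have h3 : t ≤ ex W s x := h
      have h4 : t / N * t ≤ t / N * ex W s x := by gcongr
      have h5 : (t / N) ^2 * N = t / N * t := by field_simp
      have h6 : -b * t ^2 / N = - b * (t / N * t) := by ring
      rw [h5, h6]; nlinarith
    · simp [ii, h]
  · constructor
    · intro h
      have h1 : ∀ z, ∃ w, u z - v z = w + w := fun z => by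
        have := congrFun h z; rw [ZMod.intCast_eq_intCast_iff_dvd_sub] at this
        obtain ⟨c, hc⟩ := this
        exact ⟨-c, by push_cast at hc; linarith⟩
      choose w hw using h1
      exact ⟨w, funext hw⟩
    · rintro ⟨w, hw⟩; ext z
      rw [ZMod.intCast_eq_intCast_iff_dvd_sub]
      have := congrFun hw z; simp only [Pi.sub_apply, Pi.add_apply] at this
      exact ⟨-w z, by push_cast; linarith⟩
  · ext z; have := congrFun h z; simp at this ⊢; omega

lemma at_deriv (a t : ℝ) : HasDerivAt (fun t => arctan (t / a)) ((1 / a) * Real.cos (arctan (t / a)) ^2) t := by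
  have := ((hasDerivAt_id t).div_const a).arctan
  simp only [id] at this
  refine this.congr_deriv ?_
  rw [Real.cos_sq_arctan]; ring
lemma at_sq {a : ℝ} (ha : 0 < a) (t : ℝ) : (arctan ((t +1) / a) - arctan (t / a)) ^2 ≤
    1 / (2 * a) * (Real.sin (2 * arctan ((t +1) / a)) /2 + arctan ((t +1) / a)) -
    1 / (2 * a) * (Real.sin (2 * arctan (t / a)) /2 + arctan (t / a)) := by
  set c := arctan ((t +1) / a) - arctan (t / a) with hc
  set G : ℝ → ℝ := fun t => 1 / (2 * a) * (Real.sin (2 * arctan (t / a)) /2 + arctan (t / a)) -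
    2 * c * arctan (t / a) + c ^2 * t with hG
  have hd : ∀ t, HasDerivAt G (((1 / a) * Real.cos (arctan (t / a)) ^2 - c) ^2) t := fun t => by
    have h := at_deriv a t
    have := ((((h.const_mul 2).sin.div_const 2).add h).const_mul (1 / (2 * a))).sub (h.const_mul (2 * c)) |>.add
      ((hasDerivAt_id t).const_mul (c ^2))
    refine this.congr_deriv ?_
    rw [Real.cos_two_mul]; field_simp; ring
  have hm : Monotone G := monotone_of_deriv_nonneg (fun t => (hd t).differentiableAt) fun t => by
    rw [(hd t).deriv]; positivity
  have := hm (show t ≤ t +1 by linarith)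
  simp only [hG] at this
  have e : 2 * c * arctan ((t +1) / a) -2 * c * arctan (t / a) =2 * c ^2 := by rw [hc]; ring
  nlinarith
lemma at_bd (y : ℝ) : |Real.sin (2 * arctan y) /2 + arctan y| ≤ π /2 := by
  have h1 := Real.arctan_lt_pi_div_two y
  have h2 := Real.neg_pi_div_two_lt_arctan y
  rw [abs_le]; constructor
  · have := Real.sin_le (show 0 ≤ π +2 * arctan y by linarith)
    rw [Real.sin_add, Real.sin_pi, Real.cos_pi] at this; linarith
  · have := Real.sin_le (show 0 ≤ π -2 * arctan y by linarith)
    rw [Real.sin_sub, Real.sin_pi, Real.cos_pi] at this; linarith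
def hh (i j : ℤ) : ℝ := (arctan ((j +1 /2) / (i +1 /2)) - arctan ((j -1 /2) / (i +1 /2))) / (2 * π)
lemma hh_col (i : ℤ) (n : ℕ) : ∑ j ∈ Finset.Ico (-(n : ℤ)) n, hh i j ^2 ≤1 / (8 * π) * (1 / |(i:ℝ) +1 /2|) := by
  have hpi := Real.pi_pos
  have ha : 0 < |(i:ℝ) +1 /2| := by
    rw [abs_pos]; intro h
    have : ((2 * i +1 : ℤ) : ℝ) =0 := by push_cast; linarith
    have : 2 * i +1 =0 := by exact_mod_cast this
    omega
  set a := |(i:ℝ) +1 /2| with haa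
  set Φ : ℤ → ℝ := fun j => 1 / (2 * a) * (Real.sin (2 * arctan ((j -1 /2) / a)) /2 + arctan ((j -1 /2) / a))
  have h1 : ∀ j : ℤ, hh i j ^2 ≤ (Φ (j +1) - Φ j) / (2 * π) ^2 := fun j => by
    rw [hh, div_pow]; gcongr
    have h2 := at_sq ha (j -1 /2)
    simp only [Φ]; push_cast
    rw [show (j : ℝ) -1 /2 +1 = j +1 /2 by ring] at h2
    rw [show (j : ℝ) +1 -1 /2 = j +1 /2 by ring]
    refine le_trans (le_of_eq ?_) h2
    rcases abs_choice ((i:ℝ) +1 /2) with h | h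
    · rw [haa, h]
    · rw [haa, h, div_neg, div_neg, Real.arctan_neg, Real.arctan_neg]; ring
  have h2 : ∀ n : ℕ, ∑ j ∈ Finset.Ico (-(n : ℤ)) n, (Φ (j +1) - Φ j) = Φ n - Φ (-n) := fun n => by
    induction n with
    | zero => simp
    | succ n ih =>
      have : Finset.Ico (-((n +1 : ℕ) : ℤ)) ((n +1 : ℕ) : ℤ) = insert (-((n +1 : ℕ) : ℤ)) (insert (n : ℤ) (Finset.Ico (-(n : ℤ)) n)) := by
        ext j; simp only [Finset.mem_Ico, Finset.mem_insert]; push_cast; omega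
      rw [this, sum_insert, sum_insert, ih]
      · push_cast; rw [show -((n:ℤ) +1) +1 = -n by ring]; ring
      · simp
      · simp
  have h3 : ∀ j, |Φ j| ≤1 / (2 * a) * (π /2) := fun j => by
    simp only [Φ]; rw [abs_mul, abs_of_pos (by positivity : 0 <1 / (2 * a))]; gcongr; exact at_bd _
  calc _ ≤ ∑ j ∈ Finset.Ico (-(n : ℤ)) n, (Φ (j +1) - Φ j) / (2 * π) ^2 := sum_le_sum fun j _ => h1 j
    _ = (Φ n - Φ (-n)) / (2 * π) ^2 := by rw [← Finset.sum_div, h2]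
    _ ≤ (1 / (2 * a) * (π /2) +1 / (2 * a) * (π /2)) / (2 * π) ^2 := by
        gcongr; have := abs_le.1 (h3 n); have := abs_le.1 (h3 (-n)); linarith
    _ = _ := by field_simp; ring
lemma hh_tot {n : ℕ} (hn : 1 ≤ n) : ∑ i ∈ Finset.Ico (-(n +1 : ℤ)) (n +1), ∑ j ∈ Finset.Ico (-(n +1 : ℤ)) (n +1), hh i j ^2 ≤
    (log n +3) / (4 * π) := by
  have hpi := Real.pi_pos
  have h2 : ∀ n : ℕ, ∑ i ∈ Finset.Ico (-(n : ℤ)) n, 1 / |(i:ℝ) +1 /2| =2 * ∑ i ∈ Finset.range n, 1 / ((i : ℝ) +1 /2) := fun n => by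
    induction n with
    | zero => simp
    | succ n ih =>
      have : Finset.Ico (-((n +1 : ℕ) : ℤ)) ((n +1 : ℕ) : ℤ) = insert (-((n +1 : ℕ) : ℤ)) (insert (n : ℤ) (Finset.Ico (-(n : ℤ)) n)) := by
        ext j; simp only [Finset.mem_Ico, Finset.mem_insert]; push_cast; omega
      rw [this, sum_insert, sum_insert, ih, Finset.sum_range_succ]
      · push_cast; rw [show -((n:ℝ) +1) +1 /2 = -(n +1 /2) by ring, abs_neg, abs_of_pos (by positivity)]; ring
      · simp
      · simp
  have h3 : ∑ i ∈ Finset.range (n +1), 1 / ((i : ℝ) +1 /2) ≤ log n +3 := by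
    rw [Finset.sum_range_succ']
    have : ∑ k ∈ Finset.range n, 1 / (((k +1 : ℕ) : ℝ) +1 /2) ≤ harmonic n := by
      rw [harmonic]; push_cast
      refine sum_le_sum fun k _ => ?_
      rw [one_div]; exact inv_anti₀ (by positivity) (by linarith)
    have h4 := harmonic_le_one_add_log n
    norm_num at *; linarith
  calc _ ≤ ∑ i ∈ Finset.Ico (-(n +1 : ℤ)) (n +1), 1 / (8 * π) * (1 / |(i:ℝ) +1 /2|) :=
        sum_le_sum fun i _ => by have := hh_col i (n +1); push_cast at this ⊢; exact this
    _ =1 / (8 * π) * (2 * ∑ i ∈ Finset.range (n +1), 1 / ((i : ℝ) +1 /2)) := by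
        rw [← Finset.mul_sum, ← h2]; push_cast; rfl
    _ ≤1 / (8 * π) * (2 * (log n +3)) := by gcongr
    _ = _ := by field_simp; ring
def fl (e : Edge) : ℝ := if e.2 then hh e.1.1 e.1.2 else hh e.1.2 e.1.1
lemma sgn_at {p q : ℝ} (hp : p ≠ 0) (hq : q ≠ 0) :
    arctan (q / p) + arctan (p / q) = π /2 * (SignType.sign p * SignType.sign q) := by
  have : p / q = (q / p)⁻¹ := by rw [inv_div]
  rw [this]
  rcases lt_or_gt_of_ne hp with h | h <;> rcases lt_or_gt_of_ne hq with h' | h'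
  · rw [Real.arctan_inv_of_pos (div_pos_of_neg_of_neg h' h)]; simp [h, h']
  · rw [Real.arctan_inv_of_neg (div_neg_of_pos_of_neg h' h)]; simp [h, h']
  · rw [Real.arctan_inv_of_neg (div_neg_of_neg_of_pos h' h)]; simp [h, h']
  · rw [Real.arctan_inv_of_pos (div_pos h' h)]; simp [h, h']
lemma sgn_half (i : ℤ) : ((SignType.sign ((i : ℝ) +1 /2) : SignType) : ℝ) = if 0 ≤ i then 1 else -1 := by
  split_ifs with h
  · have : (0:ℝ) ≤ i := by exact_mod_cast h
    rw [sign_pos (by linarith)]; simp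
  · have : (i:ℝ) ≤ -1 := by exact_mod_cast (by omega : i ≤ -1)
    rw [sign_neg (by linarith)]; simp
lemma half_ne (i : ℤ) : (i : ℝ) +1 /2 ≠ 0 := fun h => by
  have : ((2 * i +1 : ℤ) : ℝ) =0 := by push_cast; linarith
  have : 2 * i +1 =0 := by exact_mod_cast this
  omega
lemma fl_div (i j : ℤ) : hh i j - hh (i -1) j + hh j i - hh (j -1) i = if i =0 ∧ j =0 then 1 else 0 := by
  have hpi := Real.pi_pos
  have k : ∀ i j : ℤ, arctan (((j:ℝ) +1 /2) / (i +1 /2)) + arctan (((i:ℝ) +1 /2) / (j +1 /2)) =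
      π /2 * ((if 0 ≤ i then 1 else -1) * if 0 ≤ j then 1 else -1) := fun i j => by
    rw [sgn_at (half_ne i) (half_ne j), sgn_half, sgn_half]
  have k1 := k i j; have k2 := k (i -1) j; have k3 := k i (j -1); have k4 := k (i -1) (j -1)
  simp only [hh]
  push_cast at *
  rw [show (i : ℝ) -1 +1 /2 = i -1 /2 by ring] at *
  rw [show (j : ℝ) -1 +1 /2 = j -1 /2 by ring] at *
  rw [← sub_div, ← add_div, ← sub_div, div_eq_iff (by positivity)]
  have key : ∀ i : ℤ, ((if 0 ≤ i then 1 else -1 : ℝ) - if 0 ≤ i -1 then 1 else -1) = if i =0 then 2 else 0 := fun i => by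
    split_ifs <;> first | (exfalso; omega) | norm_num
  have : (if i =0 ∧ j =0 then (1:ℝ) else 0) * (2 * π) = π /2 * (((if 0 ≤ i then 1 else -1 : ℝ) - if 0 ≤ i -1 then 1 else -1) *
      ((if 0 ≤ j then 1 else -1 : ℝ) - if 0 ≤ j -1 then 1 else -1)) := by
    rw [key, key]; split_ifs <;> first | (exfalso; tauto) | (simp; try ring)
  rw [this]; linarith
def shf (x : Site) (e : Edge) : Edge := (e.1 - x, e.2)
lemma fl_ibp {x : Site} (hx : x ∈ W) (hη : ∀ z ∉ W, η z =0) : ∑ e ∈ ed W, -fl (shf x e) * gr η e = η x := by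
  have h1 : ∑ e ∈ ed W, fl (shf x e) * η e.1 = ∑ z ∈ W, (fl (shf x (z, true)) + fl (shf x (z, false))) * η z := by
    rw [← Finset.sum_subset (s₁ := W ×ˢ (Finset.univ : Finset Bool))]
    · rw [sum_product]; refine sum_congr rfl fun z _ => ?_
      rw [Fintype.sum_bool]; ring
    · intro e he; rw [mem_ed]; simp at he; exact Or.inl he
    · intro e _ he; simp at he; simp [hη _ he]
  have h2 : ∑ e ∈ ed W, fl (shf x e) * η (tg e) = ∑ z ∈ W, (fl (shf x ((z.1 -1, z.2), true)) + fl (shf x ((z.1, z.2 -1), false))) * η z := by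
    have : ∀ e ∈ ed W, fl (shf x e) * (η (tg e) : ℝ) = ∑ z ∈ W, if tg e = z then fl (shf x e) * (η z : ℝ) else 0 := fun e _ => by
      rw [Finset.sum_ite_eq]; split_ifs with h
      · rfl
      · simp [hη _ h]
    rw [sum_congr rfl this, Finset.sum_comm]
    refine sum_congr rfl fun z hz => ?_
    rw [← Finset.sum_filter]
    have : (ed W).filter (fun e => tg e = z) = {((z.1 -1, z.2), true), ((z.1, z.2 -1), false)} := by
      ext ⟨⟨i, j⟩, c⟩
      simp only [mem_filter, mem_ed, Finset.mem_insert, Finset.mem_singleton, Prod.mk.injEq]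
      constructor
      · rintro ⟨_, rfl⟩; cases c <;> simp [tg]
      · rintro (⟨⟨rfl, rfl⟩, rfl⟩ | ⟨⟨rfl, rfl⟩, rfl⟩) <;> simp [tg, hz]
    rw [this, Finset.sum_pair (by simp)]; ring
  have h3 : ∑ e ∈ ed W, -fl (shf x e) * gr η e = ∑ e ∈ ed W, fl (shf x e) * η e.1 - ∑ e ∈ ed W, fl (shf x e) * η (tg e) := by
    rw [← Finset.sum_sub_distrib]; refine sum_congr rfl fun e _ => ?_
    simp only [gr]; push_cast; ring
  rw [h3, h1, h2, ← Finset.sum_sub_distrib, Finset.sum_eq_single x]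
  · have := fl_div 0 0
    simp [fl, shf] at *; linear_combination (η x : ℝ) * this
  · intro z _ hz
    have := fl_div (z.1 - x.1) (z.2 - x.2)
    rw [if_neg (by rintro ⟨h, h'⟩; exact hz (Prod.ext (by linarith) (by linarith)))] at this
    simp only [fl, shf, if_true, Prod.fst_sub, Prod.snd_sub, Bool.false_eq_true, if_false]
    rw [show z.1 -1 - x.1 = z.1 - x.1 -1 by ring, show z.2 -1 - x.2 = z.2 - x.2 -1 by ring]
    linear_combination (η z : ℝ) * this
  · exact fun h => (h hx).elim
/-- centred box -/
def Bx (x : Site) (r : ℕ) : Finset Site := Finset.Icc (x.1 - r) (x.1 + r) ×ˢ Finset.Icc (x.2 - r) (x.2 + r)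
/-- (C) -/
lemma tailC (hb : 0 < b) {x : Site} (hx : x ∈ W) {r : ℕ} (hr : 1 ≤ r) (hW : W ⊆ Bx x r) {t : ℝ} (ht : 0 ≤ t) :
    S b W 0 (ii {η | t ≤ η x}) ≤ ofReal (exp (-b * t ^2 * (2 * π / (log r +3)))) * S b W 0 (ii Set.univ) := by
  have hpi := Real.pi_pos
  have hlr : 0 ≤ log r := log_natCast_nonneg r
  have hE : ∑ e ∈ ed W, (-fl (shf x e)) ^2 ≤ (log r +3) / (2 * π) := by
    set Q := Finset.Ico (-(r +1 : ℤ)) (r +1)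
    have inj : Function.Injective (shf x) := fun e e' h => by
      simp only [shf, Prod.mk.injEq, sub_left_inj] at h; exact Prod.ext h.1 h.2
    calc _ = ∑ e ∈ (ed W).image (shf x), fl e ^2 := by
          rw [Finset.sum_image fun _ _ _ _ h => inj h]; simp
      _ ≤ ∑ e ∈ (Q ×ˢ Q) ×ˢ (Finset.univ : Finset Bool), fl e ^2 := by
          refine sum_le_sum_of_subset_of_nonneg ?_ fun _ _ _ => sq_nonneg _
          intro e he'
          obtain ⟨⟨⟨i, j⟩, c⟩, he, rfl⟩ := Finset.mem_image.1 he'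
          have hW' : ∀ z ∈ W, x.1 - r ≤ z.1 ∧ z.1 ≤ x.1 + r ∧ x.2 - r ≤ z.2 ∧ z.2 ≤ x.2 + r := fun z hz => by
            have := hW hz; simp only [Bx, mem_product, Finset.mem_Icc] at this; omega
          simp only [shf, Q, mem_product, Finset.mem_Ico, Finset.mem_univ, and_true, Prod.fst_sub, Prod.snd_sub]
          rw [mem_ed] at he
          rcases he with he | he <;> have h := hW' _ he
          · simp only at h; omega
          · cases c <;> simp [tg] at h <;> omega
      _ = ∑ i ∈ Q, ∑ j ∈ Q, hh i j ^2 + ∑ i ∈ Q, ∑ j ∈ Q, hh i j ^2 := by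
          rw [sum_product]; simp only [Fintype.sum_bool, fl, if_true, Bool.false_eq_true, if_false]
          rw [sum_add_distrib, sum_product, Finset.sum_product_right]
      _ ≤ _ := by have := hh_tot hr; rw [show (log r +3) / (2 * π) = (log r +3) / (4 * π) + (log r +3) / (4 * π) by field_simp; ring]; exact add_le_add this this
  have hp : 0 < ∑ e ∈ ed W, (-fl (shf x e)) ^2 := by
    refine lt_of_le_of_ne (sum_nonneg fun _ _ => sq_nonneg _) fun h => ?_
    have h1 := (Finset.sum_eq_zero_iff_of_nonneg fun _ _ => sq_nonneg _).1 h.symm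
    have h2 := fl_ibp (η := Pi.single x 1) hx fun z hz => by simp [Pi.single_apply]; rintro rfl; exact hz hx
    rw [Finset.sum_eq_zero fun e he => by rw [pow_eq_zero_iff (by norm_num) |>.1 (h1 e he), zero_mul]] at h2
    simp at h2
  refine (subG hb ht hp fun η hη => fl_ibp hx hη).trans ?_
  gcongr
  rw [div_eq_mul_inv, ← mul_neg_one]
  have h5 : 2 * π / (log r +3) ≤ (∑ e ∈ ed W, (-fl (shf x e)) ^2)⁻¹ := by
    rw [← inv_div]; exact inv_anti₀ hp hE
  have : 0 ≤ b * t ^2 := by positivity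
  nlinarith

/-- edges of a plaquette -/
def pq (z : Site) : Finset Edge := {(z, true), (z, false), ((z.1, z.2 +1), true), ((z.1 +1, z.2), false)}
def nb (e : Edge) : Finset Edge := pq e.1 ∪ pq (if e.2 then (e.1.1, e.1.2 -1) else (e.1.1 -1, e.1.2))
lemma pq_nb {e f : Edge} {z : Site} (he : e ∈ pq z) (hf : f ∈ pq z) : f ∈ nb e := by
  simp only [pq, Finset.mem_insert, Finset.mem_singleton] at he
  rcases he with rfl | rfl | rfl | rfl <;> simp [nb, hf]
lemma nb_card (e : Edge) : (nb e).card ≤8 := by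
  have : ∀ z, (pq z).card ≤4 := fun z => Finset.card_le_four
  exact (Finset.card_union_le _ _).trans (add_le_add (this _) (this _))
lemma nb_self (e : Edge) : e ∈ nb e := by
  obtain ⟨z, c⟩ := e; cases c <;> simp [nb, pq]
lemma nb_iff {e f : Edge} : f ∈ nb e ↔ ∃ z, e ∈ pq z ∧ f ∈ pq z := by
  refine ⟨fun h => ?_, fun ⟨z, h, h'⟩ => pq_nb h h'⟩
  obtain ⟨⟨i, j⟩, c⟩ := e
  cases c <;> simp only [nb, Finset.mem_union, Bool.false_eq_true, if_false, if_true] at h <;> rcases h with h | h <;>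
    exact ⟨_, by simp [pq], h⟩
def cc (K : Finset Edge) : Edge → Edge → Prop := Relation.ReflTransGen fun a c => a ∈ K ∧ c ∈ K ∧ c ∈ nb a
lemma cc_symm {K : Finset Edge} {a c : Edge} (h : cc K a c) : cc K c a := by
  induction h with
  | refl => exact .refl
  | tail _ h ih =>
    obtain ⟨z, h1, h2⟩ := nb_iff.1 h.2.2
    exact ih.head ⟨h.2.1, h.1, nb_iff.2 ⟨z, h2, h1⟩⟩
lemma cc_mem {K : Finset Edge} {a c : Edge} (h : cc K a c) (ha : a ∈ K) : c ∈ K := by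
  cases h with
  | refl => exact ha
  | tail _ h => exact h.2.1
def Ks (F : Finset Edge) (e : Edge) : Finset (Finset Edge) := F.powerset.filter fun K => e ∈ K ∧ ∀ f ∈ K, cc K e f
lemma count0 (F : Finset Edge) (e : Edge) : ∑ K ∈ Ks F e, (1 /2 : ℝ) ^ (8 * K.card) ≤1 := by
  set U := F.biUnion nb
  set Fm : Finset Edge → Finset (Finset Edge) := fun K => U.powerset.filter fun T => T ∩ K.biUnion nb = K
  have dis : ∀ K K', K ∈ Ks F e → K' ∈ Ks F e → ∀ T ∈ Fm K, T ∈ Fm K' → K ⊆ K' := by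
    intro K K' hK hK' T hT hT' f hf
    have h1 := (mem_filter.1 hK).2.2 f hf
    have hT := (mem_filter.1 hT).2; have hT' := (mem_filter.1 hT').2
    clear hf
    induction h1 with
    | refl => exact (mem_filter.1 hK').2.1
    | tail _ h ih =>
      rw [← hT']; refine Finset.mem_inter.2 ⟨?_, Finset.mem_biUnion.2 ⟨_, ih, h.2.2⟩⟩
      have := h.2.1; rw [← hT] at this; exact (Finset.mem_inter.1 this).1
  have cd : ∀ K ∈ Ks F e, (2 : ℝ) ^ U.card * (1 /2) ^ (8 * K.card) ≤ (Fm K).card := by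
    intro K hK
    have hKF := mem_powerset.1 (mem_filter.1 hK).1
    set N := K.biUnion nb
    have hN : N ⊆ U := Finset.biUnion_subset_biUnion_of_subset_left _ hKF
    have hKN : K ⊆ N := fun f hf => Finset.mem_biUnion.2 ⟨f, hf, nb_self f⟩
    have h1 : (U \ N).powerset.card ≤ (Fm K).card := by
      refine Finset.card_le_card_of_injOn (fun T => K ∪ T) (fun T hT => ?_) (fun T hT T' hT' h => ?_)
      · have hT := mem_powerset.1 hT
        refine mem_filter.2 ⟨mem_powerset.2 (Finset.union_subset (hKN.trans hN) (hT.trans Finset.sdiff_subset)), ?_⟩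
        rw [Finset.union_inter_distrib_right, Finset.inter_eq_left.2 hKN]
        rw [Finset.disjoint_iff_inter_eq_empty.1 (Finset.disjoint_of_subset_left hT Finset.sdiff_disjoint), Finset.union_empty]
      · have hd : ∀ T ∈ (U \ N).powerset, Disjoint K T := fun T hT =>
          Finset.disjoint_of_subset_right (mem_powerset.1 hT) (Finset.disjoint_of_subset_left hKN Finset.disjoint_sdiff)
        have := congrArg (· \ K) h
        simpa [Finset.union_sdiff_cancel_left (hd T hT), Finset.union_sdiff_cancel_left (hd T' hT')] using this
    rw [Finset.card_powerset] at h1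
    have h2 : N.card ≤8 * K.card := by
      rw [mul_comm]; exact Finset.card_biUnion_le_card_mul _ _ _ fun f _ => nb_card f
    have h3 := Finset.card_sdiff_add_card_eq_card hN
    calc (2 : ℝ) ^ U.card * (1 /2) ^ (8 * K.card) ≤2 ^ U.card * (1 /2) ^ N.card := by
          gcongr ?_ * ?_; exact pow_le_pow_of_le_one (by norm_num) (by norm_num) h2
      _ =2 ^ (U \ N).card := by rw [← h3, pow_add, one_div, inv_pow]; field_simp
      _ ≤ _ := by exact_mod_cast h1
  have h4 : ∑ K ∈ Ks F e, (Fm K).card ≤2 ^ U.card := by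
    rw [← Finset.card_biUnion, ← Finset.card_powerset]
    · exact Finset.card_le_card (Finset.biUnion_subset.2 fun K _ => filter_subset _ _)
    · intro K hK K' hK' hne
      refine Finset.disjoint_left.2 fun T hT hT' => ?_
      exact hne ((dis K K' hK hK' T hT hT').antisymm (dis K' K hK' hK T hT' hT))
  have h5 : (2 : ℝ) ^ U.card * ∑ K ∈ Ks F e, (1 /2 : ℝ) ^ (8 * K.card) ≤2 ^ U.card := by
    rw [Finset.mul_sum]; refine (sum_le_sum cd).trans ?_
    exact_mod_cast h4
  exact le_of_mul_le_mul_left (by simpa using h5) (by positivity : (0:ℝ) <2 ^ U.card)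
def bd (A : Finset Site) : Finset Edge := (ed A).filter fun e => ¬ (e.1 ∈ A ↔ tg e ∈ A)
lemma mem_bd {A : Finset Site} {e : Edge} : e ∈ bd A ↔ ¬ (e.1 ∈ A ↔ tg e ∈ A) := by
  rw [bd, mem_filter, mem_ed]; tauto
lemma bd_inj {A B : Finset Site} (h : bd A = bd B) : A = B := by
  have h1 : ∀ z : Site, (((z.1 +1, z.2) ∈ A ↔ (z.1 +1, z.2) ∈ B)) → (z ∈ A ↔ z ∈ B) := fun z hz => by
    have h1 : (z, true) ∈ bd A ↔ (z, true) ∈ bd B := by rw [h]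
    rw [mem_bd, mem_bd] at h1; simp only [tg, if_true] at h1; tauto
  have h2 : ∀ (k : ℕ) (z : Site), (((z.1 + k, z.2) ∈ A ↔ (z.1 + k, z.2) ∈ B)) → (z ∈ A ↔ z ∈ B) := fun k => by
    induction k with
    | zero => intro z; simp
    | succ k ih =>
      intro z hz; apply h1; apply ih; push_cast at hz; simp only
      rwa [show z.1 +1 + (k:ℤ) = z.1 + (k +1) by ring]
  ext z
  obtain ⟨k, hk⟩ : ∃ k : ℕ, (z.1 + (k : ℤ), z.2) ∉ A ∪ B := by
    by_contra! h
    exact Set.infinite_of_injective_forall_mem (f := fun k : ℕ => ((z.1 + (k : ℤ), z.2) : Site))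
      (fun a c h => by simpa using h) h (A ∪ B).finite_toSet
  rw [Finset.mem_union, not_or] at hk
  exact h2 k z (by tauto)
def cp (G : Finset Edge) (e : Edge) : Finset Edge := G.filter fun f => cc G e f
def LA (R : Finset Site) (n : ℕ) : Finset (Finset Site) := R.powerset.filter fun A => ∀ e ∈ bd A, n ≤ (cp (bd A) e).card
lemma cp_eq {G : Finset Edge} {e f : Edge} (h : cc G e f) : cp G e = cp G f := by
  ext a; simp only [cp, mem_filter]
  exact and_congr_right fun _ => ⟨fun h' => (cc_symm h).trans h', fun h' => h.trans h'⟩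
lemma cp_conn {G : Finset Edge} {e : Edge} (he : e ∈ G) : e ∈ cp G e ∧ ∀ f ∈ cp G e, cc (cp G e) e f := by
  refine ⟨mem_filter.2 ⟨he, .refl⟩, fun f hf => ?_⟩
  have := (mem_filter.1 hf).2
  clear hf
  induction this with
  | refl => exact .refl
  | tail h1 h2 ih => exact ih.tail ⟨mem_filter.2 ⟨h2.1, h1⟩, mem_filter.2 ⟨h2.2.1, h1.tail h2⟩, h2.2.2⟩
lemma countA (R : Finset Site) {n : ℕ} {x : ℝ} (hx : 0 ≤ x) (hx1 : 256 * x ≤1) :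
    ∑ A ∈ LA R n, x ^ (bd A).card ≤ exp ((ed R).card * (256 * x) ^ n) := by
  set KK := ((ed R).biUnion fun e => Ks (ed R) e).filter fun K => n ≤ K.card
  set Cs : Finset Site → Finset (Finset Edge) := fun A => (bd A).image (cp (bd A))
  have e1 : ∀ A, (bd A) = (Cs A).biUnion id := fun A => by
    ext e; simp only [Cs, Finset.mem_biUnion, Finset.mem_image, id]
    refine ⟨fun h => ⟨_, ⟨e, h, rfl⟩, (cp_conn h).1⟩, ?_⟩
    rintro ⟨_, ⟨f, hf, rfl⟩, h⟩; exact (mem_filter.1 h).1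
  have e2 : ∀ A, (bd A).card = ∑ K ∈ Cs A, K.card := fun A => by
    conv_lhs => rw [e1 A]
    rw [Finset.card_biUnion]; · rfl
    intro K hK K' hK' hne
    obtain ⟨e, he, rfl⟩ := Finset.mem_image.1 hK
    obtain ⟨e', he', rfl⟩ := Finset.mem_image.1 hK'
    refine Finset.disjoint_left.2 fun f hf hf' => hne ?_
    rw [cp_eq (mem_filter.1 hf).2, cp_eq (mem_filter.1 hf').2]
  have e3 : ∀ A ∈ LA R n, Cs A ∈ KK.powerset := fun A hA => by
    rw [mem_powerset]; intro K hK
    obtain ⟨e, he, rfl⟩ := Finset.mem_image.1 hK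
    have hAR := mem_powerset.1 (mem_filter.1 hA).1
    have hsub : bd A ⊆ ed R := (filter_subset _ _).trans (ed_mono hAR)
    exact mem_filter.2 ⟨Finset.mem_biUnion.2 ⟨e, hsub he, mem_filter.2 ⟨mem_powerset.2
      ((filter_subset _ _).trans hsub), cp_conn he⟩⟩, (mem_filter.1 hA).2 e he⟩
  have inj : ∀ A B, Cs A = Cs B → A = B := fun A B h => bd_inj (by rw [e1, e1 B, h])
  calc ∑ A ∈ LA R n, x ^ (bd A).card = ∑ A ∈ LA R n, ∏ K ∈ Cs A, x ^ K.card :=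
        sum_congr rfl fun A _ => by rw [e2, Finset.prod_pow_eq_pow_sum]
    _ = ∑ T ∈ (LA R n).image Cs, ∏ K ∈ T, x ^ K.card := by rw [Finset.sum_image fun A _ B _ h => inj A B h]
    _ ≤ ∑ T ∈ KK.powerset, ∏ K ∈ T, x ^ K.card := by
        refine sum_le_sum_of_subset_of_nonneg ?_ fun _ _ _ => Finset.prod_nonneg fun _ _ => by positivity
        intro T hT; obtain ⟨A, hA, rfl⟩ := Finset.mem_image.1 hT; exact e3 A hA
    _ = ∏ K ∈ KK, (1 + x ^ K.card) := (Finset.prod_one_add _).symm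
    _ ≤ ∏ K ∈ KK, exp (x ^ K.card) := Finset.prod_le_prod (fun _ _ => by positivity) fun K _ => by
        rw [add_comm]; exact add_one_le_exp _
    _ = exp (∑ K ∈ KK, x ^ K.card) := (Real.exp_sum _ _).symm
    _ ≤ _ := by
        refine exp_le_exp.2 ?_
        calc ∑ K ∈ KK, x ^ K.card ≤ ∑ K ∈ KK, (256 * x) ^ n * (1 /2) ^ (8 * K.card) := by
              refine sum_le_sum fun K hK => ?_
              have h1 := pow_le_pow_of_le_one (by positivity) hx1 (mem_filter.1 hK).2
              calc x ^ K.card = (256 * x) ^ K.card * (1 /2) ^ (8 * K.card) := by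
                    rw [pow_mul, ← mul_pow]; norm_num; congr 1; ring
                _ ≤ _ := by gcongr
          _ = (256 * x) ^ n * ∑ K ∈ KK, (1 /2) ^ (8 * K.card) := by rw [Finset.mul_sum]
          _ ≤ (256 * x) ^ n * (ed R).card := by
              gcongr
              calc ∑ K ∈ KK, (1 /2 : ℝ) ^ (8 * K.card) ≤ ∑ K ∈ (ed R).biUnion fun e => Ks (ed R) e, (1 /2) ^ (8 * K.card) :=
                    sum_le_sum_of_subset_of_nonneg (filter_subset _ _) fun _ _ _ => by positivity
                _ ≤ ∑ e ∈ ed R, ∑ K ∈ Ks (ed R) e, (1 /2 : ℝ) ^ (8 * K.card) := by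
                    refine (sum_le_sum_of_subset_of_nonneg (t := ((ed R).sigma fun e => Ks (ed R) e).image Sigma.snd) ?_ ?_).trans ?_
                    · intro K hK; obtain ⟨e, h1, h2⟩ := Finset.mem_biUnion.1 hK
                      exact Finset.mem_image.2 ⟨⟨e, K⟩, Finset.mem_sigma.2 ⟨h1, h2⟩, rfl⟩
                    · intros; positivity
                    · rw [← Finset.sum_sigma (f := fun x : (_ : Edge) × Finset Edge => (1 /2 : ℝ) ^ (8 * x.2.card))]
                      exact Finset.sum_image_le_of_nonneg (f := fun K : Finset Edge => (1 /2 : ℝ) ^ (8 * K.card)) fun _ _ => by positivity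
                _ ≤ ∑ e ∈ ed R, 1 := sum_le_sum fun e _ => count0 _ e
                _ = _ := by simp
          _ = _ := mul_comm _ _

lemma Ad_iff {x y : Site} : Ad x y ↔ (y = (x.1 +1, x.2) ∨ y = (x.1, x.2 +1) ∨ y = (x.1 -1, x.2) ∨ y = (x.1, x.2 -1)) := by
  obtain ⟨i, j⟩ := x; obtain ⟨k, l⟩ := y
  constructor
  · rintro ⟨⟨⟨a, c⟩, d⟩, h⟩
    cases d <;> simp [tg] at h ⊢ <;> omega
  · rintro (h | h | h | h) <;> simp only [Prod.mk.injEq] at h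
    · exact ⟨((i, j), true), .inl (by simp [tg, h])⟩
    · exact ⟨((i, j), false), .inl (by simp [tg, h])⟩
    · exact ⟨((k, l), true), .inr (by simp [tg, h])⟩
    · exact ⟨((k, l), false), .inr (by simp [tg, h])⟩
def Cn (p : Site → Prop) : Site → Site → Prop := Relation.ReflTransGen fun a c => Ad a c ∧ p a ∧ p c
lemma Cn_symm {p : Site → Prop} {a c : Site} (h : Cn p a c) : Cn p c a := by
  induction h with
  | refl => exact .refl
  | tail _ h ih => exact ih.head ⟨h.1.symm, h.2.2, h.2.1⟩
lemma Cn_mem {p : Site → Prop} {a c : Site} (h : Cn p a c) (ha : p a) : p c := by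
  cases h with
  | refl => exact ha
  | tail _ h => exact h.2.2
lemma Cn_ivt {p : Site → Prop} {y z : Site} (h : Cn p y z) (φ : Site → ℤ) (hφ : ∀ a c, Ad a c → |φ a - φ c| ≤1)
    (c : ℤ) (hc : (φ y ≤ c ∧ c ≤ φ z) ∨ (φ z ≤ c ∧ c ≤ φ y)) : ∃ s, Cn p y s ∧ φ s = c := by
  induction h with
  | refl => exact ⟨y, .refl, by omega⟩
  | tail h1 h2 ih =>
    rename_i w z
    by_cases h : (φ y ≤ c ∧ c ≤ φ w) ∨ (φ w ≤ c ∧ c ≤ φ y)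
    · exact ih h
    · have := abs_le.1 (hφ _ _ h2.1)
      exact ⟨z, h1.tail h2, by omega⟩
def far (n : ℕ) (y z : Site) : Prop := (n : ℤ) ≤ |y.1 - z.1| ∨ (n : ℤ) ≤ |y.2 - z.2|
lemma Ad_abs {a c : Site} (h : Ad a c) : |a.1 - c.1| ≤1 ∧ |a.2 - c.2| ≤1 := by
  rcases Ad_iff.1 h with rfl | rfl | rfl | rfl <;> simp
lemma card_ge {K : Finset Edge} {n : ℕ} {y z : ℤ} (φ : Edge → ℤ) (h : (n : ℤ) ≤ |y - z|)
    (hs : ∀ c, (y ≤ c ∧ c ≤ z) ∨ (z ≤ c ∧ c ≤ y) → ∃ e ∈ K, φ e = c) : n ≤ K.card := by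
  have h1 : Finset.Icc (min y z) (max y z) ⊆ K.image φ := fun c hc => by
    rw [Finset.mem_Icc] at hc
    obtain ⟨e, he, h2⟩ := hs c (by omega)
    exact Finset.mem_image.2 ⟨e, he, h2⟩
  have h2 := (Finset.card_le_card h1).trans Finset.card_image_le
  rw [Int.card_Icc] at h2
  rcases abs_cases (y - z) with h | h <;> omega
/-- potential of a contour component -/
lemma pot (A : Finset Site) (e0 : Edge) : ∃ g : Site → ZMod 2,
    (∀ e : Edge, g (tg e) = g e.1 + if e ∈ cp (bd A) e0 then 1 else 0) ∧
    (∀ z, g z ≠ 0 → ∃ e ∈ cp (bd A) e0, e.2 = true ∧ e.1.2 = z.2 ∧ e.1.1 < z.1) := by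
  set K := cp (bd A) e0
  set Fg : Site → Finset Edge := fun z => K.filter fun f => f.2 = true ∧ f.1.2 = z.2 ∧ f.1.1 < z.1
  set g : Site → ZMod 2 := fun z => ((Fg z).card : ZMod 2)
  have hh : ∀ z : Site, g (z.1 +1, z.2) = g z + if (z, true) ∈ K then 1 else 0 := fun z => by
    by_cases h : (z, true) ∈ K
    · have : Fg (z.1 +1, z.2) = insert (z, true) (Fg z) := by
        ext ⟨⟨i, j⟩, c⟩; obtain ⟨k, l⟩ := z
        simp only [Fg, mem_filter, Finset.mem_insert, Prod.mk.injEq]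
        constructor
        · rintro ⟨h1, rfl, rfl, h2⟩
          by_cases h3 : i = k
          · simp [h3]
          · exact .inr ⟨h1, rfl, rfl, by omega⟩
        · rintro (⟨⟨rfl, rfl⟩, rfl⟩ | ⟨h1, rfl, rfl, h2⟩)
          · exact ⟨h, rfl, rfl, by omega⟩
          · exact ⟨h1, rfl, rfl, by omega⟩
      simp only [g, this, if_pos h]
      rw [Finset.card_insert_of_notMem (by simp [Fg])]; push_cast; ring
    · have : Fg (z.1 +1, z.2) = Fg z := by
        ext ⟨⟨i, j⟩, c⟩; obtain ⟨k, l⟩ := z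
        simp only [Fg, mem_filter]
        refine and_congr_right fun h1 => and_congr_right fun h2 => and_congr_right fun h3 => ⟨fun h4 => ?_, fun h4 => by omega⟩
        subst h2 h3; replace h4 : i < k +1 := h4; change i < k
        rcases (show i < k ∨ i = k by omega) with h5 | rfl
        · exact h5
        · exact absurd h1 h
      simp [g, this, h]
  have hK : ∀ z, ∀ e ∈ pq z, ∀ f ∈ pq z, e ∈ K → f ∈ bd A → f ∈ K := fun z e he f hf h1 h2 => by
    have h1 := mem_filter.1 h1
    exact mem_filter.2 ⟨h2, h1.2.tail ⟨h1.1, h2, pq_nb he hf⟩⟩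
  have par : ∀ z : Site, ((if (z, true) ∈ K then 1 else 0) + (if (z, false) ∈ K then 1 else 0) +
      (if ((z.1, z.2 +1), true) ∈ K then 1 else 0) + (if ((z.1 +1, z.2), false) ∈ K then 1 else 0) : ZMod 2) =0 := fun z => by
    by_cases h : ∃ e ∈ pq z, e ∈ K
    · obtain ⟨e, he, heK⟩ := h
      have h1 : ∀ f ∈ pq z, f ∈ K ↔ ¬ (f.1 ∈ A ↔ tg f ∈ A) := fun f hf =>
        ⟨fun h => mem_bd.1 (mem_filter.1 h).1, fun h => hK z e he f hf heK (mem_bd.2 h)⟩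
      rw [if_congr (h1 _ (by simp [pq])) rfl rfl, if_congr (h1 _ (by simp [pq])) rfl rfl,
        if_congr (h1 _ (by simp [pq])) rfl rfl, if_congr (h1 _ (by simp [pq])) rfl rfl]
      simp only [tg, if_true, Bool.false_eq_true, if_false]
      by_cases a1 : z ∈ A <;> by_cases a2 : (z.1 +1, z.2) ∈ A <;> by_cases a3 : (z.1, z.2 +1) ∈ A <;>
        by_cases a4 : (z.1 +1, z.2 +1) ∈ A <;> simp [a1, a2, a3, a4] <;> decide
    · push Not at h
      simp [h _ (show (z, true) ∈ pq z by simp [pq]), h _ (show (z, false) ∈ pq z by simp [pq]),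
        h _ (show ((z.1, z.2 +1), true) ∈ pq z by simp [pq]), h _ (show ((z.1 +1, z.2), false) ∈ pq z by simp [pq])]
  have hv : ∀ z : Site, g (z.1, z.2 +1) = g z + if (z, false) ∈ K then 1 else 0 := by
    obtain ⟨m, hm⟩ : ∃ m : ℤ, ∀ e ∈ K, m ≤ e.1.1 := by
      obtain ⟨m, hm⟩ := (K.image fun e => e.1.1).bddBelow
      exact ⟨m, fun e he => hm (Finset.mem_coe.2 (Finset.mem_image_of_mem _ he))⟩
    have : ∀ (k : ℕ) (j : ℤ), g (m -1 + k, j +1) = g (m -1 + k, j) + if ((m -1 + k, j), false) ∈ K then 1 else 0 := by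
      intro k; induction k with
      | zero =>
        intro j
        have h1 : ∀ j : ℤ, Fg (m -1, j) = ∅ := fun j => by
          refine Finset.filter_eq_empty_iff.2 fun e he => ?_
          have := hm e he; simp only; omega
        have h2 : ((m -1, j), false) ∉ K := fun h => by have := hm _ h; simp at this
        simp [g, h1, h2]
      | succ k ih =>
        intro j
        have e1 := hh (m -1 + k, j +1); have e2 := hh (m -1 + k, j); have e3 := par (m -1 + k, j)
        have e4 := ih j
        simp only at e1 e2 e3
        push_cast; rw [show m -1 + ((k : ℤ) +1) = m -1 + k +1 by ring, e1, e2, e4]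
        have tw : ∀ x : ZMod 2, x + x =0 := by decide
        generalize (if ((m -1 + (k : ℤ), j), true) ∈ K then (1 : ZMod 2) else 0) = x1 at *
        generalize (if ((m -1 + (k : ℤ), j), false) ∈ K then (1 : ZMod 2) else 0) = x2 at *
        generalize (if ((m -1 + (k : ℤ), j +1), true) ∈ K then (1 : ZMod 2) else 0) = x3 at *
        generalize (if ((m -1 + (k : ℤ) +1, j), false) ∈ K then (1 : ZMod 2) else 0) = x4 at *
        generalize g (m -1 + k, j) = x5 at *
        clear e4 e1 e2 ih
        revert x1 x2 x3 x4 x5; decide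
    intro z
    by_cases hz : m -1 ≤ z.1
    · have := this (z.1 - (m -1)).toNat z.2
      rwa [Int.toNat_of_nonneg (by omega), show m -1 + (z.1 - (m -1)) = z.1 by ring] at this
    · have h1 : ∀ j : ℤ, Fg (z.1, j) = ∅ := fun j => by
        refine Finset.filter_eq_empty_iff.2 fun e he => ?_
        have := hm e he; simp only; omega
      have h2 : (z, false) ∉ K := fun h => by have := hm _ h; simp only at this; omega
      have h3 : Fg z = ∅ := h1 z.2
      simp [g, h1, h2, h3]
  refine ⟨g, ?_, fun z hz => ?_⟩
  · rintro ⟨z, c⟩; cases c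
    · simpa [tg] using hv z
    · simpa [tg] using hh z
  · have : (Fg z).Nonempty := by
      by_contra h; rw [Finset.not_nonempty_iff_eq_empty] at h; simp [g, h] at hz
    obtain ⟨e, he⟩ := this
    have := mem_filter.1 he
    exact ⟨e, this⟩
lemma pot_z {l r u v : ℤ} {A : Finset Site} (hA : A ⊆ Finset.Icc l r ×ˢ Finset.Icc u v) {e0 : Edge} {g : Site → ZMod 2}
    (h1 : ∀ e : Edge, g (tg e) = g e.1 + if e ∈ cp (bd A) e0 then 1 else 0)
    (h2 : ∀ z, g z ≠ 0 → ∃ e ∈ cp (bd A) e0, e.2 = true ∧ e.1.2 = z.2 ∧ e.1.1 < z.1) {z : Site}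
    (hz : z ∉ Finset.Icc l r ×ˢ Finset.Icc u v) : g z =0 := by
  have hK : ∀ e ∈ cp (bd A) e0, e.1 ∈ Finset.Icc l r ×ˢ Finset.Icc u v ∨ tg e ∈ Finset.Icc l r ×ˢ Finset.Icc u v := fun e he => by
    have := mem_ed.1 (mem_filter.1 (mem_filter.1 he).1).1
    exact this.imp (fun h => hA h) (fun h => hA h)
  have far0 : ∀ z : Site, z.2 < u ∨ v < z.2 ∨ z.1 < l → g z =0 := fun z hz => by
    by_contra h; obtain ⟨⟨⟨i, j⟩, c⟩, he, rfl, h3, h4⟩ := h2 z h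
    have := hK _ he
    simp [tg] at this h3 h4; omega
  by_cases hr : r < z.1
  · have : ∀ (k : ℕ), g (z.1, z.2 + k) = g z := fun k => by
      induction k with
      | zero => simp
      | succ k ih =>
        have := h1 ((z.1, z.2 + k), false)
        rw [if_neg (fun h => by have := hK _ h; simp [tg] at this; omega)] at this
        simp only [tg, Bool.false_eq_true, if_false] at this
        push_cast; rw [← add_assoc, this, add_zero, ih]
    rw [← this (v +1 - z.2).toNat]
    apply far0; simp only; omega
  · simp at hz; apply far0; omega
/-- long level connections are caught by a family of long contours -/
lemma GEO {l r u v : ℤ} {p : Site → Prop} (n : ℕ) (hp : ∀ z, p z → z ∈ Finset.Icc l r ×ˢ Finset.Icc u v) :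
    ∃ A ∈ LA (Finset.Icc l r ×ˢ Finset.Icc u v) n, (∀ a ∈ A, ∀ o ∉ A, Ad a o → p a ∧ ¬ p o) ∧
      ∀ x z, p x → Cn p x z → far n x z → x ∈ A := by
  set R := Finset.Icc l r ×ˢ Finset.Icc u v
  set Sf : Site → Prop := fun x => p x ∧ ∃ y z, Cn p x y ∧ Cn p x z ∧ far n y z
  set O : Site → Prop := fun z => ∃ w, w ∉ R ∧ Cn (fun x => ¬ Sf x) w z
  set A := R.filter fun z => ¬ O z
  have hSR : ∀ z, Sf z → z ∈ R := fun z h => hp z h.1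
  have hOS : ∀ z, O z → ¬ Sf z := fun z ⟨w, hw, h⟩ => Cn_mem h fun h => hw (hSR _ h)
  have hA : ∀ z, z ∈ A ↔ ¬ O z := fun z => by
    rw [mem_filter, and_iff_right_of_imp]; intro h; by_contra h1; exact h ⟨z, h1, .refl⟩
  have hSc : ∀ x y, Sf x → Cn p x y → Sf y := fun x y ⟨h1, a, c, h2, h3, h4⟩ h =>
    ⟨Cn_mem h h1, a, c, (Cn_symm h).trans h2, (Cn_symm h).trans h3, h4⟩
  have hSA : ∀ z, Sf z → z ∈ A := fun z h => (hA z).2 fun h1 => hOS z h1 h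
  have hin : ∀ a ∈ A, ∀ o ∉ A, Ad a o → Sf a ∧ O o := fun a ha o ho h => by
    have hO : O o := by by_contra h1; exact ho ((hA o).2 h1)
    refine ⟨?_, hO⟩; by_contra hs
    have := (hA a).1 ha; apply this
    obtain ⟨w, hw, h1⟩ := hO
    exact ⟨w, hw, h1.tail ⟨h.symm, Cn_mem h1 fun h => hw (hSR _ h), hs⟩⟩
  refine ⟨A, mem_filter.2 ⟨mem_powerset.2 (filter_subset _ _), fun e0 he0 => ?_⟩, fun a ha o ho h => ?_, ?_⟩
  · obtain ⟨g, h1, h2⟩ := pot A e0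
    have hz := fun z => pot_z (z := z) (filter_subset _ _) h1 h2
    have hst : ∀ x y, Ad x y → (x ∈ A ↔ y ∈ A) → g x = g y := by
      rintro x y ⟨e, he⟩ hxy
      have := h1 e
      have hn : e ∉ cp (bd A) e0 := fun h => by
        have h3 := mem_bd.1 (mem_filter.1 h).1
        rcases he with ⟨rfl, rfl⟩ | ⟨rfl, rfl⟩
        · exact h3 hxy
        · exact h3 hxy.symm
      rw [if_neg hn, add_zero] at this
      rcases he with ⟨rfl, rfl⟩ | ⟨rfl, rfl⟩
      · exact this.symm
      · exact this
    have hO : ∀ z, O z → g z =0 := by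
      rintro z ⟨w, hw, h⟩
      have : O z ∧ g z =0 := by
        induction h with
        | refl => exact ⟨⟨w, hw, .refl⟩, hz w hw⟩
        | tail h3 h4 ih =>
          have h5 : O _ := ⟨w, hw, h3.tail h4⟩
          refine ⟨h5, ?_⟩
          rw [← hst _ _ h4.1 (iff_of_false (fun h => (hA _).1 h ih.1) (fun h => (hA _).1 h h5)), ih.2]
      exact this.2
    have e0K := (cp_conn he0).1
    obtain ⟨a, ha, hga⟩ : ∃ a, Sf a ∧ g a ≠ 0 := by
      have h3 := h1 e0; rw [if_pos e0K] at h3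
      have h4 := mem_bd.1 he0
      by_cases h5 : e0.1 ∈ A
      · obtain ⟨h6, h7⟩ := hin _ h5 (tg e0) (fun h => h4 (iff_of_true h5 h)) ⟨e0, .inl ⟨rfl, rfl⟩⟩
        refine ⟨_, h6, fun h8 => ?_⟩; rw [h8, hO _ h7] at h3; simp at h3
      · obtain ⟨h6, h7⟩ := hin (tg e0) (by by_contra h; exact h4 (iff_of_false h5 h)) e0.1 h5 ⟨e0, .inr ⟨rfl, rfl⟩⟩
        refine ⟨_, h6, fun h8 => ?_⟩; rw [h8, hO _ h7] at h3; simp at h3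
    have hcl : ∀ c, Cn p a c → g c ≠ 0 := fun c h => by
      have : Sf c ∧ g c = g a := by
        induction h with
        | refl => exact ⟨ha, rfl⟩
        | tail h3 h4 ih =>
          have h5 := hSc _ _ ih.1 (.single h4)
          exact ⟨h5, by rw [← ih.2, hst _ _ h4.1]; exact iff_of_true (hSA _ ih.1) (hSA _ h5)⟩
      rw [this.2]; exact hga
    obtain ⟨_, y, z, hy, hz', hf⟩ := ha
    have hyz := (Cn_symm hy).trans hz'
    rcases hf with hf | hf
    · refine card_ge (fun e => e.1.1) hf fun c hc => ?_
      obtain ⟨s, hs, rfl⟩ := Cn_ivt hyz (fun z => z.1) (fun _ _ h => (Ad_abs h).1) c hc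
      have hgs := hcl s (hy.trans hs)
      by_contra! hno
      have : ∀ k : ℕ, g (s.1, s.2 + k) = g s := fun k => by
        induction k with
        | zero => simp
        | succ k ih =>
          have := h1 ((s.1, s.2 + k), false)
          rw [if_neg (fun h => hno _ h rfl)] at this
          simp only [tg, Bool.false_eq_true, if_false] at this
          push_cast; rw [← add_assoc, this, add_zero, ih]
      apply hgs; rw [← this (v +1 - s.2).toNat]; apply hz
      simp [R]; omega
    · refine card_ge (fun e => e.1.2) hf fun c hc => ?_
      obtain ⟨s, hs, rfl⟩ := Cn_ivt hyz (fun z => z.2) (fun _ _ h => (Ad_abs h).2) c hc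
      obtain ⟨e, he, _, h5, _⟩ := h2 s (hcl s (hy.trans hs))
      exact ⟨e, he, h5⟩
  · obtain ⟨h1, h2⟩ := hin a ha o ho h
    exact ⟨h1.1, fun h3 => hOS o h2 (hSc a o h1 (.single ⟨h, h1.1, h3⟩))⟩
  · intro x z hx h hf
    exact hSA x ⟨hx, x, z, .refl, h, hf⟩

def IsR (R : Finset Site) : Prop := ∃ l r u v : ℤ, R = Finset.Icc l r ×ˢ Finset.Icc u v
lemma IsR_Bx (x : Site) (r : ℕ) : IsR (Bx x r) := ⟨_, _, _, _, rfl⟩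
lemma IsR_box (L : ℕ) : IsR (box L) := ⟨_, _, _, _, rfl⟩
lemma geo {R : Finset Site} (hR : IsR R) {p : Site → Prop} (n : ℕ) (hp : ∀ z, p z → z ∈ R) :
    ∃ A ∈ LA R n, (∀ a ∈ A, ∀ o ∉ A, Ad a o → p a ∧ ¬ p o) ∧ ∀ x z, p x → Cn p x z → far n x z → x ∈ A := by
  obtain ⟨l, r, u, v, rfl⟩ := hR; exact GEO n hp
lemma ed_card (W : Finset Site) : (ed W).card ≤4 * W.card := by
  refine (Finset.card_union_le _ _).trans ?_
  have h1 := Finset.card_union_le (W ×ˢ (Finset.univ : Finset Bool)) (W.image (fun x => (((x.1 -1, x.2), true) : Edge)))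
  have h2 : (W.image (fun x => (((x.1 -1, x.2), true) : Edge))).card ≤ W.card := Finset.card_image_le
  have h3 : (W.image (fun x => (((x.1, x.2 -1), false) : Edge))).card ≤ W.card := Finset.card_image_le
  rw [Finset.card_product, Finset.card_univ, Fintype.card_bool] at h1
  omega
/-- nonempty contour families -/
def LN (R : Finset Site) (n : ℕ) : Finset (Finset Site) := (LA R n).erase ∅
def eps (R : Finset Site) (n : ℕ) : ℝ := 8 * R.card * exp (-4 * n)
lemma eps_nn (R : Finset Site) (n : ℕ) : 0 ≤ eps R n := by unfold eps; positivity
lemma h256 (hb : 20 ≤ b) : 256 * exp (-b /2) ≤ exp (-4) := by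
  have h1 : exp (-b /2) ≤ exp (-4) * exp (-6) := by
    rw [← exp_add]; exact exp_le_exp.2 (by linarith)
  have h2 : (256 : ℝ) ≤ exp 6 := by
    have := Real.exp_one_gt_d9
    calc (256 : ℝ) ≤2.7 ^6 := by norm_num
      _ ≤ exp 1 ^6 := by gcongr; linarith
      _ = _ := by rw [← exp_nat_mul]; norm_num
  have h3 : exp 6 * exp (-6) =1 := by rw [← exp_add]; simp
  nlinarith [exp_pos (-4), exp_pos (-6), exp_pos 6]
lemma bd_empty : bd ∅ = ∅ := by ext e; simp [mem_bd]
lemma cnt0 (hb : 20 ≤ b) (R : Finset Site) (n : ℕ) :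
    ∑ A ∈ LA R n, exp (-b /2 * (bd A).card) ≤ exp (eps R n /2) := by
  have h1 := h256 hb
  have h2 := countA R (n := n) (exp_pos (-b /2)).le (h1.trans (Real.exp_le_one_iff.2 (by norm_num)))
  simp only [← exp_nat_mul] at h2
  refine (le_of_eq (sum_congr rfl fun A _ => by rw [mul_comm])).trans (h2.trans (exp_le_exp.2 ?_))
  have h3 : (256 * exp (-b /2)) ^ n ≤ exp (-4 * n) := by
    calc _ ≤ exp (-4) ^ n := by gcongr
      _ = _ := by rw [← exp_nat_mul, mul_comm]
  have h4 : ((ed R).card : ℝ) ≤4 * R.card := by exact_mod_cast ed_card R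
  calc _ ≤4 * (R.card : ℝ) * exp (-4 * n) := by gcongr
    _ = _ := by unfold eps; ring
lemma cnt (hb : 20 ≤ b) {R : Finset Site} {n : ℕ} (he : eps R n ≤1) :
    ∑ A ∈ LN R n, exp (-b /2 * (bd A).card) ≤ eps R n := by
  have h1 := cnt0 hb R n
  have h0 : ∅ ∈ LA R n := mem_filter.2 ⟨Finset.empty_mem_powerset _, by simp [bd_empty]⟩
  rw [← Finset.add_sum_erase _ _ h0] at h1
  simp only [bd_empty, Finset.card_empty, Nat.cast_zero, mul_zero, Real.exp_zero] at h1
  have := eps_nn R n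
  have h2 := Real.abs_exp_sub_one_sub_id_le (x := eps R n /2) (by rw [abs_of_nonneg] <;> linarith)
  have h3 := (abs_le.1 h2).2
  change ∑ A ∈ (LA R n).erase ∅, _ ≤ _
  nlinarith
lemma S_cnt (hb : 20 ≤ b) {R : Finset Site} {n : ℕ} (he : eps R n ≤1) {Y : ℝ≥0∞} (F : Finset Site → Set Om)
    (hE : ∀ η, (∀ x ∉ Λ, η x = ζ x) → η ∈ E → ∃ A ∈ LN R n, η ∈ F A)
    (hF : ∀ A ∈ LN R n, S b Λ ζ (ii (F A)) ≤ ofReal (exp (-b /2 * (bd A).card)) * Y) :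
    S b Λ ζ (ii E) ≤ ofReal (eps R n) * Y := by
  refine (S_union _ F hE).trans ((sum_le_sum hF).trans ?_)
  rw [← Finset.sum_mul, ← ENNReal.ofReal_sum_of_nonneg (fun _ _ => (exp_pos _).le)]
  gcongr; exact cnt hb he
def sh (A : Finset Site) (s : ℤ) (η : Om) : Om := fun x => η x + if x ∈ A then s else 0
lemma sh_inj (A : Finset Site) (s : ℤ) : Function.Injective (sh A s) := fun η η' h => by
  ext x; have := congrFun h x; simpa [sh] using this
lemma bd_sub {A R : Finset Site} (h : A ⊆ R) : bd A ⊆ ed R := (filter_subset _ _).trans (ed_mono h)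
lemma peierls (hb : 0 ≤ b) {F : Finset Edge} {A : Finset Site} (hF : bd A ⊆ F) {s : ℤ} (hs : s * s =1)
    (h : ∀ a ∈ A, ∀ o ∉ A, Ad a o → 1 ≤ s * (η o - η a)) :
    ofReal (exp (b * (bd A).card)) * wt b F η ≤ wt b F (sh A s η) := by
  rw [wt, wt, ← ofReal_mul (exp_pos _).le, ← exp_add]
  refine ofReal_le_ofReal (exp_le_exp.2 ?_)
  have key : en F (sh A s η) + (bd A).card ≤ en F η := by
    have : ((bd A).card : ℝ) = ∑ e ∈ F, if e ∈ bd A then (1 : ℝ) else 0 := by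
      rw [Finset.sum_ite_mem, Finset.inter_eq_right.2 hF]; simp
    rw [this, en, en, ← sum_add_distrib]
    refine sum_le_sum fun e _ => ?_
    by_cases h1 : e.1 ∈ A <;> by_cases h2 : tg e ∈ A
    · simp [mem_bd, h1, h2, gr, sh]
    · have := h _ h1 _ h2 ⟨e, .inl ⟨rfl, rfl⟩⟩
      simp only [mem_bd, h1, h2, gr, sh, if_true, if_false]; norm_num
      norm_cast; nlinarith
    · have := h _ h2 _ h1 ⟨e, .inr ⟨rfl, rfl⟩⟩
      simp only [mem_bd, h1, h2, gr, sh, if_true, if_false]; norm_num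
      norm_cast; nlinarith
    · simp [mem_bd, h1, h2, gr, sh]
  nlinarith
lemma S_pei (hb : 0 ≤ b) {A : Finset Site} (hA : A ⊆ Λ) {s : ℤ} (hs : s * s =1)
    (h : ∀ η ∈ E, (∀ x ∉ Λ, η x = ζ x) → (∀ a ∈ A, ∀ o ∉ A, Ad a o → 1 ≤ s * (η o - η a)) ∧ sh A s η ∈ B) :
    S b Λ ζ (ii E) ≤ ofReal (exp (-b * (bd A).card)) * S b Λ ζ (ii B) := by
  have h1 := S_map (b := b) (W := Λ) (ζ := ζ) (ζ' := ζ) (A := E) (B := B) (sh A s) (ofReal (exp (b * (bd A).card)))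
    (sh_inj A s).injOn fun η h1 h2 => ⟨fun x hx => by simp [sh, show x ∉ A from fun h => hx (hA h), h2 x hx],
      (h η h1 h2).2, peierls hb (bd_sub hA) hs (h η h1 h2).1⟩
  calc S b Λ ζ (ii E) = ofReal (exp (-b * (bd A).card)) * (ofReal (exp (b * (bd A).card)) * S b Λ ζ (ii E)) := by
        rw [← mul_assoc, ← ofReal_mul (exp_pos _).le, ← exp_add]; simp
    _ ≤ _ := by gcongr
lemma S_cnt' (hb : 20 ≤ b) {R : Finset Site} {n : ℕ} (he : eps R n ≤1) {s : ℤ} (hs : s * s =1)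
    (hE : ∀ η, (∀ x ∉ R, η x = ζ x) → η ∈ E → ∃ A ∈ LN R n, (∀ a ∈ A, ∀ o ∉ A, Ad a o → 1 ≤ s * (η o - η a)) ∧ sh A s η ∈ B) :
    S b R ζ (ii E) ≤ ofReal (eps R n) * S b R ζ (ii B) := by
  refine S_cnt hb he (fun A => {η | (∀ a ∈ A, ∀ o ∉ A, Ad a o → 1 ≤ s * (η o - η a)) ∧ sh A s η ∈ B}) hE fun A hA => ?_
  refine (S_pei (by linarith) (mem_powerset.1 (mem_filter.1 (Finset.mem_of_mem_erase hA)).1) hs fun η h _ => h).trans ?_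
  gcongr; nlinarith [(Nat.cast_nonneg (bd A).card : (0:ℝ) ≤ _)]
lemma Kx_Cn {P : ℤ → Prop} {D : Finset Site} {z : Site} (h : Kx P D η z) :
    P (η z) ∧ ∃ w, w ∉ D ∧ P (η w) ∧ Cn (fun x => P (η x)) z w := by
  induction h with
  | base z h1 h2 => exact ⟨h2, z, h1, h2, .refl⟩
  | step y z h1 h2 h3 h4 ih =>
    obtain ⟨h5, w, h6, h7, h8⟩ := ih
    exact ⟨h4, w, h6, h7, h8.head ⟨h2.symm, h4, h5⟩⟩
lemma nVx {P : ℤ → Prop} {D : Finset Site} {y : Site} (hy : y ∈ D) (h : y ∉ Vx P D η) :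
    ∃ z, (z = y ∨ Ad y z) ∧ P (η z) ∧ ∃ w, w ∉ D ∧ P (η w) ∧ Cn (fun x => P (η x)) z w := by
  simp only [Vx, mem_filter, hy, true_and, not_and_or, not_not, not_forall] at h
  rcases h with h | ⟨z, h1, h2⟩
  · exact ⟨y, .inl rfl, Kx_Cn h⟩
  · exact ⟨z, .inr h1, Kx_Cn h2⟩
lemma mem_Bx {x z : Site} {r : ℕ} : z ∈ Bx x r ↔ |z.1 - x.1| ≤ r ∧ |z.2 - x.2| ≤ r := by
  simp only [Bx, mem_product, Finset.mem_Icc, abs_le]; constructor <;> intro h <;> omega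

def UB (b : ℝ) (W : Finset Site) (x : Site) (j : ℤ) (c : ℝ) : Prop :=
  S b W 0 (ii {η | j ≤ η x}) ≤ ofReal c * S b W 0 (ii Set.univ)
lemma Z_ne : S b W ζ (ii Set.univ) ≠ 0 := S_pos (Set.mem_univ ζ) fun _ _ => rfl
lemma cancel {a a' z z' c : ℝ≥0∞} (h : a * z' ≤ a' * z) (h' : a' ≤ c * z') (h0 : z' ≠ 0) (h1 : z' ≠ ⊤) : a ≤ c * z := by
  refine (ENNReal.mul_le_mul_iff_left h0 h1).1 (h.trans ?_)
  calc a' * z ≤ c * z' * z := by gcongr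
    _ = _ := by ring
lemma UB_mono (hb : 0 < b) {x : Site} {j : ℤ} {c : ℝ} (h : UB b Λ x j c) (hW : W ⊆ Λ) (hx : x ∈ W) (hj : 1 ≤ j) : UB b W x j c :=
  cancel (Amono hb hx hW hj) h Z_ne (S_fin' hb)
lemma On_univ : On W Set.univ := fun _ _ _ _ => trivial
lemma On_up {x : Site} (hx : x ∈ W) (j : ℤ) : On W {η | j ≤ η x} := fun η η' h h1 => by
  have h1 : j ≤ η x := h1
  rw [h x hx] at h1; exact h1
lemma UB_bc (hb : 0 < b) {x : Site} {j : ℤ} {c : ℝ} (h : UB b W x j c) (hx : x ∈ W)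
    (hξ : ∀ x ∈ W, ∀ y ∉ W, Ad x y → ξ y ≤0) : S b W ξ (ii {η | j ≤ η x}) ≤ ofReal c * S b W ξ (ii Set.univ) := by
  have := LOC hb.le (I := Set.univ) (J := Set.univ) (E := {η : Om | j ≤ η x}) (ζ := ξ) (ζ' := 0) hξ On_univ On_univ (On_up hx j)
    fun η η' _ h _ => ⟨trivial, trivial, le_trans (show j ≤ η x from h) (le_max_left (η x) (η' x))⟩
  rw [Set.univ_inter] at this
  refine cancel (this.trans_eq (mul_comm _ _)) h Z_ne (S_fin' hb)
lemma DL (hb : 20 ≤ b) {R : Finset Site} (hR : IsR R) {x : Site} {r : ℕ} (hB : Bx x r ⊆ R) (he : eps R r ≤1) {j : ℤ} (hj : 1 ≤ j)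
    {c : ℝ} (hV : ∀ V ⊆ Bx x r, x ∈ V → UB b V x j c) :
    S b R 0 (ii {η | j ≤ η x}) ≤ ofReal c * S b R 0 (ii Set.univ) + ofReal (eps R r) * S b R 0 (ii {η | j -1 ≤ η x}) := by
  have hb0 : 0 < b := by linarith
  have hxB : x ∈ Bx x r := by simp [mem_Bx]
  refine (S_or (B := {η | j ≤ η x ∧ x ∈ Vx (fun t => 1 ≤ t) (Bx x r) η}) (E := {η | j ≤ η x ∧ x ∉ Vx (fun t => 1 ≤ t) (Bx x r) η})
    fun η _ h => ?_).trans (add_le_add ?_ ?_)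
  · by_cases h1 : x ∈ Vx (fun t => 1 ≤ t) (Bx x r) η
    · exact .inl ⟨h, h1⟩
    · exact .inr ⟨h, h1⟩
  · rw [← S_smul]
    refine expl (P := fun t => 1 ≤ t) hB fun ξ hξ => ?_
    rw [S_smul]
    set V := Vx (fun t => 1 ≤ t) (Bx x r) ξ with hVd
    have hVe : ∀ η : Om, (∀ z ∉ V, η z = ξ z) → Vx (fun t => 1 ≤ t) (Bx x r) η = V := fun η h => Vx_eq fun z _ hz => h z hz
    by_cases hx : x ∈ V
    · refine (S_ii_mono fun η _ h => h.1).trans (UB_bc hb0 (hV V Vx_sub hx) hx fun y hy z hz ha => ?_)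
      have := Vx_bd hy hz ha; omega
    · refine le_trans (S_mono (g := fun η => 0 * ii Set.univ η) fun η h => ?_) (by rw [S_smul]; simp)
      simp [ii, hVe η h, hx]
  · refine S_cnt' hb he (s := -1) (by norm_num) fun η h0 hη => ?_
    obtain ⟨h1, h2⟩ := hη
    have hp : ∀ z, 1 ≤ η z → z ∈ R := fun z h => by by_contra h3; rw [h0 z h3] at h; simp at h
    obtain ⟨A, hA, hA1, hA2⟩ := geo hR (p := fun z => 1 ≤ η z) r hp
    obtain ⟨z, hz, hpz, w, hw, hpw, hc⟩ := nVx hxB h2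
    have hx1 : 1 ≤ η x := hj.trans h1
    have hcx : Cn (fun z => 1 ≤ η z) x w := by
      rcases hz with rfl | hz
      · exact hc
      · exact hc.head ⟨hz, hx1, hpz⟩
    have hxA := hA2 x w hx1 hcx (by
      rw [mem_Bx, not_and_or] at hw; unfold far; rw [abs_sub_comm x.1, abs_sub_comm x.2]; omega)
    refine ⟨A, Finset.mem_erase.2 ⟨Finset.ne_empty_of_mem hxA, hA⟩, fun a ha o ho hao => ?_, ?_⟩
    · have := hA1 a ha o ho hao; omega
    · show j -1 ≤ sh A (-1) η x
      have h1 : j ≤ η x := h1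
      simp [sh, hxA]; omega
lemma tg_add (e v : Site) (c : Bool) : tg (e + v, c) = tg (e, c) + v := by
  cases c <;> ext <;> simp [tg] <;> ring
/-- translation -/
lemma S_tr (x : Site) (r : ℕ) (f : Om → ℝ≥0∞) : S b (Bx x r) 0 f = S b (Bx 0 r) 0 (fun η => f (fun z => η (z - x))) := by
  have key : ∀ (x y : Site) (f g : Om → ℝ≥0∞), (∀ η, f η = g (fun z => η (z + (x - y)))) → S b (Bx x r) 0 f ≤ S b (Bx y r) 0 g := by
    intro x y f g hfg
    have hm : ∀ z, z ∈ Bx y r ↔ z + (x - y) ∈ Bx x r := fun z => by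
      simp only [mem_Bx, Prod.fst_add, Prod.snd_add, Prod.fst_sub, Prod.snd_sub]
      rw [show z.1 + (x.1 - y.1) - x.1 = z.1 - y.1 by ring, show z.2 + (x.2 - y.2) - x.2 = z.2 - y.2 by ring]
    refine S_mapf (fun η z => η (z + (x - y))) (fun η η' _ _ _ _ h => ?_) fun η h _ => ⟨fun z hz => h _ (by rwa [← hm]), le_of_eq ?_⟩
    · ext z; have := congrFun h (z - (x - y)); simpa using this
    · rw [hfg]; congr 1
      rw [wt, wt]; congr 3
      unfold en
      refine Finset.sum_bij' (fun e _ => (e.1 - (x - y), e.2)) (fun e _ => (e.1 + (x - y), e.2)) ?_ ?_ ?_ ?_ ?_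
      · rintro ⟨e, c⟩ he; rw [mem_ed] at he ⊢; rw [hm, hm, ← tg_add]; simpa using he
      · rintro ⟨e, c⟩ he; rw [mem_ed] at he ⊢; rw [hm, hm, ← tg_add] at he; exact he
      · intros; simp
      · intros; simp
      · rintro ⟨e, c⟩ he
        have : tg (e - (x - y), c) + (x - y) = tg (e, c) := by rw [← tg_add, sub_add_cancel]
        simp [gr, this]
  refine le_antisymm (key x 0 _ _ fun η => ?_) (key 0 x _ _ fun η => ?_)
  · congr 1; ext z; simp
  · congr 1; ext z; congr 1; abel
def q (b : ℝ) (r : ℕ) (j : ℤ) : ℝ := (S b (Bx 0 r) 0 (ii {η | j ≤ η 0}) / S b (Bx 0 r) 0 (ii Set.univ)).toReal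
lemma q_nn (r : ℕ) (j : ℤ) : 0 ≤ q b r j := ENNReal.toReal_nonneg
lemma q_eq (hb : 0 < b) (x : Site) (r : ℕ) (j : ℤ) :
    S b (Bx x r) 0 (ii {η | j ≤ η x}) = ofReal (q b r j) * S b (Bx x r) 0 (ii Set.univ) := by
  have h1 : S b (Bx x r) 0 (ii {η | j ≤ η x}) = S b (Bx 0 r) 0 (ii {η | j ≤ η 0}) := by
    rw [S_tr]; congr 1; ext η; simp [ii, Set.indicator]
  have h2 : S b (Bx x r) 0 (ii Set.univ) = S b (Bx 0 r) 0 (ii Set.univ) := by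
    rw [S_tr]; rfl
  rw [h1, h2, q, ENNReal.ofReal_toReal, ENNReal.div_mul_cancel Z_ne (S_fin' hb)]
  exact ENNReal.div_ne_top (S_fin' hb) Z_ne
lemma q_le (hb : 0 < b) {r : ℕ} {j : ℤ} {c : ℝ} (hc : 0 ≤ c) (h : UB b (Bx 0 r) 0 j c) : q b r j ≤ c := by
  refine ENNReal.toReal_le_of_le_ofReal hc ?_
  exact ENNReal.div_le_of_le_mul h
lemma q_UB (hb : 0 < b) (x : Site) (r : ℕ) {j : ℤ} (hj : 1 ≤ j) (V : Finset Site) (hV : V ⊆ Bx x r) (hx : x ∈ V) : UB b V x j (q b r j) :=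
  UB_mono hb (q_eq hb x r j).le hV hx hj
lemma q_one (hb : 0 < b) (r : ℕ) (j : ℤ) : q b r j ≤1 := q_le hb zero_le_one (by
  unfold UB; simp only [ENNReal.ofReal_one, one_mul]; exact S_ii_mono fun _ _ _ => trivial)
lemma q_anti (hb : 0 < b) (r : ℕ) {j j' : ℤ} (h : j ≤ j') : q b r j' ≤ q b r j := q_le hb (q_nn _ _) (by
  unfold UB; rw [← q_eq hb]; exact S_ii_mono fun η _ h' => le_trans h h')
lemma Bq (hb : 20 ≤ b) {R : Finset Site} (hR : IsR R) {x : Site} {r : ℕ} (hB : Bx x r ⊆ R) (he : eps R r ≤1) {j : ℤ} (hj : 1 ≤ j)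
    (hW : W ⊆ R) (hx : x ∈ W) : UB b W x j (q b r j + eps R r) := by
  refine UB_mono (by linarith) ?_ hW hx hj
  refine (DL hb hR hB he hj (q_UB (by linarith) x r hj)).trans ?_
  rw [ofReal_add (q_nn _ _) (eps_nn _ _), add_mul]
  gcongr; exact S_ii_mono fun _ _ _ => trivial
lemma Dq (hb : 20 ≤ b) {l r : ℕ} (hr : 1 ≤ r) (hl : r ≤ l) (he : eps (Bx 0 l) r ≤1) {j : ℤ} (hj : 1 ≤ j) :
    q b l j ≤ exp (-b * (j:ℝ) ^2 * (2 * π / (log r +3))) + eps (Bx 0 l) r * q b l (j -1) := by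
  have hb0 : 0 < b := by linarith
  have hq := mul_nonneg (eps_nn (Bx 0 l) r) (q_nn (b := b) l (j -1))
  refine q_le hb0 (by positivity) ?_
  have h1 := DL hb (IsR_Bx 0 l) (x := 0) (r := r) (fun z hz => by rw [mem_Bx] at hz ⊢; omega) he hj
    (c := exp (-b * (j:ℝ) ^2 * (2 * π / (log r +3)))) fun V hV hx => by
      have := tailC hb0 hx hr hV (t := (j : ℝ)) (by exact_mod_cast (by omega : 0 ≤ j))
      unfold UB; simpa only [Int.cast_le] using this
  refine h1.trans ?_
  rw [ofReal_add (exp_pos _).le hq, add_mul, ofReal_mul (eps_nn _ _), q_eq hb0]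
  simp only [mul_assoc]; exact le_rfl

def FV (V : Finset Site) (c : ℤ) : Set Om := {η | ∀ x ∈ V, c ≤ η x}
lemma On_FV (c : ℤ) : On W (FV W c) := fun η η' h h1 x hx => by rw [← h x hx]; exact h1 x hx
lemma On_FVs (c : ℤ) (h : V ⊆ W) : On W (FV V c) := fun η η' h0 h1 x hx => by rw [← h0 x (h hx)]; exact h1 x hx
lemma ofR_split {a z : ℝ≥0∞} {r : ℝ} (hr : 0 ≤ r) (hr1 : r ≤1) {f : ℝ≥0∞} (hz : z ≠ ⊤) (h : z ≤ f + a) (ha : a ≤ ofReal r * z) :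
    ofReal (1 - r) * z ≤ f := by
  have h1 : ofReal (1 - r) * z + ofReal r * z = z := by
    rw [← add_mul, ← ofReal_add (by linarith) hr]; simp
  have h2 : ofReal (1 - r) * z + ofReal r * z ≤ f + ofReal r * z := by
    rw [h1]; exact h.trans (by gcongr)
  exact (ENNReal.add_le_add_iff_right (ENNReal.mul_ne_top ENNReal.ofReal_ne_top hz)).1 h2
lemma S_le_neg {y : Site} {j : ℤ} {Q : ℝ} (h : UB b W y j Q) :
    S b W 0 (ii {η | η y ≤ -j}) ≤ ofReal Q * S b W 0 (ii Set.univ) := by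
  unfold UB at h; rw [S_neg]; refine le_trans (le_of_eq ?_) h; congr 1; ext η; simp [ii, Set.indicator]
lemma floorP (hb : 0 < b) {c : ℤ} {Q : ℝ} (h0 : 0 ≤ Q) (hQ : Q ≤1 /2) (h : ∀ y ∈ W, UB b W y (c +1) Q) :
    S b W 0 (ii Set.univ) ≤ ofReal (exp (2 * W.card * Q)) * S b W 0 (ii (FV W (-c))) := by
  have key : ∀ T ⊆ W, ofReal ((1 - Q) ^ T.card) * S b W 0 (ii Set.univ) ≤ S b W 0 (ii (FV T (-c))) := by
    intro T
    induction T using Finset.induction_on with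
    | empty => intro _; simp [FV]
    | insert y T hy ih =>
      intro hT
      have hyW := hT (Finset.mem_insert_self y T)
      have hTW : T ⊆ W := fun z hz => hT (Finset.mem_insert_of_mem hz)
      have h1 := LOC hb.le (I := Set.univ) (J := FV T (-c)) (E := {η : Om | -c ≤ η y}) (ζ := 0) (ζ' := 0) (W := W) (fun _ _ _ _ _ => le_rfl)
        On_univ (On_FVs _ hTW) (On_up hyW _) fun η η' _ h h' => ⟨trivial, fun x hx => le_trans (h' x hx) (le_max_right (η x) (η' x)),
          le_trans (show -c ≤ η y from h) (le_max_left (η y) (η' y))⟩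
      rw [Set.univ_inter] at h1
      have h2 : ofReal (1 - Q) * S b W 0 (ii Set.univ) ≤ S b W 0 (ii {η : Om | -c ≤ η y}) :=
        ofR_split h0 (by linarith) (S_fin' hb) (S_or fun η _ _ => by
          show -c ≤ η y ∨ η y ≤ -(c +1)
          omega) (S_le_neg (h y hyW))
      have h3 : S b W 0 (ii (FV T (-c) ∩ {η : Om | -c ≤ η y})) ≤ S b W 0 (ii (FV (insert y T) (-c))) :=
        S_ii_mono fun η _ h x hx => by
          rcases Finset.mem_insert.1 hx with rfl | hx
          · exact h.2
          · exact h.1 x hx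
      have h4 : ofReal (1 - Q) * S b W 0 (ii (FV T (-c))) ≤ S b W 0 (ii (FV (insert y T) (-c))) := by
        refine (ENNReal.mul_le_mul_iff_left Z_ne (S_fin' hb (W := W))).1 ?_
        calc _ = (ofReal (1 - Q) * S b W 0 (ii Set.univ)) * S b W 0 (ii (FV T (-c))) := by ring
          _ ≤ _ := mul_le_mul_left h2 _
          _ ≤ _ := h1
          _ ≤ _ := by rw [mul_comm]; gcongr
      rw [Finset.card_insert_of_notMem hy, pow_succ', ofReal_mul (by linarith), mul_assoc]
      exact (mul_le_mul_right (ih hTW) _).trans h4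
  have h1 := key W subset_rfl
  have h2 : 1 ≤ exp (2 * W.card * Q) * (1 - Q) ^ W.card := by
    have : exp (2 * W.card * Q) = exp (2 * Q) ^ W.card := by rw [← exp_nat_mul]; ring_nf
    rw [this, ← mul_pow]
    refine one_le_pow₀ ?_
    nlinarith [add_one_le_exp (2 * Q)]
  calc S b W 0 (ii Set.univ) ≤ ofReal (exp (2 * W.card * Q) * (1 - Q) ^ W.card) * S b W 0 (ii Set.univ) := by
        conv_lhs => rw [← one_mul (S b W 0 _)]
        gcongr; simpa using h2
    _ ≤ _ := by rw [ofReal_mul (exp_pos _).le, mul_assoc]; gcongr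
lemma floorU (hb : 0 < b) {c : ℤ} {Q : ℝ} (h0 : 0 ≤ Q) (hQ : Q ≤1 /2) (h : ∀ y ∈ W, UB b W y (c +1) Q)
    (hξ : ∀ x ∈ W, ∀ y ∉ W, Ad x y → 0 ≤ ξ y) :
    S b W ξ (ii Set.univ) ≤ ofReal (exp (2 * W.card * Q)) * S b W ξ (ii (FV W (-c))) := by
  have h1 := LOC hb.le (I := Set.univ) (J := Set.univ) (E := FV W (-c)) (ζ := 0) (ζ' := ξ) (W := W) hξ On_univ On_univ (On_FV _)
    fun η η' _ h _ => ⟨trivial, trivial, fun x hx => le_trans (h x hx) (le_max_left (η x) (η' x))⟩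
  rw [Set.univ_inter] at h1
  have hh : S b W 0 (ii (FV W (-c))) ≠ 0 := fun h2 => by
    have := floorP hb h0 hQ h; rw [h2, mul_zero] at this; exact Z_ne (le_antisymm this zero_le)
  exact cancel ((mul_comm _ _).trans_le h1) (floorP hb h0 hQ h) hh (S_fin' hb)
lemma floorD (hb : 0 < b) {c : ℤ} {Q Q2 : ℝ} (h0 : 0 ≤ Q) (hQ : Q ≤1 /2) (h : ∀ y ∈ W, UB b W y (c +1) Q) {x : Site} (hx : x ∈ W) {j : ℤ}
    (h2 : UB b W x j Q2) (h20 : 0 ≤ Q2) (hc : 2 * W.card * Q ≤1 /2) (hξ : ∀ x ∈ W, ∀ y ∉ W, Ad x y → ξ y ≤0) :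
    S b W ξ (ii (FV W (-c) ∩ {η | j ≤ η x})) ≤ ofReal (2 * Q2) * S b W ξ (ii (FV W (-c))) := by
  have h1 := LOC hb.le (I := FV W (-c)) (J := FV W (-c)) (E := {η | j ≤ η x}) (ζ := ξ) (ζ' := 0) (W := W) hξ (On_FV _) (On_FV _) (On_up hx j)
    fun η η' hi h hj => ⟨fun x hx => le_min (hi x hx) (hj x hx), fun x hx => le_trans (hi x hx) (le_max_left (η x) (η' x)),
      le_trans (show j ≤ η x from h) (le_max_left (η x) (η' x))⟩
  have h3 := floorP hb h0 hQ h
  have hh : S b W 0 (ii (FV W (-c))) ≠ 0 := fun h2 => by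
    rw [h2, mul_zero] at h3; exact Z_ne (le_antisymm h3 zero_le)
  have he : exp (2 * W.card * Q) ≤2 := by
    refine (exp_le_exp.2 hc).trans ?_
    have := Real.abs_exp_sub_one_sub_id_le (x := 1 /2) (by norm_num [abs_le])
    have := (abs_le.1 this).2; norm_num at this; linarith
  refine cancel (h1.trans_eq (mul_comm _ _)) ?_ hh (S_fin' hb)
  calc S b W 0 (ii (FV W (-c) ∩ {η | j ≤ η x})) ≤ S b W 0 (ii {η | j ≤ η x}) := S_ii_mono fun _ _ h => h.2
    _ ≤ ofReal Q2 * S b W 0 (ii Set.univ) := h2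
    _ ≤ ofReal Q2 * (ofReal 2 * S b W 0 (ii (FV W (-c)))) := by gcongr; exact h3.trans (by gcongr)
    _ = _ := by rw [← mul_assoc, ← ofReal_mul h20, mul_comm Q2]
lemma S_shift (c : ℤ) (f : Om → ℝ≥0∞) : S b W (fun _ => c) f = S b W 0 (fun η => f (fun x => η x + c)) := by
  have key : ∀ (c d : ℤ) (f g : Om → ℝ≥0∞), (∀ η, f η = g (fun x => η x + (d - c))) → S b W (fun _ => c) f ≤ S b W (fun _ => d) g := by
    intro c d f g h
    refine S_mapf (fun η x => η x + (d - c)) (fun η η' _ _ _ _ h => ?_) fun η h1 _ => ⟨fun x hx => by simp [h1 x hx], le_of_eq ?_⟩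
    · ext x; have := congrFun h x; simpa using this
    · rw [h]; congr 1; exact wt_congr fun e _ => by simp [gr]
  refine le_antisymm (key c 0 _ _ fun η => ?_) (key 0 c _ _ fun η => ?_)
  · congr 1; ext x; simp
  · congr 1; ext x; simp
lemma bd_iso {L : ℕ} {A : Finset Site} (hA : A ⊆ box L) : A.card ≤ L * (bd A).card := by
  have hex : ∀ a ∈ A, ∃ e ∈ bd A, e.1.2 = a.2 := fun a ha => by
    by_contra! h
    have : ∀ k : ℕ, (a.1 + (k:ℤ), a.2) ∈ A := fun k => by
      induction k with
      | zero => simpa using ha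
      | succ k ih =>
        by_contra h1
        refine h ((a.1 + (k:ℤ), a.2), true) (mem_bd.2 fun h2 => h1 ?_) rfl
        have := h2.1 ih; simp only [tg, if_true] at this; push_cast; rwa [← add_assoc]
    have h1 := hA ha; have h2 := hA (this L)
    simp [box] at h1 h2; omega
  choose! φ h1 h2 using hex
  refine Finset.card_le_mul_card_image_of_maps_to (f := φ) h1 L fun e _ => ?_
  calc _ ≤ (Finset.Icc (1:ℤ) L).card := by
        refine Finset.card_le_card_of_injOn (fun a => a.1) (fun a ha => ?_) fun a ha a' ha' h => ?_
        · have := hA (mem_filter.1 ha).1; simp [box] at this ⊢; omega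
        · have e1 := mem_filter.1 ha; have e2 := mem_filter.1 ha'
          exact Prod.ext h (by rw [← h2 a e1.1, ← h2 a' e2.1, e1.2, e2.2])
    _ = L := by simp

lemma S_zero (h : ∀ η, (∀ x ∉ W, η x = ζ x) → η ∉ A) : S b W ζ (ii A) =0 := by
  refine le_antisymm ((S_mono (g := fun η => 0 * ii Set.univ η) fun η h1 => ?_).trans (by rw [S_smul]; simp)) zero_le
  simp [ii, h η h1]
lemma box_card (L : ℕ) : (box L).card = L ^2 := by simp [box, sq]
lemma up (hb : 20 ≤ b) {L l : ℕ} {c j : ℤ} (hc : 0 ≤ c) (hj : 1 ≤ j) {Q1 Q2 : ℝ} (h01 : 0 ≤ Q1) (h02 : 0 ≤ Q2)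
    (h1 : ∀ V ⊆ box L, ∀ y ∈ V, UB b V y (c +1) Q1) (h2 : ∀ V ⊆ box L, ∀ y ∈ V, UB b V y j Q2) (hQ : Q1 ≤1 /2)
    (hQB : 2 * (2 * l +1) ^2 * Q1 ≤1 /2) (hQL : 2 * L * Q1 ≤ b /2) (he : eps (box L) l ≤1) :
    S b (box L) 0 (ii (FV (box L) (-c) ∩ {η | ∃ x ∈ box L, j ≤ η x})) ≤
      ofReal (L ^2 * (2 * Q2) + eps (box L) l) * S b (box L) 0 (ii (FV (box L) (-c))) := by
  have hb0 : 0 < b := by linarith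
  rw [ofReal_add (by positivity) (eps_nn _ _), add_mul]
  set Λ := box L with hΛ
  let D : Site → Finset Site := fun x => Bx x l ∩ Λ
  have hD : ∀ x, D x ⊆ Λ := fun x => Finset.inter_subset_right
  let P : ℤ → Prop := fun t => 1 ≤ t
  refine (S_or (B := {η | η ∈ FV Λ (-c) ∧ ∃ x ∈ Λ, j ≤ η x ∧ x ∈ Vx P (D x) η}) (E := {η | η ∈ FV Λ (-c) ∧ ∃ x ∈ Λ, j ≤ η x ∧ x ∉ Vx P (D x) η})
    fun η _ h => ?_).trans (add_le_add ?_ ?_)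
  · obtain ⟨h3, x, hx, hj⟩ := h
    by_cases h1 : x ∈ Vx P (D x) η
    · exact .inl ⟨h3, x, hx, hj, h1⟩
    · exact .inr ⟨h3, x, hx, hj, h1⟩
  · refine (S_union Λ (fun x => {η | η ∈ FV Λ (-c) ∧ j ≤ η x ∧ x ∈ Vx P (D x) η}) fun η _ h => ?_).trans
      ((Finset.sum_le_card_nsmul _ _ (ofReal (2 * Q2) * S b Λ 0 (ii (FV Λ (-c)))) fun x hx => ?_).trans ?_)
    · obtain ⟨h3, x, hx, hj, hv⟩ := h; exact ⟨x, hx, h3, hj, hv⟩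
    · rw [← S_smul]
      refine expl (P := P) (hD x) fun ξ hξ => ?_
      rw [S_smul]
      set V := Vx P (D x) ξ with hVd
      have hVΛ : V ⊆ Λ := Vx_sub.trans (hD x)
      have hVe : ∀ η : Om, (∀ z ∉ V, η z = ξ z) → Vx P (D x) η = V := fun η h => Vx_eq fun z _ hz => h z hz
      by_cases hg : x ∈ V ∧ ∀ z ∈ Λ, z ∉ V → -c ≤ ξ z
      · refine (S_ii_mono (B := FV V (-c) ∩ {η | j ≤ η x}) fun η _ h => ⟨fun z hz => h.1 z (hVΛ hz), h.2.1⟩).trans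
          ((floorD hb0 h01 hQ (fun y hy => h1 V hVΛ y hy) hg.1 (h2 V hVΛ x hg.1) h02 ?_ ?_).trans ?_)
        · refine le_trans ?_ hQB
          have h5 : V.card ≤ (2 * l +1) ^2 := by
            refine (Finset.card_le_card (Vx_sub.trans Finset.inter_subset_left)).trans_eq ?_
            rw [Bx, Finset.card_product, Int.card_Icc, Int.card_Icc, sq]; congr 1 <;> omega
          have h5 : (V.card : ℝ) ≤ (2 * l +1) ^2 := by exact_mod_cast h5
          gcongr
        · intro y hy z hz ha
          have : ¬ 1 ≤ ξ z := Vx_bd hy hz ha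
          omega
        · gcongr
          refine S_ii_mono fun η h h3 z hz => ?_
          by_cases hzV : z ∈ V
          · exact h3 z hzV
          · rw [h z hzV]; exact hg.2 z hz hzV
      · rw [S_zero]
        · exact zero_le
        · intro η h ⟨h3, _, h4⟩
          rw [hVe η h] at h4
          exact hg ⟨h4, fun z hz hzV => by rw [← h z hzV]; exact h3 z hz⟩
    · rw [box_card, nsmul_eq_mul, ← mul_assoc, ofReal_mul (p := (L:ℝ) ^2) (by positivity),
        ← ENNReal.ofReal_natCast]; push_cast; rfl
  · refine S_cnt hb he (fun A => {η | η ∈ FV Λ (-c) ∧ ∀ a ∈ A, ∀ o ∉ A, Ad a o → 1 ≤ η a ∧ ¬ 1 ≤ η o}) (fun η h0 hη => ?_) fun A hA => ?_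
    · obtain ⟨hF, x, hxΛ, hjx, h2⟩ := hη
      have hp : ∀ z, 1 ≤ η z → z ∈ Λ := fun z h => by by_contra h3; rw [h0 z h3] at h; simp at h
      obtain ⟨A, hA, hA1, hA2⟩ := geo (IsR_box L) (p := fun z => 1 ≤ η z) l hp
      obtain ⟨z, hz, hpz, w, hw, hpw, hcc⟩ := nVx (Finset.mem_inter.2 ⟨by simp [mem_Bx], hxΛ⟩) h2
      have hx1 : 1 ≤ η x := hj.trans hjx
      have hcx : Cn (fun z => 1 ≤ η z) x w := by
        rcases hz with rfl | hz
        · exact hcc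
        · exact hcc.head ⟨hz, hx1, hpz⟩
      have hw : w ∉ Bx x l := fun h => hw (Finset.mem_inter.2 ⟨h, hp w hpw⟩)
      have hxA := hA2 x w hx1 hcx (by
        rw [mem_Bx, not_and_or] at hw; unfold far; rw [abs_sub_comm x.1, abs_sub_comm x.2]; omega)
      exact ⟨A, Finset.mem_erase.2 ⟨Finset.ne_empty_of_mem hxA, hA⟩, hF, hA1⟩
    · have hAΛ : A ⊆ Λ := mem_powerset.1 (mem_filter.1 (Finset.mem_erase.1 hA).2).1
      let W := A.filter fun a => ∀ o, Ad a o → o ∈ A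
      have hW : W ⊆ A := filter_subset _ _
      refine (S_pei (by linarith) hAΛ (s := -1) (by norm_num) (B := {η | (∀ z ∈ Λ, z ∉ W → -c ≤ η z) ∧ ∀ a ∈ A, a ∉ W → 0 ≤ η a})
        fun η hη _ => ⟨fun a ha o ho hao => ?_, fun z hz hzW => ?_, fun a ha haW => ?_⟩).trans ?_
      · have := hη.2 a ha o ho hao; omega
      · by_cases hzA : z ∈ A
        · simp only [W, mem_filter, hzA, true_and, not_forall] at hzW
          obtain ⟨o, ho, ho'⟩ := hzW
          have := (hη.2 z hzA o ho' ho).1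
          simp [sh, hzA]; omega
        · simpa [sh, hzA] using hη.1 z hz
      · simp only [W, mem_filter, ha, true_and, not_forall] at haW
        obtain ⟨o, ho, ho'⟩ := haW
        have := (hη.2 a ha o ho' ho).1
        simp [sh, ha]; omega
      · have h3 : S b Λ 0 (ii {η | (∀ z ∈ Λ, z ∉ W → -c ≤ η z) ∧ ∀ a ∈ A, a ∉ W → 0 ≤ η a}) ≤
            ofReal (exp (b /2 * (bd A).card)) * S b Λ 0 (ii (FV Λ (-c))) := by
          rw [← S_smul]
          refine fiber (hW.trans hAΛ) fun ξ hξ => ?_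
          rw [S_smul]
          by_cases hg : (∀ z ∈ Λ, z ∉ W → -c ≤ ξ z) ∧ ∀ a ∈ A, a ∉ W → 0 ≤ ξ a
          · refine (S_ii_mono fun _ _ _ => Set.mem_univ _).trans ((floorU hb0 h01 hQ (c := c) (fun y hy => h1 W (hW.trans hAΛ) y hy) ?_).trans ?_)
            · intro x hx y hy ha
              exact hg.2 y ((mem_filter.1 hx).2 y ha) hy
            · refine mul_le_mul' (ofReal_le_ofReal (exp_le_exp.2 ?_)) ?_
              · have h5 : (W.card : ℝ) ≤ L * (bd A).card := by exact_mod_cast (Finset.card_le_card hW).trans (bd_iso hAΛ)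
                calc 2 * (W.card : ℝ) * Q1 ≤2 * (L * (bd A).card) * Q1 := by gcongr
                  _ =2 * L * Q1 * (bd A).card := by ring
                  _ ≤ _ := by gcongr
              · refine S_ii_mono fun η h h3 z hz => ?_
                by_cases hzV : z ∈ W
                · exact h3 z hzV
                · rw [h z hzV]; exact hg.1 z hz hzV
          · rw [S_zero]
            · exact zero_le
            · intro η h ⟨h3, h4⟩
              exact hg ⟨fun z hz hzV => by rw [← h z hzV]; exact h3 z hz hzV, fun z hz hzV => by rw [← h z hzV]; exact h4 z hz hzV⟩
        refine (mul_le_mul_right h3 _).trans_eq ?_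
        rw [← mul_assoc, ← ofReal_mul (exp_pos _).le, ← exp_add]; congr 3; ring
/-- upper tail of the maximum, any floor `a ≤0` -/
lemma up2 (hb : 0 < b) {L : ℕ} {a c j : ℤ} (hc : 0 ≤ c) (ha : a ≤0) {θ : ℝ}
    (h : S b (box L) 0 (ii (FV (box L) (-c) ∩ {η | ∃ x ∈ box L, j ≤ η x})) ≤ ofReal θ * S b (box L) 0 (ii (FV (box L) (-c)))) :
    S b (box L) 0 (ii (FV (box L) a ∩ {η | ∃ x ∈ box L, j + c ≤ η x})) ≤ ofReal θ * S b (box L) 0 (ii (FV (box L) a)) := by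
  have h1 := LOC hb.le (I := FV (box L) a) (J := FV (box L) 0) (E := {η | ∃ x ∈ box L, j + c ≤ η x}) (ζ := 0) (ζ' := fun _ => c) (W := box L)
    (fun _ _ _ _ _ => hc) (On_FV _) (On_FV _) (fun η η' h ⟨x, hx, h1⟩ => ⟨x, hx, by rwa [← h x hx]⟩)
    fun η η' hi h hj => ⟨fun x hx => le_min (hi x hx) (ha.trans (hj x hx)), fun x hx => le_trans (hj x hx) (le_max_right (η x) (η' x)), by
      obtain ⟨x, hx, h⟩ := h; exact ⟨x, hx, h.trans (le_max_left (η x) (η' x))⟩⟩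
  have h3 : ∀ A : Set Om, S b (box L) (fun _ => c) (ii A) = S b (box L) 0 (ii {η | (fun x => η x + c) ∈ A}) := fun A => by
    rw [S_shift]; rfl
  have e1 : {η : Om | (fun x => η x + c) ∈ FV (box L) 0} = FV (box L) (-c) := by
    ext η; simp only [FV, Set.mem_setOf_eq]; exact forall₂_congr fun x _ => by omega
  have e2 : {η : Om | (fun x => η x + c) ∈ FV (box L) 0 ∩ {η | ∃ x ∈ box L, j + c ≤ η x}} = FV (box L) (-c) ∩ {η | ∃ x ∈ box L, j ≤ η x} := by
    rw [← e1]; ext η; simp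
  rw [h3, h3, e1, e2] at h1
  exact cancel (h1.trans_eq (mul_comm _ _)) h (S_pos (η := 0) (fun x _ => by simpa using hc) fun _ _ => rfl) (S_fin' hb)

lemma LBq (hb : 0 < b) {x : Site} {r : ℕ} (hB : Bx x r ⊆ V) {j : ℤ} (hj : 1 ≤ j) :
    ofReal (q b r j) * S b V 0 (ii Set.univ) ≤ S b V 0 (ii {η | j ≤ η x}) := by
  have h1 := Amono hb (show x ∈ Bx x r by simp [mem_Bx]) hB hj
  rw [q_eq hb] at h1
  refine (ENNReal.mul_le_mul_iff_left (Z_ne (b := b) (W := Bx x r) (ζ := 0)) (S_fin' hb)).1 (le_trans (le_of_eq ?_) h1)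
  ring
lemma kap {c : ℝ} (h0 : 0 ≤ c) (h1 : c <1) {X G E : Set Om} (hGE : ∀ η ∈ G, η ∉ E)
    (h : ofReal c * S b V ξ (ii X) ≤ S b V ξ (ii (X ∩ E))) : S b V ξ (ii (X ∩ G)) ≤ ofReal (1 - c) * S b V ξ (ii X) := by
  by_cases ht : S b V ξ (ii X) = ⊤
  · rw [ht, ENNReal.mul_top (by simpa using h1)]; exact le_top
  have h2 : S b V ξ (ii (X ∩ G)) + S b V ξ (ii (X ∩ E)) ≤ S b V ξ (ii X) := by
    rw [← S_add]
    refine S_mono fun η _ => ?_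
    by_cases hX : η ∈ X <;> by_cases hG : η ∈ G <;> by_cases hE : η ∈ E <;> simp [ii, hX, hG, hE]
    exact (hGE η hG hE).elim
  refine (ENNReal.add_le_add_iff_right (ENNReal.mul_ne_top ENNReal.ofReal_ne_top ht : ofReal c * S b V ξ (ii X) ≠ ⊤)).1 ?_
  rw [← add_mul, ← ofReal_add (by linarith) h0]
  simp only [sub_add_cancel, ENNReal.ofReal_one, one_mul]
  exact (add_le_add_right h _).trans h2
/-- restricting a floor to the explored region -/
lemma S_flo {a : ℤ} (hV : V ⊆ Λ) (A : Set Om) (κ : ℝ≥0∞) (h : S b V ξ (ii (FV V a ∩ A)) ≤ κ * S b V ξ (ii (FV V a))) :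
    S b V ξ (ii (FV Λ a ∩ A)) ≤ κ * S b V ξ (ii (FV Λ a)) := by
  by_cases hg : ∀ z ∈ Λ, z ∉ V → a ≤ ξ z
  · refine (S_ii_mono (B := FV V a ∩ A) fun η _ h => ⟨fun z hz => h.1 z (hV hz), h.2⟩).trans (h.trans ?_)
    gcongr
    refine S_ii_mono fun η h h3 z hz => ?_
    by_cases hzV : z ∈ V
    · exact h3 z hzV
    · rw [h z hzV]; exact hg z hz hzV
  · rw [S_zero]
    · exact zero_le
    · intro η h ⟨h3, _⟩
      exact hg fun z hz hzV => by rw [← h z hzV]; exact h3 z hz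
lemma kap2 (hb : 0 < b) {x : Site} {r : ℕ} {H k : ℤ} (hB : Bx x r ⊆ V) (hV : V ⊆ Λ) (hk : 1 ≤ k)
    (hξ : ∀ x ∈ V, ∀ y ∉ V, Ad x y → H ≤ ξ y) :
    S b V ξ (ii (FV Λ 0 ∩ {η | η x < H + k})) ≤ ofReal (1 - q b r k /2) * S b V ξ (ii (FV Λ 0)) := by
  have hxV : x ∈ V := hB (by simp [mem_Bx])
  refine S_flo hV _ _ (kap (E := {η | H + k ≤ η x}) (by have := q_nn (b := b) r k; linarith) (by have := q_one hb r k; linarith) (fun η h h' => ?_) ?_)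
  · exact absurd (show η x < H + k from h) (not_lt.2 h')
  · have h1 := LOC hb.le (I := Set.univ) (J := FV V 0) (E := {η | H + k ≤ η x}) (ζ := fun _ => H) (ζ' := ξ) (W := V) hξ On_univ (On_FV _) (On_up hxV _)
      fun η η' _ h hj => ⟨trivial, fun x hx => le_trans (hj x hx) (le_max_right (η x) (η' x)), le_trans (show H + k ≤ η x from h) (le_max_left (η x) (η' x))⟩
    rw [Set.univ_inter, S_shift, S_shift] at h1
    have e1 : (fun η : Om => ii {η : Om | H + k ≤ η x} (fun x => η x + H)) = ii {η | k ≤ η x} := by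
      ext η; simp only [ii, Set.indicator, Set.mem_setOf_eq]; congr 1; apply propext; omega
    have e2 : (fun η : Om => ii Set.univ (fun x => η x + H)) = ii Set.univ := by ext η; simp [ii]
    rw [e1, e2] at h1
    refine (ENNReal.mul_le_mul_iff_left (Z_ne (b := b) (W := V) (ζ := 0)) (S_fin' hb)).1 (le_trans ?_ (h1.trans_eq (mul_comm _ _)))
    calc _ ≤ ofReal (q b r k) * S b V 0 (ii Set.univ) * S b V ξ (ii (FV V 0)) := by
          rw [mul_right_comm]; gcongr; linarith [q_nn (b := b) r k]
      _ ≤ _ := by gcongr; exact LBq hb hB hk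
lemma kap1 (hb : 0 < b) {x : Site} {r : ℕ} {H : ℤ} {Q : ℝ} (hB : Bx x r ⊆ V) (hV : V ⊆ Λ) (hH : 1 ≤ H) (hQ0 : 0 ≤ Q)
    (hQ : ∀ y ∈ V, UB b V y (H +1) Q) (hQ2 : V.card * Q ≤ q b r H /2)
    (hξ : ∀ x ∈ V, ∀ y ∉ V, Ad x y → ξ y ≤ H -1) :
    S b V ξ (ii (FV Λ (-1) ∩ {η | 0 ≤ η x})) ≤ ofReal (1 - q b r H /2) * S b V ξ (ii (FV Λ (-1))) := by
  have hxV : x ∈ V := hB (by simp [mem_Bx])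
  have hq0 := q_nn (b := b) r H
  refine S_flo hV _ _ ?_
  have h1 := LOC hb.le (I := FV V (-1)) (J := FV V (-1)) (E := {η | 0 ≤ η x}) (ζ := ξ) (ζ' := fun _ => H -1) (W := V) hξ (On_FV _) (On_FV _) (On_up hxV _)
    fun η η' hi h hj => ⟨fun x hx => le_min (hi x hx) (hj x hx), fun x hx => le_trans (hi x hx) (le_max_left (η x) (η' x)),
      le_trans (show 0 ≤ η x from h) (le_max_left (η x) (η' x))⟩
  have e1 : (fun η : Om => ii (FV V (-1)) (fun x => η x + (H -1))) = ii (FV V (-H)) := by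
    ext η; simp only [ii, Set.indicator]; congr 1; apply propext; exact forall₂_congr fun x _ => by (show -1 ≤ η x + (H -1) ↔ _); omega
  have e2 : (fun η : Om => ii (FV V (-1) ∩ {η | 0 ≤ η x}) (fun x => η x + (H -1))) = ii (FV V (-H) ∩ {η | 1 - H ≤ η x}) := by
    ext η; simp only [ii, Set.indicator]; congr 1; apply propext
    exact and_congr (forall₂_congr fun x _ => by (show -1 ≤ η x + (H -1) ↔ _); omega) (by show 0 ≤ η x + (H -1) ↔ 1 - H ≤ η x; omega)
  rw [S_shift, S_shift, e1, e2] at h1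
  refine cancel (h1.trans_eq (mul_comm _ _)) (kap (E := {η | η x ≤ -H}) (by linarith) (by have := q_one hb r H; linarith) (fun η h h' => ?_) ?_)
    (S_pos (η := 0) (fun x _ => by simp; omega) fun _ _ => rfl) (S_fin' hb)
  · have h : 1 - H ≤ η x := h
    have h' : η x ≤ -H := h'
    omega
  have h2 := LBq hb hB hH
  have h3 : S b V 0 (ii {η | H ≤ η x}) = S b V 0 (ii {η | η x ≤ -H}) := by
    rw [S_neg]; congr 1; ext η; simp only [ii, Set.indicator]; congr 1; apply propext; show H ≤ - η x ↔ η x ≤ -H; omega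
  rw [h3] at h2
  have h4 : S b V 0 (ii {η | η x ≤ -H}) ≤ S b V 0 (ii (FV V (-H) ∩ {η | η x ≤ -H})) + S b V 0 (ii {η | ∃ y ∈ V, η y ≤ -(H +1)}) :=
    S_or fun η _ h => by
      by_cases h5 : η ∈ FV V (-H)
      · exact .inl ⟨h5, h⟩
      · simp only [FV, Set.mem_setOf_eq, not_forall] at h5
        obtain ⟨y, hy, h5⟩ := h5
        exact .inr ⟨y, hy, by omega⟩
  have h5 : S b V 0 (ii {η | ∃ y ∈ V, η y ≤ -(H +1)}) ≤ ofReal (q b r H /2) * S b V 0 (ii Set.univ) := by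
    refine (S_union V (fun y => {η | η y ≤ -(H +1)}) fun η _ h => h).trans ((Finset.sum_le_card_nsmul _ _ _ fun y hy => S_le_neg (hQ y hy)).trans ?_)
    rw [nsmul_eq_mul, ← mul_assoc, ← ENNReal.ofReal_natCast, ← ofReal_mul (by positivity)]
    gcongr
  have h6 : ofReal (q b r H /2) * S b V 0 (ii Set.univ) ≤ S b V 0 (ii (FV V (-H) ∩ {η | η x ≤ -H})) := by
    refine (ENNReal.add_le_add_iff_right (ENNReal.mul_ne_top ENNReal.ofReal_ne_top (S_fin' hb (W := V) (A := Set.univ)) : ofReal (q b r H /2) * _ ≠ ⊤)).1 ?_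
    refine le_trans (le_of_eq ?_) (h2.trans (h4.trans (add_le_add_right h5 _)))
    rw [← add_mul, ← ofReal_add (by linarith) (by linarith)]; congr 2; ring
  exact le_trans (by gcongr; exact S_ii_mono fun _ _ _ => trivial) h6
lemma peel {ι : Type} {s : Finset ι} {D Bf : ι → Finset Site} {P : ℤ → Prop} {X : Set Om} {G : ι → Set Om} {κ : ℝ≥0∞}
    (hκ0 : κ ≠ 0) (hκ : κ ≤1) (hD : ∀ i ∈ s, D i ⊆ Λ) (hG : ∀ i ∈ s, On (D i) (G i))
    (hs : ∀ i ∈ s, ∀ j ∈ s, i ≠ j → ∀ z ∈ D i, z ∉ D j ∧ ∀ y ∈ D j, ¬ Ad y z)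
    (h : ∀ i ∈ s, ∀ ξ : Om, Bf i ⊆ Vx P (D i) ξ → S b (Vx P (D i) ξ) ξ (ii (X ∩ G i)) ≤ κ * S b (Vx P (D i) ξ) ξ (ii X)) (m : ℕ) :
    S b Λ 0 (ii {η | η ∈ X ∧ (∀ i ∈ s, η ∈ G i) ∧ m ≤ (s.filter fun i => Bf i ⊆ Vx P (D i) η).card}) ≤ κ ^ m * S b Λ 0 (ii X) := by
  have hκt : κ ≠ ⊤ := ne_top_of_le_ne_top ENNReal.one_ne_top hκ
  let F : ι → Om → ℝ≥0∞ := fun i η => if Bf i ⊆ Vx P (D i) η then κ⁻¹ * ii (G i) η else 1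
  have key : ∀ t ⊆ s, S b Λ 0 (fun η => (∏ i ∈ t, F i η) * ii X η) ≤ S b Λ 0 (ii X) := by
    intro t
    induction t using Finset.induction_on with
    | empty => intro _; simp
    | insert i t hi ih =>
      intro ht
      have his := ht (Finset.mem_insert_self i t)
      have hts : t ⊆ s := fun z hz => ht (Finset.mem_insert_of_mem hz)
      refine le_trans (expl (P := P) (hD i his) fun ξ _ => ?_) (ih hts)
      set V := Vx P (D i) ξ with hVd
      have hVe : ∀ η : Om, (∀ z ∉ V, η z = ξ z) → Vx P (D i) η = V := fun η h => Vx_eq fun z _ hz => h z hz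
      have hc : ∀ η : Om, (∀ z ∉ V, η z = ξ z) → ∏ j ∈ t, F j η = ∏ j ∈ t, F j ξ := fun η hη => by
        refine Finset.prod_congr rfl fun j hj => ?_
        have hij : i ≠ j := fun h => hi (h ▸ hj)
        have h1 : ∀ z ∈ D j, z ∉ V := fun z hz hzV => (hs i his j (hts hj) hij z (Vx_sub hzV)).1 hz
        have h2 : Vx P (D j) η = Vx P (D j) ξ := Vx_eq fun z hz _ => hη z fun hzV => by
          rcases hz with hz | ⟨y, hy, hyz⟩
          · exact h1 z hz hzV
          · exact (hs i his j (hts hj) hij z (Vx_sub hzV)).2 y hy hyz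
        have h3 : η ∈ G j ↔ ξ ∈ G j := ⟨hG j (hts hj) _ _ fun z hz => hη z (h1 z hz), hG j (hts hj) _ _ fun z hz => (hη z (h1 z hz)).symm⟩
        simp only [F, h2, ii, Set.indicator, h3, Pi.one_apply]
      have e1 : S b V ξ (fun η => (∏ j ∈ insert i t, F j η) * ii X η) = (∏ j ∈ t, F j ξ) * S b V ξ (fun η => F i η * ii X η) := by
        rw [← S_smul]
        refine S_congr fun η hη => ?_
        rw [Finset.prod_insert hi, hc η hη]; ring
      have e2 : S b V ξ (fun η => (∏ j ∈ t, F j η) * ii X η) = (∏ j ∈ t, F j ξ) * S b V ξ (ii X) := by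
        rw [← S_smul]; exact S_congr fun η hη => by rw [hc η hη]
      rw [e1, e2]
      gcongr
      by_cases hB : Bf i ⊆ V
      · have e3 : S b V ξ (fun η => F i η * ii X η) = κ⁻¹ * S b V ξ (ii (X ∩ G i)) := by
          rw [← S_smul]; refine S_congr fun η hη => ?_
          simp only [F, hVe η hη, hB, if_true]
          by_cases hX : η ∈ X <;> by_cases hG : η ∈ G i <;> simp [ii, hX, hG]
        rw [e3]
        refine (mul_le_mul_right (h i his ξ hB) _).trans_eq ?_
        rw [← mul_assoc, ENNReal.inv_mul_cancel hκ0 hκt, one_mul]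
      · refine le_of_eq (S_congr fun η hη => ?_)
        simp only [F, hVe η hη, hB, if_false, one_mul]
  refine le_trans ?_ (mul_le_mul_right (key s subset_rfl) _)
  rw [← S_smul]
  refine S_mono fun η _ => ?_
  by_cases hη : η ∈ X ∧ (∀ i ∈ s, η ∈ G i) ∧ m ≤ (s.filter fun i => Bf i ⊆ Vx P (D i) η).card
  · have e1 : ∏ i ∈ s, F i η = κ⁻¹ ^ (s.filter fun i => Bf i ⊆ Vx P (D i) η).card := by
      rw [← Finset.prod_const, Finset.prod_filter]
      exact Finset.prod_congr rfl fun i hi => by simp [F, ii, hη.2.1 i hi]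
    have e2 : ii X η =1 := by simp [ii, hη.1]
    rw [e1, e2, mul_one]
    calc _ ≤ (1 : ℝ≥0∞) := by simp only [ii]; exact Set.indicator_le_self' (fun _ _ => zero_le) _
      _ = κ ^ m * κ⁻¹ ^ m := by rw [← mul_pow, ENNReal.mul_inv_cancel hκ0 hκt, one_pow]
      _ ≤ _ := by
        gcongr
        · exact ENNReal.one_le_inv.2 hκ
        · exact hη.2.2
  · have : ii {η | η ∈ X ∧ (∀ i ∈ s, η ∈ G i) ∧ m ≤ (s.filter fun i => Bf i ⊆ Vx P (D i) η).card} η =0 := by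
      rw [ii, Set.indicator, if_neg]; exact hη
    rw [this]; exact zero_le

def Gd (Λ : Finset Site) (l : ℕ) (H : ℤ) : Set Om :=
  {η | ∀ z w, η z ≤ H -1 → Cn (fun z => η z ≤ H -1) z w → far l z w → ∃ v ∉ Λ, Cn (fun z => η z ≤ H -1) z v}
lemma down (hb : 20 ≤ b) {R : Finset Site} (hR : IsR R) {l : ℕ} {H : ℤ} (hH : 1 ≤ H) (he : eps R l ≤1) :
    S b R 0 (ii {η | η ∈ FV R 0 ∧ η ∉ Gd R l H}) ≤ ofReal (eps R l) * S b R 0 (ii (FV R 0)) := by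
  refine S_cnt' hb he (s := 1) (by norm_num) fun η h0 hη => ?_
  obtain ⟨hF, hG⟩ := hη
  simp only [Gd, Set.mem_setOf_eq, not_forall] at hG
  obtain ⟨z, w, hz, hzw, hf, hv⟩ := hG
  let c : Site → Prop := fun z => η z ≤ H -1
  let p : Site → Prop := fun z => c z ∧ ¬ ∃ v ∉ R, Cn c z v
  obtain ⟨A, hA, hA1, hA2⟩ := geo hR (p := p) l fun z hp => by
    by_contra h; exact hp.2 ⟨z, h, .refl⟩
  have hpw : Cn p z w ∧ p w := by
    clear hf
    induction hzw with
    | refl => exact ⟨.refl, hz, hv⟩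
    | tail h1 h2 ih =>
      have hp : p _ := ⟨h2.2.2, fun ⟨v, hv1, hv2⟩ => ih.2.2 ⟨v, hv1, hv2.head h2⟩⟩
      exact ⟨ih.1.tail ⟨h2.1, ih.2, hp⟩, hp⟩
  have hzA := hA2 z w ⟨hz, hv⟩ hpw.1 hf
  refine ⟨A, Finset.mem_erase.2 ⟨Finset.ne_empty_of_mem hzA, hA⟩, fun a ha o ho hao => ?_, fun x hx => ?_⟩
  · obtain ⟨⟨h1, h2⟩, h3⟩ := hA1 a ha o ho hao
    have h4 : ¬ c o := fun hc => h3 ⟨hc, fun ⟨v, hv1, hv2⟩ => h2 ⟨v, hv1, hv2.head ⟨hao, h1, hc⟩⟩⟩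
    simp only [c] at h1 h4; omega
  · have := hF x hx; simp only [sh]; split_ifs <;> omega
lemma bd_box (L : ℕ) : (bd (box L)).card ≤4 * L := by
  let I := Finset.Icc (1:ℤ) L
  have h : bd (box L) ⊆ (I.image fun i => (((0, i), true) : Edge)) ∪ (I.image fun i => (((L, i), true) : Edge)) ∪
      ((I.image fun i => (((i, 0), false) : Edge)) ∪ (I.image fun i => (((i, L), false) : Edge))) := by
    rintro ⟨⟨i, j⟩, c⟩ he
    rw [mem_bd] at he
    cases c <;> simp [box, tg, I] at he ⊢ <;> omega
  refine (Finset.card_le_card h).trans ((Finset.card_union_le _ _).trans ?_)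
  have h1 := Finset.card_union_le (I.image fun i => (((0, i), true) : Edge)) (I.image fun i => (((L, i), true) : Edge))
  have h2 := Finset.card_union_le (I.image fun i => (((i, 0), false) : Edge)) (I.image fun i => (((i, L), false) : Edge))
  have hI : I.card = L := by simp [I]
  have h3 : ∀ f : ℤ → Edge, (I.image f).card ≤ L := fun f => Finset.card_image_le.trans_eq hI
  have := h3 fun i => (((0, i), true) : Edge)
  have := h3 fun i => (((L, i), true) : Edge)
  have := h3 fun i => (((i, 0), false) : Edge)
  have := h3 fun i => (((i, L), false) : Edge)
  omega
/-- raising everything by one -/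
lemma raise (hb : 0 ≤ b) (L n : ℕ) : S b (box L) 0 (ii {η | η ∈ FV (box L) (-1) ∧ ∀ x ∈ box L, η x ≤ n}) ≤
    ofReal (exp (b * (4 * L * (2 * n +1)))) * S b (box L) 0 (ii (FV (box L) 0)) := by
  have h1 := S_map (b := b) (W := box L) (ζ := 0) (ζ' := 0) (A := {η | η ∈ FV (box L) (-1) ∧ ∀ x ∈ box L, η x ≤ n}) (B := FV (box L) 0)
    (sh (box L) 1) (ofReal (exp (-(b * (4 * L * (2 * n +1)))))) (sh_inj _ _).injOn fun η hη h0 => ⟨fun x hx => by simp [sh, hx, h0 x hx],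
      fun x hx => by have := hη.1 x hx; simp [sh, hx]; omega, ?_⟩
  · calc _ = ofReal (exp (b * (4 * L * (2 * n +1)))) * (ofReal (exp (-(b * (4 * L * (2 * n +1))))) * S b (box L) 0 (ii {η | η ∈ FV (box L) (-1) ∧ ∀ x ∈ box L, η x ≤ n})) := by
          rw [← mul_assoc, ← ofReal_mul (exp_pos _).le, ← exp_add]; simp
      _ ≤ _ := by gcongr
  · rw [wt, wt, ← ofReal_mul (exp_pos _).le, ← exp_add]
    refine ofReal_le_ofReal (exp_le_exp.2 ?_)
    have h2 : en (ed (box L)) (sh (box L) 1 η) - en (ed (box L)) η ≤4 * L * (2 * n +1) := by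
      rw [en, en, ← Finset.sum_sub_distrib]
      calc _ ≤ ∑ e ∈ ed (box L), if e ∈ bd (box L) then (2 * n +1 : ℝ) else 0 := by
            refine sum_le_sum fun e _ => ?_
            have hz : ∀ z ∉ box L, η z =0 := h0
            simp only [mem_bd]
            by_cases ha : e.1 ∈ box L <;> by_cases hc : tg e ∈ box L <;> simp [gr, sh, ha, hc]
            · rw [hz _ hc]; have := hη.2 _ ha
              have : (η e.1 : ℝ) ≤ n := by exact_mod_cast this
              push_cast; nlinarith
            · rw [hz _ ha]; have := hη.2 _ hc
              have : (η (tg e) : ℝ) ≤ n := by exact_mod_cast this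
              push_cast; nlinarith
        _ = (bd (box L)).card * (2 * n +1) := by
            rw [← Finset.sum_filter, Finset.sum_const, Finset.filter_mem_eq_inter, Finset.inter_eq_right.2 (bd_sub subset_rfl), nsmul_eq_mul]
        _ ≤ _ := by
            have := bd_box L
            have : ((bd (box L)).card : ℝ) ≤4 * L := by exact_mod_cast this
            gcongr
    nlinarith
def Tt (Λ : Finset Site) (l : ℕ) (H : ℤ) (t : ℕ) : Set Om :=
  {η | ∃ A ∈ LA Λ l, t ≤ (bd A).card ∧ ∀ a ∈ A, ∀ o ∉ A, Ad a o → H ≤ η a ∧ ¬ H ≤ η o}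
lemma long (hb : 20 ≤ b) {L l n t : ℕ} {H : ℤ} (he : eps (box L) l ≤1) :
    S b (box L) 0 (ii {η | η ∈ FV (box L) 0 ∧ (∀ x ∈ box L, η x ≤ n) ∧ η ∈ Tt (box L) l H t}) ≤
      ofReal (3 * exp (b * (4 * L * (2 * n +1)) - b /2 * t)) * S b (box L) 0 (ii (FV (box L) 0)) := by
  have hb0 : 0 ≤ b := by linarith
  set Λ := box L with hΛ
  set Y := S b Λ 0 (ii (FV Λ 0)) with hY
  let s := (LA Λ l).filter fun A => t ≤ (bd A).card
  refine (S_union s (fun A => {η | η ∈ FV Λ 0 ∧ (∀ x ∈ Λ, η x ≤ n) ∧ ∀ a ∈ A, ∀ o ∉ A, Ad a o → H ≤ η a ∧ ¬ H ≤ η o}) fun η _ h => ?_).trans ?_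
  · obtain ⟨h1, h2, A, hA, ht, h3⟩ := h
    exact ⟨A, mem_filter.2 ⟨hA, ht⟩, h1, h2, h3⟩
  have h1 : ∀ A ∈ s, S b Λ 0 (ii {η | η ∈ FV Λ 0 ∧ (∀ x ∈ Λ, η x ≤ n) ∧ ∀ a ∈ A, ∀ o ∉ A, Ad a o → H ≤ η a ∧ ¬ H ≤ η o}) ≤
      ofReal (exp (-b /2 * (bd A).card)) * (ofReal (exp (b * (4 * L * (2 * n +1)) - b /2 * t)) * Y) := fun A hA => by
    have hAs := mem_filter.1 hA
    have hAΛ : A ⊆ Λ := mem_powerset.1 (mem_filter.1 hAs.1).1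
    refine (S_pei hb0 hAΛ (s := -1) (by norm_num) (B := {η | η ∈ FV Λ (-1) ∧ ∀ x ∈ Λ, η x ≤ n}) fun η hη _ => ⟨fun a ha o ho hao => ?_, fun x hx => ?_, fun x hx => ?_⟩).trans
      ((mul_le_mul_right (raise hb0 L n) _).trans ?_)
    · have := hη.2.2 a ha o ho hao; omega
    · have := hη.1 x hx; simp only [sh]; split_ifs <;> omega
    · have := hη.2.1 x hx; simp only [sh]; split_ifs <;> omega
    · rw [← hΛ, ← hY, ← mul_assoc (ofReal _) _ Y, ← mul_assoc (ofReal _) _ Y, ← ofReal_mul (exp_pos _).le, ← ofReal_mul (exp_pos _).le, ← exp_add, ← exp_add]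
      refine mul_le_mul_left (ofReal_le_ofReal (exp_le_exp.2 ?_)) _
      have : (t : ℝ) ≤ (bd A).card := by exact_mod_cast hAs.2
      nlinarith
  refine (sum_le_sum h1).trans ?_
  rw [← Finset.sum_mul, ← ENNReal.ofReal_sum_of_nonneg fun _ _ => (exp_pos _).le, ← mul_assoc, ← ofReal_mul (sum_nonneg fun _ _ => (exp_pos _).le)]
  gcongr
  refine (sum_le_sum_of_subset_of_nonneg (filter_subset _ _) fun _ _ _ => (exp_pos _).le).trans ((cnt0 hb Λ l).trans ?_)
  refine (exp_le_exp.2 (show eps Λ l /2 ≤1 by linarith)).trans ?_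
  have := Real.exp_one_lt_d9; linarith

lemma S_un : S b W ζ (ii (A ∪ B)) ≤ S b W ζ (ii A) + S b W ζ (ii B) := S_or fun _ _ h => h
lemma cst {f : ℤ → Prop} {u v : ℤ} (h : ∀ i, u ≤ i → i +1 ≤ v → (f i ↔ f (i +1))) {i j : ℤ} (h1 : u ≤ i) (h2 : i ≤ v) (h3 : u ≤ j) (h4 : j ≤ v) : f i ↔ f j := by
  have key : ∀ i, u ≤ i → (i ≤ v → (f u ↔ f i)) := fun i hi => by
    induction i, hi using Int.le_induction with
    | base => exact fun _ => Iff.rfl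
    | succ i hi ih => exact fun hv => (ih (by omega)).trans (h i hi hv)
  exact (key i h1 h2).symm.trans (key j h3 h4)
lemma edgeB {A : Finset Site} {c : Site} {r : ℕ} {z w : Site} (hz : z ∈ Bx c r) (hw : w ∈ Bx c r) (hzA : z ∈ A) (hwA : w ∉ A) :
    ∃ e ∈ bd A, e.1 ∈ Bx c r := by
  by_contra! h
  simp only [mem_Bx, abs_le] at hz hw
  have h1 := (cst (f := fun i => ((i, z.2) : Site) ∈ A) (u := c.1 - r) (v := c.1 + r) (fun i h1 h2 => by
    by_contra h3
    refine h ((i, z.2), true) (mem_bd.2 ?_) (mem_Bx.2 (by simp only [abs_le]; omega))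
    simpa [tg] using h3) (i := z.1) (j := w.1) (by omega) (by omega) (by omega) (by omega)).1 hzA
  have h2 := (cst (f := fun i => ((w.1, i) : Site) ∈ A) (u := c.2 - r) (v := c.2 + r) (fun i h1 h2 => by
    by_contra h3
    refine h ((w.1, i), false) (mem_bd.2 ?_) (mem_Bx.2 (by simp only [abs_le]; omega))
    simpa [tg] using h3) (i := z.2) (j := w.2) (by omega) (by omega) (by omega) (by omega)).1 h1
  exact hwA h2
def ctr (l : ℕ) (i : ℕ × ℕ) : Site := (2 * l +1 + (4 * l +2) * i.1, 2 * l +1 + (4 * l +2) * i.2)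
lemma ctr_sep {l : ℕ} {i j : ℕ × ℕ} (h : i ≠ j) : 4 * (l : ℤ) +2 ≤ |(ctr l i).1 - (ctr l j).1| ∨ 4 * (l : ℤ) +2 ≤ |(ctr l i).2 - (ctr l j).2| := by
  have key : ∀ a c : ℕ, a ≠ c → 4 * (l : ℤ) +2 ≤ |2 * (l:ℤ) +1 + (4 * l +2) * a - (2 * l +1 + (4 * l +2) * c)| := fun a c hac => by
    rw [show 2 * (l:ℤ) +1 + (4 * l +2) * a - (2 * l +1 + (4 * l +2) * c) = (4 * l +2) * (a - c) by ring, abs_mul, abs_of_nonneg (by positivity : (0:ℤ) ≤4 * l +2)]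
    have : 1 ≤ |(a : ℤ) - c| := Int.one_le_abs (by omega)
    nlinarith
  by_cases h1 : i.1 = j.1
  · exact .inr (key _ _ fun h2 => h (Prod.ext h1 h2))
  · exact .inl (key _ _ h1)
lemma count (hH : (1:ℤ) ≤ H) {L l M t m : ℕ} (hl : 1 ≤ l) (ht : 2 * m + t ≤ M ^2) (h0 : ∀ x ∉ box L, η x =0)
    (hG : η ∈ Gd (box L) l H) (hT : η ∉ Tt (box L) l H t) :
    m ≤ ((Finset.range M ×ˢ Finset.range M).filter fun i => Bx (ctr l i) l ⊆ Vx (fun t => H ≤ t) (Bx (ctr l i) (2 * l)) η).card ∨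
    m ≤ ((Finset.range M ×ˢ Finset.range M).filter fun i => Bx (ctr l i) l ⊆ Vx (fun t => t ≤ H -1) (Bx (ctr l i) (2 * l)) η).card := by
  set s := Finset.range M ×ˢ Finset.range M with hs
  obtain ⟨A, hA, hA1, hA2⟩ := geo (IsR_box L) (p := fun z => H ≤ η z) l fun z hz => by
    by_contra h; rw [h0 z h] at hz; omega
  have hAΛ : A ⊆ box L := mem_powerset.1 (mem_filter.1 hA).1
  have hAt : (bd A).card < t := by
    by_contra h; exact hT ⟨A, hA, not_lt.1 h, hA1⟩
  let s1 := s.filter fun i => Bx (ctr l i) l ⊆ Vx (fun t => H ≤ t) (Bx (ctr l i) (2 * l)) η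
  let s2 := s.filter fun i => Bx (ctr l i) l ⊆ Vx (fun t => t ≤ H -1) (Bx (ctr l i) (2 * l)) η
  have hfar : ∀ {c y z w : Site}, y ∈ Bx c l → (z = y ∨ Ad y z) → w ∉ Bx c (2 * l) → z ∈ Bx c (l +1) ∧ far l z w := fun {c y z w} hy hz hw => by
    have hyz : |y.1 - z.1| ≤1 ∧ |y.2 - z.2| ≤1 := by
      rcases hz with rfl | hz
      · simp
      · exact Ad_abs hz
    simp only [mem_Bx, far, abs_le, le_abs] at *
    push_cast at *
    constructor <;> omega
  have hbad : ∀ i ∈ s \ (s1 ∪ s2), ∃ e ∈ bd A, e.1 ∈ Bx (ctr l i) (l +1) := fun i hi => by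
    simp only [Finset.mem_sdiff, Finset.mem_union, not_or, s1, s2, mem_filter, not_and] at hi
    obtain ⟨y, hy, hyV⟩ := Finset.not_subset.1 (hi.2.1 hi.1)
    obtain ⟨y', hy', hyV'⟩ := Finset.not_subset.1 (hi.2.2 hi.1)
    have hDD : ∀ y ∈ Bx (ctr l i) l, y ∈ Bx (ctr l i) (2 * l) := fun y hy => by rw [mem_Bx] at *; push_cast; omega
    obtain ⟨z, hz, hpz, w, hw, hpw, hcc⟩ := nVx (hDD y hy) hyV
    obtain ⟨z', hz', hpz', w', hw', hpw', hcc'⟩ := nVx (hDD y' hy') hyV'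
    obtain ⟨f1, f2⟩ := hfar hy hz hw
    obtain ⟨f1', f2'⟩ := hfar hy' hz' hw'
    refine edgeB f1 f1' (hA2 z w hpz hcc f2) fun hzA => ?_
    obtain ⟨v, hv, hc⟩ := hG z' w' hpz' hcc' f2'
    have : v ∈ A := by
      clear hv
      induction hc with
      | refl => exact hzA
      | tail h1 h2 ih =>
        by_contra h3
        have := (hA1 _ ih _ h3 h2.1).1
        have := h2.2.1
        omega
    exact hv (hAΛ this)
  choose! φ hφ1 hφ2 using hbad
  have hc1 : (s \ (s1 ∪ s2)).card ≤ (bd A).card := by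
    refine Finset.card_le_card_of_injOn φ hφ1 fun i hi j hj hij => ?_
    by_contra hne
    have h1 := hφ2 i hi; have h2 := hφ2 j hj; rw [← hij] at h2
    have := ctr_sep (l := l) hne
    simp only [mem_Bx, abs_le, le_abs] at *
    push_cast at *
    omega
  have hc2 : s.card ≤ (s \ (s1 ∪ s2)).card + (s1 ∪ s2).card := by
    rw [← Finset.card_sdiff_add_card_inter s (s1 ∪ s2)]; exact Nat.add_le_add_left (Finset.card_le_card Finset.inter_subset_right) _
  have hc3 := Finset.card_union_le s1 s2
  have hc4 : s.card = M ^2 := by simp [hs, sq]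
  show m ≤ s1.card ∨ m ≤ s2.card
  omega
/-- lower tail of the maximum -/
lemma low (hb : 20 ≤ b) {L l M n t m : ℕ} {H k : ℤ} (hH : 1 ≤ H) (hk : 1 ≤ k) (hl : 1 ≤ l) (he : eps (box L) l ≤1) (hM : M * (4 * l +2) ≤ L)
    (ht : 2 * m + t ≤ M ^2) {Q θ : ℝ} (hQ0 : 0 ≤ Q) (hQ : ∀ V ⊆ box L, ∀ y ∈ V, UB b V y (H +1) Q) (hQ2 : (4 * l +1) ^2 * Q ≤ q b l H /2)
    (hθ0 : 0 ≤ θ) (hθ1 : θ ≤1 /2) (hθ : ∀ a : ℤ, -1 ≤ a → a ≤0 → S b (box L) 0 (ii (FV (box L) a ∩ {η | ∃ x ∈ box L, (n:ℤ) +1 ≤ η x})) ≤ ofReal θ * S b (box L) 0 (ii (FV (box L) a))) :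
    S b (box L) 0 (ii {η | η ∈ FV (box L) 0 ∧ ∀ x ∈ box L, η x < H + k}) ≤
      ofReal (θ + (eps (box L) l + (3 * exp (b * (4 * L * (2 * n +1)) - b /2 * t) +
        ((1 - q b l H /2) ^ m * (2 * exp (b * (4 * L * (2 * n +1)))) + (1 - q b l k /2) ^ m)))) * S b (box L) 0 (ii (FV (box L) 0)) := by
  have hb0 : 0 < b := by linarith
  have hqH := q_one hb0 l H
  have hqk := q_one hb0 l k
  have hqH' : 0 <1 - q b l H /2 := by linarith
  have hqk' : 0 <1 - q b l k /2 := by linarith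
  have hqH0 := q_nn (b := b) l H
  have hqk0 := q_nn (b := b) l k
  have he0 := eps_nn (box L) l
  set Λ := box L with hΛ
  set s := Finset.range M ×ˢ Finset.range M with hs
  have hD : ∀ i ∈ s, Bx (ctr l i) (2 * l) ⊆ Λ := fun i hi z hz => by
    simp only [hs, mem_product, Finset.mem_range] at hi
    have key : ∀ a : ℕ, a < M → ((4 * l +2) * a : ℤ) + (4 * l +2) ≤ L := fun a ha => by
      have : (4 * l +2) * (a +1) ≤ L := le_trans (by rw [mul_comm]; gcongr; omega) hM
      zify at this; linarith
    have k1 := key _ hi.1; have k2 := key _ hi.2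
    have p1 : (0:ℤ) ≤ (4 * l +2) * i.1 := by positivity
    have p2 : (0:ℤ) ≤ (4 * l +2) * i.2 := by positivity
    simp only [mem_Bx, abs_le, ctr] at hz
    simp only [hΛ, box, mem_product, Finset.mem_Icc]
    push_cast at *
    omega
  have hxD : ∀ i, ctr l i ∈ Bx (ctr l i) (2 * l) := fun i => by simp [mem_Bx]
  have hsep : ∀ i ∈ s, ∀ j ∈ s, i ≠ j → ∀ z ∈ Bx (ctr l i) (2 * l), z ∉ Bx (ctr l j) (2 * l) ∧ ∀ y ∈ Bx (ctr l j) (2 * l), ¬ Ad y z := fun i _ j _ hij z hz => by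
    have h1 := ctr_sep (l := l) hij
    refine ⟨fun h => ?_, fun y hy ha => ?_⟩
    · simp only [mem_Bx, abs_le, le_abs] at *; push_cast at *; omega
    · have := Ad_abs ha
      simp only [mem_Bx, abs_le, le_abs] at *; push_cast at *; omega
  have p1 := peel (b := b) (Λ := Λ) (s := s) (D := fun i => Bx (ctr l i) (2 * l)) (Bf := fun i => Bx (ctr l i) l) (P := fun t => H ≤ t) (X := FV Λ (-1))
    (G := fun i => {η | 0 ≤ η (ctr l i)}) (κ := ofReal (1 - q b l H /2)) (by simpa using hqH') (by rw [ENNReal.ofReal_le_one]; linarith) hD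
    (fun i _ => On_up (hxD i) 0) hsep (fun i hi ξ hB => kap1 hb0 hB (Vx_sub.trans (hD i hi)) hH hQ0 (fun y hy => hQ _ (Vx_sub.trans (hD i hi)) y hy) (by
      refine le_trans ?_ hQ2
      gcongr
      have h5 : (Vx (fun t => H ≤ t) (Bx (ctr l i) (2 * l)) ξ).card ≤ (4 * l +1) ^2 := by
        refine (Finset.card_le_card Vx_sub).trans_eq ?_
        rw [Bx, Finset.card_product, Int.card_Icc, Int.card_Icc, sq]; congr 1 <;> push_cast <;> omega
      exact_mod_cast h5) fun x hx y hy ha => by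
        have : ¬ H ≤ ξ y := Vx_bd hx hy ha
        omega) m
  have p2 := peel (b := b) (Λ := Λ) (s := s) (D := fun i => Bx (ctr l i) (2 * l)) (Bf := fun i => Bx (ctr l i) l) (P := fun t => t ≤ H -1) (X := FV Λ 0)
    (G := fun i => {η | η (ctr l i) < H + k}) (κ := ofReal (1 - q b l k /2)) (by simpa using hqk') (by rw [ENNReal.ofReal_le_one]; linarith) hD
    (fun i _ η η' h h1 => by
      have h1 : η (ctr l i) < H + k := h1
      rw [h _ (hxD i)] at h1; exact h1) hsep (fun i hi ξ hB => kap2 hb0 hB (Vx_sub.trans (hD i hi)) hk fun x hx y hy ha => by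
        have : ¬ ξ y ≤ H -1 := Vx_bd hx hy ha
        omega) m
  rw [← ENNReal.ofReal_pow hqH'.le] at p1
  rw [← ENNReal.ofReal_pow hqk'.le] at p2
  have hm1 : S b Λ 0 (ii (FV Λ (-1))) ≤ ofReal (2 * exp (b * (4 * L * (2 * n +1)))) * S b Λ 0 (ii (FV Λ 0)) := by
    have h1 := ofR_split hθ0 (by linarith) (S_fin' hb0) (S_or (B := {η | η ∈ FV Λ (-1) ∧ ∀ x ∈ Λ, η x ≤ n}) fun η _ h => by
      by_cases h2 : ∃ x ∈ Λ, (n:ℤ) +1 ≤ η x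
      · exact .inr ⟨h, h2⟩
      · push Not at h2; exact .inl ⟨h, fun x hx => by have := h2 x hx; omega⟩) (hθ (-1) (by norm_num) (by norm_num))
    have h2 : ofReal (1 /2) * S b Λ 0 (ii (FV Λ (-1))) ≤ _ := (mul_le_mul_left (ofReal_le_ofReal (by linarith)) _).trans (h1.trans (raise hb0.le L n))
    calc _ = ofReal 2 * (ofReal (1 /2) * S b Λ 0 (ii (FV Λ (-1)))) := by
          rw [← mul_assoc, ← ofReal_mul (by norm_num)]; norm_num
      _ ≤ _ := (mul_le_mul_right h2 _).trans_eq (by rw [← mul_assoc, ← ofReal_mul (by norm_num)])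
  rw [ofReal_add hθ0 (by positivity), ofReal_add he0 (by positivity), ofReal_add (by positivity) (by positivity),
    ofReal_add (by positivity) (by positivity)]
  simp only [add_mul]
  refine le_trans (S_ii_mono (B := (FV Λ 0 ∩ {η | ∃ x ∈ Λ, (n:ℤ) +1 ≤ η x}) ∪ ({η | η ∈ FV Λ 0 ∧ η ∉ Gd Λ l H} ∪
    ({η | η ∈ FV Λ 0 ∧ (∀ x ∈ Λ, η x ≤ n) ∧ η ∈ Tt Λ l H t} ∪ (_ ∪ _)))) fun η h0 hη => ?_) (S_un.trans (add_le_add (hθ 0 (by norm_num) le_rfl) (S_un.trans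
      (add_le_add (down hb (IsR_box L) hH he) (S_un.trans (add_le_add (long hb he) (S_un.trans (add_le_add (p1.trans ?_) p2))))))))
  · obtain ⟨hF, hlt⟩ := hη
    by_cases h1 : ∃ x ∈ Λ, (n:ℤ) +1 ≤ η x
    · exact .inl ⟨hF, h1⟩
    push Not at h1
    refine .inr ?_
    by_cases h2 : η ∈ Gd Λ l H
    swap
    · exact .inl ⟨hF, h2⟩
    refine .inr ?_
    by_cases h3 : η ∈ Tt Λ l H t
    · exact .inl ⟨hF, fun x hx => by have := h1 x hx; omega, h3⟩
    refine .inr ?_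
    rcases count hH hl ht h0 h2 h3 with h4 | h4
    · exact .inl ⟨fun x hx => le_trans (by norm_num) (hF x hx), fun i hi => hF _ (hD i hi (hxD i)), h4⟩
    · exact .inr ⟨hF, fun i hi => hlt _ (hD i hi (hxD i)), h4⟩
  · rw [ofReal_mul (by positivity), mul_assoc]; gcongr

def GG (s a : ℝ) : ℝ := log (s ^2 + a ^2) /2
lemma GG_sq {a : ℝ} (ha : 0 < a) (t : ℝ) : (GG (t +1) a - GG t a) ^2 ≤
    (arctan ((t +1) / a) / a - (t +1) / ((t +1) ^2 + a ^2)) /2 - (arctan (t / a) / a - t / (t ^2 + a ^2)) /2 := by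
  set c := GG (t +1) a - GG t a with hc
  set G : ℝ → ℝ := fun t => (arctan (t / a) / a - t / (t ^2 + a ^2)) /2 -2 * c * GG t a + c ^2 * t with hG
  have hd : ∀ t, HasDerivAt G ((t / (t ^2 + a ^2) - c) ^2) t := fun t => by
    have hp : t ^2 + a ^2 ≠ 0 := by positivity
    have h := at_deriv a t
    have h1 : HasDerivAt (fun t : ℝ => t ^2 + a ^2) (2 * t) t := by simpa using (hasDerivAt_pow 2 t).add_const (a ^2)
    have h2 := (h1.log hp).div_const 2
    have := (((h.div_const a).sub ((hasDerivAt_id t).div h1 hp)).div_const 2).sub (h2.const_mul (2 * c)) |>.add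
      ((hasDerivAt_id t).const_mul (c ^2))
    refine this.congr_deriv ?_
    rw [Real.cos_sq_arctan]; simp only [id]; field_simp; ring
  have hm : Monotone G := monotone_of_deriv_nonneg (fun t => (hd t).differentiableAt) fun t => by
    rw [(hd t).deriv]; positivity
  have := hm (show t ≤ t +1 by linarith)
  simp only [hG] at this
  have e : 2 * c * GG (t +1) a -2 * c * GG t a =2 * c ^2 := by rw [hc]; ring
  nlinarith
lemma Ico_succ (n : ℕ) : Finset.Ico (-((n +1 : ℕ) : ℤ)) ((n +1 : ℕ) : ℤ) = insert (-((n +1 : ℕ) : ℤ)) (insert (n : ℤ) (Finset.Ico (-(n : ℤ)) n)) := by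
  ext j; simp only [Finset.mem_Ico, Finset.mem_insert]; push_cast; omega
lemma GG_row {a : ℝ} (ha : a ≠ 0) (n : ℕ) : ∑ t ∈ Finset.Ico (-(n : ℤ)) n, (GG (t +1) a - GG t a) ^2 ≤ π /2 * (1 / |a|) := by
  have ha' : 0 < |a| := abs_pos.2 ha
  have e : ∀ s, GG s a = GG s |a| := fun s => by simp [GG]
  simp only [e]
  set Φ : ℤ → ℝ := fun s => (arctan (s / |a|) / |a| - s / ((s:ℝ) ^2 + |a| ^2)) /2 with hΦ
  have h2 : ∑ j ∈ Finset.Ico (-(n : ℤ)) n, (Φ (j +1) - Φ j) = Φ n - Φ (-n) := by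
    induction n with
    | zero => simp
    | succ n ih =>
      rw [Ico_succ, sum_insert, sum_insert, ih]
      · push_cast; rw [show -((n:ℤ) +1) +1 = -n by ring]; ring
      · simp
      · simp
  calc _ ≤ ∑ j ∈ Finset.Ico (-(n : ℤ)) n, (Φ (j +1) - Φ j) := sum_le_sum fun j _ => by
        have := GG_sq ha' j; simp only [hΦ]; push_cast; exact this
    _ = Φ n - Φ (-n) := h2
    _ ≤ _ := by
      have h3 := (Real.arctan_lt_pi_div_two ((n:ℝ) / |a|)).le
      have h4 : 0 ≤ (n:ℝ) / ((n:ℝ) ^2 + |a| ^2) := by positivity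
      have h5 : arctan (n / |a|) / |a| ≤ π /2 / |a| := by gcongr
      simp only [hΦ]; push_cast
      rw [neg_div, Real.arctan_neg, neg_sq, neg_div, neg_div]
      rw [mul_one_div]; linarith
lemma GG_row0 (n : ℕ) : ∑ t ∈ Finset.Ico (-(n : ℤ)) n, (GG (t +1) 0 - GG t 0) ^2 ≤8 := by
  have h : ∑ t ∈ Finset.Ico (-(n : ℤ)) n, (GG (t +1) 0 - GG t 0) ^2 ≤8 -4 / n := by
    induction n with
    | zero => simp
    | succ n ih =>
      rw [Ico_succ, sum_insert, sum_insert]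
      · have e : (GG (((-((n +1 : ℕ) : ℤ) : ℤ) : ℝ) +1) 0 - GG ((-((n +1 : ℕ) : ℤ) : ℤ) : ℝ) 0) ^2 = (GG (((n : ℤ) : ℝ) +1) 0 - GG ((n : ℤ) : ℝ) 0) ^2 := by
          simp only [GG]; push_cast
          rw [show -((n:ℝ) +1) +1 = - n by ring, neg_sq, neg_sq]; ring
        rw [e]
        rcases n.eq_zero_or_pos with rfl | hn
        · simp [GG]; norm_num
        have hn' : (0:ℝ) < n := by exact_mod_cast hn
        have h1 : GG (((n : ℤ) : ℝ) +1) 0 - GG ((n : ℤ) : ℝ) 0 = log (1 +1 / n) := by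
          simp only [GG]; push_cast
          rw [show (1:ℝ) +1 / n = (n +1) / n by field_simp, Real.log_div (by positivity) (by positivity)]
          simp
        have h2 : log (1 +1 / n) ≤1 / n := by
          have := Real.log_le_sub_one_of_pos (show (0:ℝ) <1 +1 / n by positivity); linarith
        have h3 : 0 ≤ log (1 +1 / (n:ℝ)) := log_nonneg (by simp)
        rw [h1]
        have h5 : log (1 +1 / n) ^2 ≤2 * (1 / n -1 / (n +1 : ℝ)) := by
          have h1n : (1:ℝ) ≤ n := by exact_mod_cast hn
          calc _ ≤ (1 / (n:ℝ)) ^2 := by gcongr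
            _ ≤ _ := by rw [div_sub_div _ _ (by positivity) (by positivity), div_pow, ← mul_div_assoc, div_le_div_iff₀ (by positivity) (by positivity)]; nlinarith
        push_cast
        have : (4:ℝ) / n =4 * (1 / n) := by ring
        have : (4:ℝ) / (n +1) =4 * (1 / (n+1)) := by ring
        linarith
      · simp
      · simp
  have : (0:ℝ) ≤4 / n := by positivity
  linarith

lemma GG_tot (n : ℕ) : ∑ j ∈ Finset.Ico (-(n : ℤ)) n, ∑ t ∈ Finset.Ico (-(n : ℤ)) n, (GG (t +1) j - GG t j) ^2 ≤ π * (log n +1) +12 := by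
  have hpi := Real.pi_pos
  have h1 : ∀ j : ℤ, ∑ t ∈ Finset.Ico (-(n : ℤ)) n, (GG (t +1) j - GG t j) ^2 ≤ π /2 * (1 / |(j:ℝ)|) + if j =0 then 8 else 0 := fun j => by
    split_ifs with h
    · subst h; simpa using GG_row0 n
    · simpa using GG_row (a := (j:ℝ)) (by exact_mod_cast h) n
  have h2 : ∀ n : ℕ, ∑ i ∈ Finset.Ico (-(n : ℤ)) n, 1 / |(i:ℝ)| ≤2 * harmonic n -1 / n := fun n => by
    induction n with
    | zero => simp
    | succ n ih =>
      rw [Ico_succ, sum_insert, sum_insert, harmonic_succ]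
      · push_cast
        have e : |(-((n:ℝ) +1))| = n +1 := by rw [abs_neg, abs_of_pos (by positivity)]
        have e2 : |((n:ℤ):ℝ)| = n := by simp
        rw [e]
        rw [one_div ((n:ℝ) +1), abs_of_nonneg (Nat.cast_nonneg n)]; linarith
      · simp
      · simp
  have h4 := harmonic_le_one_add_log n
  have h5 : (0:ℝ) ≤1 / n := by positivity
  have h6 := h2 n
  calc _ ≤ ∑ j ∈ Finset.Ico (-(n : ℤ)) n, (π /2 * (1 / |(j:ℝ)|) + if j =0 then 8 else 0) := sum_le_sum fun j _ => h1 j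
    _ ≤ π /2 * (2 * (1 + log n)) +8 := by
      rw [sum_add_distrib, ← Finset.mul_sum]
      gcongr
      · linarith
      · rw [Finset.sum_ite_eq']; split_ifs <;> norm_num
    _ ≤ _ := by linarith
def Gs (z : Site) : ℝ := GG z.1 z.2
lemma GG_comm (a c : ℝ) : GG a c = GG c a := by simp [GG, add_comm]
lemma Gs_en (n : ℕ) : ∑ e ∈ ed (Bx 0 n), (Gs (tg e) - Gs e.1) ^2 ≤2 * π * log (n +1) +40 := by
  have hs : ed (Bx 0 n) ⊆ (Finset.Ico (-((n +1 : ℕ) : ℤ)) ((n +1 : ℕ) : ℤ) ×ˢ Finset.Ico (-((n +1 : ℕ) : ℤ)) ((n +1 : ℕ) : ℤ)) ×ˢ Finset.univ := by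
    rintro ⟨⟨x, y⟩, c⟩ he
    rw [mem_ed, mem_Bx, mem_Bx] at he
    simp only [mem_product, Finset.mem_Ico, Finset.mem_univ, and_true]
    cases c <;> simp [tg, abs_le] at he <;> omega
  refine (sum_le_sum_of_subset_of_nonneg hs fun _ _ _ => sq_nonneg _).trans ?_
  rw [sum_product]
  simp only [Fintype.sum_bool, sum_add_distrib]
  have h := GG_tot (n +1)
  rw [Finset.sum_product_right, sum_product]
  simp only [tg, Gs, if_true, Bool.false_eq_true, if_false]
  have h2 : ∑ x ∈ Finset.Ico (-((n +1 : ℕ) : ℤ)) ((n +1 : ℕ) : ℤ), ∑ y ∈ Finset.Ico (-((n +1 : ℕ) : ℤ)) ((n +1 : ℕ) : ℤ),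
     (GG (x:ℤ) ((y +1 : ℤ):ℝ) - GG x y) ^2 ≤ π * (log ((n +1 : ℕ):ℝ) +1) +12 := by
    exact (le_of_eq (sum_congr rfl fun x _ => sum_congr rfl fun y _ => by rw [GG_comm x, GG_comm x y]; push_cast; rfl)).trans h
  have h3 := Real.pi_lt_four
  push_cast at h h2 ⊢
  linarith

lemma shLB (hb : 20 ≤ b) {l T : ℕ} {h : ℤ} (hl : 1 ≤ l) (φ : Om) (hφ : ∀ x ∉ Bx 0 l, φ x =0) (h0 : φ 0 = h + T)
    (hT : log l +3 ≤ (T +1 : ℝ) ^2) : 1 /2 * exp (-b * en (ed (Bx 0 l)) φ) ≤ q b l h := by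
  have hb0 : 0 < b := by linarith
  set W := Bx 0 l
  set Z := S b W 0 (ii Set.univ)
  have hm : (0 : Site) ∈ W := by rw [mem_Bx]; simp
  set A : Set Om := {η | |η 0| ≤ T}
  have hlog : 0 ≤ log l := log_natCast_nonneg l
  have hA : Z ≤2 * S b W 0 (ii A) := by
    have h1 : Z ≤ S b W 0 (ii A) + S b W 0 (ii {η | ((T:ℤ) +1) ≤ |η 0|}) := S_or fun η _ _ => by
      simp only [A, Set.mem_setOf_eq]; omega
    rw [S_abs (by omega)] at h1
    have h2 := tailC hb0 hm hl (Finset.Subset.refl _) (t := (T:ℝ) +1) (by positivity)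
    have h3 : exp (-b * ((T:ℝ) +1) ^2 * (2 * π / (log l +3))) ≤1 /4 := by
      have h4 : 20 ≤ b * ((T:ℝ) +1) ^2 * (2 * π / (log l +3)) := by
        have h5 : 1 ≤2 * π / (log l +3) * ((T:ℝ) +1) ^2 := by
          rw [div_mul_eq_mul_div, le_div_iff₀ (by positivity)]
          nlinarith [pi_gt_three]
        nlinarith
      have h5 : exp (-b * ((T:ℝ) +1) ^2 * (2 * π / (log l +3))) ≤ exp (-20) := exp_le_exp.2 (by linarith)
      have h6 := exp_pos (-20)
      have h7 : exp (-20) * exp 20 =1 := by rw [← exp_add]; simp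
      have h8 := add_one_le_exp (20:ℝ)
      nlinarith
    have h4 : S b W 0 (ii {η | ((T:ℤ) +1) ≤ η 0}) ≤ ofReal (1/4) * Z := by
      have e : {η : Om | ((T:ℤ) +1) ≤ η 0} = {η : Om | (T:ℝ) +1 ≤ η 0} := by
        ext η; simp only [Set.mem_setOf_eq]; exact_mod_cast Iff.rfl
      rw [e]; refine h2.trans ?_; gcongr
    have hZ : Z ≠ ⊤ := S_fin' hb0
    have h5 : Z ≤ S b W 0 (ii A) + ofReal (1/2) * Z := h1.trans (by
      refine add_le_add le_rfl ?_
      refine (mul_le_mul_right h4 2).trans (le_of_eq ?_)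
      rw [← mul_assoc]; congr 1
      rw [show (2:ℝ≥0∞) = ofReal 2 by simp, ← ofReal_mul (by norm_num)]; norm_num)
    have hAt : S b W 0 (ii A) ≠ ⊤ := S_fin' hb0
    have h6 := ENNReal.toReal_mono (by finiteness) h5
    rw [ENNReal.toReal_add hAt (by finiteness), ENNReal.toReal_mul, ENNReal.toReal_ofReal (by norm_num)] at h6
    rw [← ENNReal.ofReal_toReal hZ, ← ENNReal.ofReal_toReal hAt, show (2:ℝ≥0∞) = ofReal 2 by simp, ← ofReal_mul (by norm_num)]
    exact ofReal_le_ofReal (by linarith)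
  set D : Om → ℝ := fun η => ∑ e ∈ ed W, (gr η e : ℝ) * gr φ e
  set c := ofReal (exp (-b * en (ed W) φ))
  set F : ℝ → Om → ℝ≥0∞ := fun s η => ii A η * ofReal (exp (s * (2 * b * D η)))
  have hsh : c * S b W 0 (F (-1)) ≤ S b W 0 (ii {η | h ≤ η 0}) := by
    rw [← S_smul]
    refine S_mapf (fun η => η + φ) (fun η η' _ _ _ _ h => add_right_cancel h) fun η hη hne => ⟨fun x hx => by simp [hη x hx, hφ x hx], ?_⟩
    have hA' : η ∈ A := by by_contra hc; simp [F, ii, hc] at hne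
    have hg : η + φ ∈ {η : Om | h ≤ η 0} := by
      simp only [A, Set.mem_setOf_eq, abs_le] at hA' ⊢; rw [Pi.add_apply, h0]; omega
    have e : en (ed W) (η + φ) = en (ed W) η +2 * D η + en (ed W) φ := by
      simp only [en, D, gr, Pi.add_apply, Finset.mul_sum, ← sum_add_distrib]
      refine sum_congr rfl fun e _ => ?_
      push_cast; ring
    simp only [F, ii, Set.indicator_of_mem hA', Set.indicator_of_mem hg, Pi.one_apply, one_mul, wt, c]
    rw [← ofReal_mul (by positivity), ← ofReal_mul (by positivity), ← exp_add, ← exp_add, e]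
    refine le_of_eq ?_; congr 2; ring
  have hsy : S b W 0 (F 1) = S b W 0 (F (-1)) := by
    rw [S_neg]; refine S_congr fun η _ => ?_
    have e : D (-η) = - D η := by
      simp only [D, gr, Pi.neg_apply, ← Finset.sum_neg_distrib]; refine sum_congr rfl fun e _ => ?_
      push_cast; ring
    have e2 : ii A (-η) = ii A η := by simp [ii, A, Set.indicator]
    simp only [F, e, e2]; congr 3; ring
  have h2 : 2 * S b W 0 (ii A) ≤ S b W 0 (F 1) + S b W 0 (F (-1)) := by
    rw [← S_add, ← S_smul]
    refine S_mono fun η _ => ?_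
    simp only [F]; rw [← mul_add, mul_comm]; gcongr
    rw [← ofReal_add (by positivity) (by positivity), show (2:ℝ≥0∞) = ofReal 2 by simp]
    refine ofReal_le_ofReal ?_
    have := add_one_le_exp (1 * (2 * b * D η))
    have := add_one_le_exp (-1 * (2 * b * D η))
    linarith
  rw [hsy, ← two_mul] at h2
  have h3 : c * Z ≤2 * S b W 0 (ii {η | h ≤ η 0}) := by
    calc c * Z ≤ c * (2 * S b W 0 (F (-1))) := by gcongr; exact hA.trans h2
      _ =2 * (c * S b W 0 (F (-1))) := by ring
      _ ≤ _ := by gcongr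
  have h4 : c /2 ≤ S b W 0 (ii {η | h ≤ η 0}) / Z := by
    rw [ENNReal.le_div_iff_mul_le (Or.inl Z_ne) (Or.inl (S_fin' hb0)), ENNReal.mul_comm_div, ← mul_div_assoc]
    exact ENNReal.div_le_of_le_mul' h3
  have h5 := ENNReal.toReal_mono (ENNReal.div_ne_top (S_fin' hb0) Z_ne) h4
  rw [ENNReal.toReal_div, ENNReal.toReal_ofReal (by positivity)] at h5
  simp only [ENNReal.toReal_ofNat] at h5
  unfold q; linarith
lemma qLB (hb : 20 ≤ b) {l R T : ℕ} {h : ℤ} {ε : ℝ} (hε : 0 < ε) (hR : 2 ≤ R) (hl : R ≤ l) (hh : 0 ≤ h) (hT : log l +3 ≤ (T +1 : ℝ) ^2) :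
    1 /2 * exp (-b * ((1 + ε) * (((h:ℝ) + T) / log R) ^2 * (2 * π * log (R +1) +40) + (1 +1 / ε) * (4 * (2 * R +1) ^2))) ≤ q b l h := by
  have hlR : 0 < log R := Real.log_pos (by exact_mod_cast hR)
  set k : ℝ := (h:ℝ) + T
  have hk : 0 ≤ k := by
    have : (0:ℝ) ≤ h := by exact_mod_cast hh
    positivity
  set u : Site → ℝ := fun z => k * max 0 (1 - Gs z / log R) with hu
  set φ : Om := fun z => ⌊u z⌋ with hφ
  have hz : ∀ z ∉ Bx 0 R, φ z =0 := fun z hz => by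
    have h1 : (R:ℝ) ^2 ≤ (z.1:ℝ) ^2 + (z.2:ℝ) ^2 := by
      rw [mem_Bx, not_and_or] at hz
      simp only [Prod.fst_zero, Prod.snd_zero, sub_zero, not_le] at hz
      have h2 : (R:ℤ) ^2 ≤ z.1 ^2 + z.2 ^2 := by
        rw [← sq_abs z.1, ← sq_abs z.2]
        rcases hz with hz | hz <;> nlinarith [abs_nonneg z.1, abs_nonneg z.2]
      exact_mod_cast h2
    have h2 : log R ≤ Gs z := by
      have := log_le_log (by positivity) h1
      rw [Real.log_pow] at this; unfold Gs GG; push_cast at this; linarith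
    have : u z =0 := by
      simp only [hu]; rw [max_eq_left, mul_zero]
      have := (one_le_div hlR).2 h2; linarith
    simp [hφ, this]
  have hsub : Bx 0 R ⊆ Bx 0 l := fun z hz => by rw [mem_Bx] at hz ⊢; omega
  refine le_trans ?_ (shLB hb (by omega) φ (fun x hx => hz x fun h => hx (hsub h)) (T := T) ?_ hT)
  swap
  · simp only [hφ, hu, Gs, GG]; simp [k]
  have e1 : en (ed (Bx 0 l)) φ = en (ed (Bx 0 R)) φ := by
    unfold en; symm
    refine Finset.sum_subset (fun e he => by rw [mem_ed] at he ⊢; exact he.imp (@hsub _) (@hsub _)) fun e _ he => ?_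
    rw [mem_ed, not_or] at he; simp [gr, hz _ he.1, hz _ he.2]
  have e2 : ∀ e, (gr φ e : ℝ) ^2 ≤ (1 + ε) * (k / log R) ^2 * (Gs (tg e) - Gs e.1) ^2 + (1 +1 / ε) := fun e => by
    have h1 : |(gr φ e : ℝ)| ≤ |u (tg e) - u e.1| +1 := by
      simp only [gr, hφ]; push_cast
      have := Int.floor_le (u (tg e)); have := Int.lt_floor_add_one (u (tg e))
      have := Int.floor_le (u e.1); have := Int.lt_floor_add_one (u e.1)
      have h3 := le_abs_self (u (tg e) - u e.1); have h4 := neg_abs_le (u (tg e) - u e.1)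
      rw [abs_le]; constructor <;> linarith
    have h2 : |u (tg e) - u e.1| ≤ k / log R * |Gs (tg e) - Gs e.1| := by
      simp only [hu]; rw [← mul_sub, abs_mul, abs_of_nonneg hk, div_mul_eq_mul_div, mul_div_assoc]
      gcongr
      rw [max_comm 0, max_comm 0]
      refine (abs_max_sub_max_le_abs _ _ _).trans (le_of_eq ?_)
      rw [show 1 - Gs (tg e) / log R - (1 - Gs e.1 / log R) = -((Gs (tg e) - Gs e.1) / log R) by ring, abs_neg, abs_div, abs_of_pos hlR]
    rw [← sq_abs (gr φ e : ℝ)]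
    set X := |u (tg e) - u e.1|
    have h3 : (X +1) ^2 ≤ (1 + ε) * X ^2 + (1 +1 / ε) := by
      have : 0 ≤ (ε * X -1) ^2 / ε := by positivity
      have e : (ε * X -1) ^2 / ε = ε * X ^2 -2 * X +1 / ε := by field_simp; ring
      linarith
    calc _ ≤ (X +1) ^2 := by gcongr
      _ ≤ _ := h3
      _ ≤ (1 + ε) * (k / log R * |Gs (tg e) - Gs e.1|) ^2 + (1 +1 / ε) := by gcongr
      _ = _ := by rw [mul_pow, sq_abs]; ring
  have e3 : en (ed (Bx 0 R)) φ ≤ (1 + ε) * (k / log R) ^2 * (2 * π * log (R +1) +40) + (1 +1 / ε) * (4 * (2 * R +1) ^2) := by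
    unfold en
    refine (sum_le_sum fun e _ => e2 e).trans ?_
    rw [sum_add_distrib, ← Finset.mul_sum, Finset.sum_const, nsmul_eq_mul]
    have hc : ((ed (Bx 0 R)).card : ℝ) ≤4 * (2 * R +1) ^2 := by
      have h1 := ed_card (Bx 0 R)
      have h2 : (Bx 0 R).card = (2 * R +1) ^2 := by
        simp [Bx]; rw [show ((R:ℤ) +1 + R).toNat =2 * R +1 by omega]; ring
      rw [h2] at h1; exact_mod_cast h1
    have := Gs_en R
    rw [mul_comm ((ed (Bx 0 R)).card : ℝ)]
    gcongr
  rw [e1]; gcongr ?_ * exp ?_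
  nlinarith

lemma ev_log (c : ℝ) {s : ℝ} (hs : 0 < s) : ∀ᶠ n : ℕ in atTop, c * (log n +1) ≤ (n:ℝ) ^ s := by
  have h1 : (fun x : ℝ => log x +1) =o[atTop] fun x => x ^ s :=
    (isLittleO_log_rpow_atTop hs).add ((Asymptotics.isLittleO_one_left_iff ℝ).2 (tendsto_norm_atTop_atTop.comp (tendsto_rpow_atTop hs)))
  have h2 := (h1.bound (show 0 <1 / (|c| +1) by positivity))
  filter_upwards [tendsto_natCast_atTop_atTop.eventually h2, eventually_ge_atTop 1] with n h hn
  have hl : 0 ≤ log n := log_natCast_nonneg n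
  rw [Real.norm_of_nonneg (by positivity), Real.norm_of_nonneg (by positivity), div_mul_eq_mul_div, le_div_iff₀ (by positivity)] at h
  have := le_abs_self c
  nlinarith
lemma ev_ll (c : ℝ) : ∀ᶠ n : ℕ in atTop, c ≤ log n :=
  (Real.tendsto_log_atTop.comp tendsto_natCast_atTop_atTop).eventually (eventually_ge_atTop c)
set_option maxHeartbeats 1000000 in
lemma LBa (hb : 20 ≤ b) {δ : ℝ} (hδ : 0 < δ) (hδ1 : δ ≤1) : ∀ᶠ n : ℕ in atTop, ∀ h : ℕ, (n:ℝ) ≤ (h:ℝ) ^2 →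
    exp (-((1 + δ) * (4 * π * b * h ^2 / log n))) ≤ q b (n ^2) h := by
  set s := δ /20 with hs
  have hs0 : 0 < s := by positivity
  have hs1 : s ≤1 /20 := by rw [hs]; linarith
  have hpi := pi_gt_three
  filter_upwards [ev_log (12 / s ^2) one_pos, ev_log 2 (half_pos hs0), ev_ll ((2 * π +40) / (2 * π * s) *4 +4),
    ev_log (37 * (1 +1 / s) / s) hs0, eventually_ge_atTop 2] with n ha hbb hc hd hn h hh
  have hn1 : (1:ℝ) < n := by exact_mod_cast hn
  have hn0 : (0:ℝ) < n := by linarith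
  have hL : 0 < log n := Real.log_pos hn1
  set L := log n with hLd
  have hh0 : 0 < (h:ℝ) := by
    rcases Nat.eq_zero_or_pos h with rfl | h'
    · norm_num at hh; linarith
    · exact_mod_cast h'
  set T := ⌈sqrt (2 * L +3)⌉₊
  set R := ⌊(n:ℝ) ^ ((1 - s) /2)⌋₊
  have hT1 : log ((n ^2 : ℕ) : ℝ) +3 ≤ (T +1 : ℝ) ^2 := by
    push_cast; rw [Real.log_pow]; push_cast
    have h1 : sqrt (2 * L +3) ≤ T := Nat.le_ceil _
    have h2 := Real.sq_sqrt (show 0 ≤2 * L +3 by positivity)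
    have := Real.sqrt_nonneg (2 * L +3)
    nlinarith only [h1,h2,this]
  have hT2 : (T:ℝ) ≤ s * h := by
    have h1 : (T:ℝ) < sqrt (2 * L +3) +1 := Nat.ceil_lt_add_one (Real.sqrt_nonneg _)
    rw [rpow_one, div_mul_eq_mul_div, div_le_iff₀ (by positivity)] at ha
    have h3 : 12 * (L +1) ≤ (s * h) ^2 := by rw [mul_pow]; have := mul_le_mul_of_nonneg_left hh (sq_nonneg s); linarith
    have h2 : sqrt (2 * L +3) ≤ s * h /2 := by
      rw [Real.sqrt_le_left (by positivity)]; nlinarith only [h3,hL]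
    have h4 : 1 ≤ s * h /2 := by
      have : 0 ≤ s * h := by positivity
      nlinarith only [this,h3,hL]
    linarith
  have hR1 : (n:ℝ) ^ ((1 -2 * s) /2) ≤ R := by
    have h1 : (n:ℝ) ^ ((1 - s) /2) < R +1 := Nat.lt_floor_add_one _
    have h2 : (n:ℝ) ^ ((1 - s) /2) = (n:ℝ) ^ ((1 -2 * s) /2) * (n:ℝ) ^ (s /2) := by
      rw [← rpow_add hn0]; congr 1; ring
    have h3 : 1 ≤ (n:ℝ) ^ ((1 -2 * s) /2) := Real.one_le_rpow hn1.le (by linarith)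
    have h4 := mul_le_mul_of_nonneg_left (show 2 ≤ (n:ℝ) ^ (s /2) by linarith) (show 0 ≤ (n:ℝ) ^ ((1 -2 * s) /2) by linarith)
    linarith
  have hR2 : (R:ℝ) ≤ (n:ℝ) ^ ((1 - s) /2) := Nat.floor_le (by positivity)
  have hRlog : (1 -2 * s) /2 * L ≤ log R := by
    have := log_le_log (by positivity) hR1
    rwa [Real.log_rpow hn0] at this
  have hK : (2 * π +40) / (2 * π * s) +1 ≤ log R := by
    have : 0 < (2 * π +40) / (2 * π * s) := by positivity
    have := mul_le_mul_of_nonneg_right (show 1 /4 ≤ (1 -2 * s) /2 by linarith) hL.le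
    linarith
  have hlR : 0 < log R := lt_of_lt_of_le (by positivity) hK
  have hRp : 2 ≤ R := by
    by_contra hc; have : R =0 ∨ R =1 := by omega
    rcases this with h | h <;> rw [h] at hlR <;> simp at hlR
  have hRn : R ≤ n ^2 := by
    have h1 : (n:ℝ) ^ ((1 - s) /2) ≤ (n:ℝ) ^ (2:ℝ) := Real.rpow_le_rpow_of_exponent_le hn1.le (by linarith)
    rw [Real.rpow_two] at h1
    exact_mod_cast hR2.trans h1
  refine le_trans ?_ (qLB hb hs0 hRp hRn (Int.natCast_nonneg h) hT1)
  have hRr : (2:ℝ) ≤ R := by exact_mod_cast hRp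
  have h1 : 2 * π * log (R +1) +40 ≤2 * π * (1 + s) * log R := by
    have h2 : log ((R:ℝ) +1) ≤ log R +1 := by
      have h3 : log ((R:ℝ) +1) - log R = log ((R +1) / R) := (Real.log_div (by positivity) (by positivity)).symm
      have h4 := Real.log_le_sub_one_of_pos (show 0 < ((R:ℝ) +1) / R by positivity)
      have h5 : ((R:ℝ) +1) / R ≤2 := by rw [div_le_iff₀ (by positivity)]; linarith
      linarith
    have h3 : 2 * π +40 ≤2 * π * s * log R := by
      have := (div_le_iff₀ (by positivity)).1 (show (2 * π +40) / (2 * π * s) ≤ log R by linarith); linarith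
    have := mul_le_mul_of_nonneg_left h2 (show 0 ≤2 * π by linarith)
    linarith
  have h2 : (1 + s) * ((((h:ℤ):ℝ) + T) / log R) ^2 * (2 * π * log (R +1) +40) ≤ (1 +9 * s) * (4 * π) * h ^2 / L := by
    have hq : 0 < (1 -2 * s) /2 * L := mul_pos (by linarith) hL
    have hq2 : 0 ≤2 * π * log (R +1) +40 := by
      have := log_nonneg (show (1:ℝ) ≤ R +1 by linarith); positivity
    push_cast
    calc _ ≤ (1 + s) * (((h:ℝ) + s * h) / log R) ^2 * (2 * π * (1 + s) * log R) := by gcongr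
      _ = (1 + s) ^4 * (2 * π) * h ^2 / log R := by field_simp
      _ ≤ (1 + s) ^4 * (2 * π) * h ^2 / ((1 -2 * s) /2 * L) := by gcongr
      _ = (1 + s) ^4 / (1 -2 * s) * ((4 * π) * h ^2 / L) := by
        have : 1 -2 * s ≠ 0 := by linarith
        field_simp; ring
      _ ≤ (1 +9 * s) * ((4 * π) * h ^2 / L) := by
        gcongr
        rw [div_le_iff₀ (by linarith)]
        have a1 : (1 + s) ^2 ≤1 +2.05 * s := by nlinarith only [hs0,hs1]
        have a2 : ((1 + s) ^2) ^2 ≤ (1 +2.05 * s) ^2 := by gcongr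
        nlinarith only [a2,hs0,hs1,mul_pos hs0 hs0]
      _ = _ := by ring
  have h3 : (1 +1 / s) * (4 * (2 * R +1) ^2) +1 ≤ s * h ^2 / L := by
    have e : ((n:ℝ) ^ ((1 - s) /2)) ^2 = (n:ℝ) ^ (1 - s) := by rw [← Real.rpow_natCast, ← Real.rpow_mul hn0.le]; congr 1; push_cast; ring
    have a1 : (R:ℝ) ^2 ≤ (n:ℝ) ^ (1 - s) := by rw [← e]; gcongr
    have a2 : 4 * (2 * (R:ℝ) +1) ^2 ≤36 * (n:ℝ) ^ (1 - s) := by nlinarith only [a1,hRr]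
    have a3 : 1 ≤ (n:ℝ) ^ (1 - s) := Real.one_le_rpow hn1.le (by linarith)
    have a4 : (n:ℝ) = (n:ℝ) ^ (1 - s) * (n:ℝ) ^ s := by rw [← rpow_add hn0]; simp
    have a5 : 0 <1 / s := by positivity
    rw [le_div_iff₀ hL]
    rw [div_mul_eq_mul_div, div_le_iff₀ hs0] at hd
    calc _ ≤ ((1 +1 / s) * (36 * (n:ℝ) ^ (1 - s)) + (1 +1 / s) * (n:ℝ) ^ (1 - s)) * L := by
          gcongr; exact one_le_mul_of_one_le_of_one_le (by linarith) a3
      _ = (37 * (1 +1 / s) * L) * (n:ℝ) ^ (1 - s) := by ring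
      _ ≤ ((n:ℝ) ^ s * s) * (n:ℝ) ^ (1 - s) := by refine mul_le_mul_of_nonneg_right ?_ (by positivity); linarith [show 0 ≤37 * (1 +1 / s) by positivity]
      _ = s * n := by rw [mul_comm s]; nth_rw 3 [a4]; ring
      _ ≤ _ := by gcongr
  have h4 : exp (-1) ≤1 /2 := by
    have := add_one_le_exp (1:ℝ)
    rw [exp_neg, ← one_div]; exact one_div_le_one_div_of_le (by norm_num) (by linarith)
  calc _ ≤ exp (-1) * exp (-b * ((1 + s) * ((((h:ℤ):ℝ) + T) / log R) ^2 * (2 * π * log (R +1) +40) + (1 +1 / s) * (4 * (2 * R +1) ^2))) := by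
        rw [← exp_add]; refine exp_le_exp.2 ?_
        have a1 : (1 +9 * s) * (4 * π) * h ^2 / L + s * h ^2 / L ≤ (1 + δ) * (4 * π * h ^2 / L) := by
          have : 0 ≤ (h:ℝ) ^2 / L := by positivity
          have e : δ =20 * s := by rw [hs]; ring
          rw [e, show (1 +9 * s) * (4 * π) * h ^2 / L + s * h ^2 / L = ((1 +9 * s) * (4 * π) + s) * (h ^2 / L) by ring,
            show (1 +20 * s) * (4 * π * h ^2 / L) = ((1 +20 * s) * (4 * π)) * (h ^2 / L) by ring]
          gcongr; nlinarith only [hs0,hpi,mul_pos hs0 Real.pi_pos]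
        have a2 : (1 + δ) * (4 * π * b * h ^2 / L) = b * ((1 + δ) * (4 * π * h ^2 / L)) := by ring
        rw [a2]
        have a3 := mul_le_mul_of_nonneg_left ((add_le_add h2 h3).trans a1) (show 0 ≤ b by linarith)
        linarith
    _ ≤ _ := by gcongr

lemma Bx_card (n : ℕ) : (Bx 0 n).card = (2 * n +1) ^2 := by
  simp [Bx]; rw [show ((n:ℤ) +1 + n).toNat =2 * n +1 by omega]; ring
lemma q_it (hb : 20 ≤ b) {l r : ℕ} (hr : 1 ≤ r) (hl : r ≤ l) {e : ℝ} (he : eps (Bx 0 l) r ≤ e) (he2 : e ≤1 /2) (j k : ℕ) :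
    q b l (j + k : ℕ) ≤2 * exp (-b * (j:ℝ) ^2 * (2 * π / (log r +3))) + e ^ k := by
  have he0 := (eps_nn (Bx 0 l) r).trans he
  have hp := Real.pi_pos
  have hlg : 0 ≤ log r := log_natCast_nonneg r
  induction k with
  | zero => have := q_one (by linarith : 0 < b) l (j +0 : ℕ); rw [pow_zero]; have := exp_pos (-b * (j:ℝ) ^2 * (2 * π / (log r +3))); linarith
  | succ k ih =>
    have h1 := Dq hb hr hl (he.trans (by linarith)) (j := ((j + (k +1) : ℕ) : ℤ)) (by push_cast; omega)
    rw [show ((j + (k +1) : ℕ) : ℤ) -1 = ((j + k : ℕ) : ℤ) by push_cast; ring] at h1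
    have h2 : exp (-b * (((j + (k +1) : ℕ) : ℤ):ℝ) ^2 * (2 * π / (log r +3))) ≤ exp (-b * (j:ℝ) ^2 * (2 * π / (log r +3))) := by
      refine exp_le_exp.2 ?_
      have : (j:ℝ) ^2 ≤ (((j + (k +1) : ℕ) : ℤ):ℝ) ^2 := by
        gcongr; push_cast; linarith [(Nat.cast_nonneg k : (0:ℝ) ≤ k)]
      have h3 : 0 ≤ b * (2 * π / (log r +3)) := mul_nonneg (by linarith) (by positivity)
      nlinarith only [mul_le_mul_of_nonneg_left this h3]
    have h3 : eps (Bx 0 l) r * q b l (j + k : ℕ) ≤ e * (2 * exp (-b * (j:ℝ) ^2 * (2 * π / (log r +3))) + e ^ k) := by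
      gcongr; exact q_nn _ _
    have h4 := exp_pos (-b * (j:ℝ) ^2 * (2 * π / (log r +3)))
    have h5 := mul_le_mul_of_nonneg_right he2 h4.le
    have h6 : e ^ (k +1) = e * e ^ k := by ring
    linarith
lemma ev_pow (c : ℝ) (k : ℕ) {s : ℝ} (hs : 0 < s) : ∀ᶠ n : ℕ in atTop, c * (n:ℝ) ^ k ≤ exp (s * n) := by
  filter_upwards [ev_ll (log (|c| +1)), ev_log ((k +1) / s) one_pos, eventually_ge_atTop 2] with n h1 h2 h3
  have hn : (0:ℝ) < n := by exact_mod_cast (by omega : 0 < n)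
  rw [rpow_one, div_mul_eq_mul_div, div_le_iff₀ hs] at h2
  have h4 : |c| +1 ≤ exp (log n) := by rw [← Real.log_le_iff_le_exp (by positivity)]; exact h1
  calc c * (n:ℝ) ^ k ≤ exp (log n) * exp (log n) ^ k := by
        rw [Real.exp_log hn] at h4 ⊢; gcongr; linarith [le_abs_self c]
    _ = exp ((k +1) * log n) := by rw [← exp_nat_mul, ← exp_add]; congr 1; ring
    _ ≤ _ := exp_le_exp.2 (by linarith [(Nat.cast_nonneg k : (0:ℝ) ≤ k)])
lemma ev_sq {p : ℕ → Prop} (hp : ∀ᶠ n in atTop, p n) : ∀ᶠ n : ℕ in atTop, ∀ h : ℕ, (n:ℝ) ≤ (h:ℝ) ^2 → p h := by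
  obtain ⟨N, hN⟩ := eventually_atTop.1 hp
  filter_upwards [eventually_ge_atTop (N ^2)] with n hn h hh
  refine hN h ?_
  have : n ≤ h ^2 := by exact_mod_cast hh
  exact (Nat.pow_le_pow_iff_left (by norm_num)).1 (hn.trans this)
set_option maxHeartbeats 1000000 in
lemma UBa (hb : 20 ≤ b) {δ : ℝ} (hδ : 0 < δ) (hδ1 : δ ≤1) : ∀ᶠ n : ℕ in atTop, ∀ h : ℕ, (n:ℝ) ≤ (h:ℝ) ^2 → (h:ℝ) ^2 ≤ n * log n ^2 →
    q b (n ^2) h ≤ exp (-((1 - δ) * (4 * π * b * h ^2 / log n))) := by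
  set s := δ /6 with hs
  have hs0 : 0 < s := by positivity
  have hs1 : s ≤1 /6 := by rw [hs]; linarith
  have hpi := pi_gt_three
  have hb0 : 0 < b := by linarith
  filter_upwards [ev_sq (ev_pow 72 8 two_pos), ev_sq (eventually_ge_atTop (⌈1 / s⌉₊ +1)), ev_ll (2 * π * b / s +2),
    (Real.tendsto_log_atTop.comp tendsto_natCast_atTop_atTop).eventually (((Real.isLittleO_log_id_atTop).bound (show 0 < s /4 by positivity))),
    ev_ll (12 / s), ev_log (1 / s) one_pos, eventually_ge_atTop 2] with n h1 h2 h3 h4 h5 h6 hn h hh hh'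
  replace h1 := h1 h hh
  replace h2 := h2 h hh
  have hn1 : (1:ℝ) < n := by exact_mod_cast hn
  have hL : 0 < log n := Real.log_pos hn1
  simp only [Function.comp, id] at h4
  set L := log n with hLd
  have hL2 : 2 ≤ L := by
    have : 0 <2 * π * b / s := by positivity
    linarith
  have hh0 : 0 < (h:ℝ) := by exact_mod_cast (by omega : 0 < h)
  have hsh : 1 ≤ s * h := by
    have a1 : (⌈1 / s⌉₊ : ℝ) ≤ h := by exact_mod_cast (by omega : ⌈1 / s⌉₊ ≤ h)
    have := (Nat.le_ceil (1 / s)).trans a1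
    rw [div_le_iff₀ hs0] at this; linarith
  have hhr : (1:ℝ) ≤ h := by exact_mod_cast (by omega : 1 ≤ h)
  have he : eps (Bx 0 (n ^2)) h ≤ exp (-2 * h) := by
    unfold eps; rw [Bx_card]; push_cast
    have a1 : (2 * (n:ℝ) ^2 +1) ^2 ≤9 * (h:ℝ) ^8 := by
      have a2 : (n:ℝ) ^2 ≤ (h:ℝ) ^4 := by rw [show (h:ℝ) ^4 = (h ^2) ^2 by ring]; gcongr
      have a3 : 1 ≤ (h:ℝ) ^4 := one_le_pow₀ hhr
      calc _ ≤ (3 * (h:ℝ) ^4) ^2 := by gcongr; linarith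
        _ = _ := by ring
    have a4 : exp (-2 * h) = exp (2 * h) * exp (-4 * h) := by rw [← exp_add]; congr 1; ring
    rw [a4]; gcongr; linarith
  have he2 : exp (-2 * (h:ℝ)) ≤1 /2 := by
    have := add_one_le_exp (2 * (h:ℝ))
    rw [neg_mul, exp_neg, ← one_div]; exact one_div_le_one_div_of_le (by norm_num) (by linarith)
  set k := ⌈s * h⌉₊
  have hk1 : s * h ≤ k := Nat.le_ceil _
  have hk2 : (k:ℝ) ≤2 * s * h := by
    have : (k:ℝ) < s * h +1 := Nat.ceil_lt_add_one (by positivity)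
    linarith
  have hkh : k ≤ h := by
    have : (k:ℝ) ≤ h := hk2.trans (by nlinarith only [mul_le_mul_of_nonneg_right hs1 hh0.le,hh0])
    exact_mod_cast this
  have hhn : h ≤ n ^2 := by
    have a1 : (h:ℝ) ^2 ≤ ((n:ℝ) ^2) ^2 := hh'.trans (by
      have : L ≤ n := (Real.log_le_sub_one_of_pos (by linarith)).trans (by linarith)
      calc (n:ℝ) * L ^2 ≤ (n:ℝ) * (n:ℝ) ^2 := by gcongr
        _ ≤ (n:ℝ) * (n:ℝ) ^2 * (n:ℝ) := le_mul_of_one_le_right (by positivity) hn1.le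
        _ = _ := by ring)
    have := (pow_le_pow_iff_left₀ (by positivity) (by positivity) (by norm_num)).1 a1
    exact_mod_cast this
  have key := q_it hb (by omega : 1 ≤ h) hhn he he2 (h - k) k
  rw [Nat.sub_add_cancel hkh] at key
  refine key.trans ?_
  set Y := 4 * π * b * h ^2 / L with hY
  have hY0 : 0 < Y := by positivity
  have hlh : log h +3 ≤ (1 + s) /2 * L := by
    have a1 : log ((h:ℝ) ^2) ≤ log (n * L ^2) := log_le_log (by positivity) hh'
    rw [Real.log_mul (by positivity) (by positivity), Real.log_pow, Real.log_pow] at a1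
    push_cast at a1
    have a2 := (le_abs_self _).trans h4
    rw [Real.norm_of_nonneg hL.le] at a2
    have a3 := (div_le_iff₀ hs0).1 h5
    linarith
  have f1 : -b * ((h - k : ℕ):ℝ) ^2 * (2 * π / (log h +3)) ≤ -((1 -5 * s) * Y) := by
    rw [Nat.cast_sub hkh]
    have a0 : 0 ≤ log h := log_nonneg hhr
    have a1 : (1 -2 * s) * h ≤ h - k := by linarith
    have a2 : ((1 -2 * s) * h) ^2 ≤ ((h:ℝ) - k) ^2 := by
      have : 0 ≤ (1 -2 * s) * h := mul_nonneg (by linarith) hh0.le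
      gcongr
    have a3 : 2 * π / ((1 + s) /2 * L) ≤2 * π / (log h +3) := by gcongr
    have a4 : b * ((1 -2 * s) * h) ^2 * (2 * π / ((1 + s) /2 * L)) ≤ b * ((h:ℝ) - k) ^2 * (2 * π / (log h +3)) := by gcongr
    have a5 : b * ((1 -2 * s) * h) ^2 * (2 * π / ((1 + s) /2 * L)) = (1 -2 * s) ^2 / (1 + s) * Y := by
      rw [hY]; field_simp; ring
    have a6 : (1 -5 * s) * Y ≤ (1 -2 * s) ^2 / (1 + s) * Y := by
      gcongr; rw [le_div_iff₀ (by positivity)]; nlinarith only [hs0,hs1,mul_pos hs0 hs0]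
    linarith
  have f2 : exp (-2 * (h:ℝ)) ^ k ≤ exp (-((1 -5 * s) * Y)) := by
    rw [← exp_nat_mul]; refine exp_le_exp.2 ?_
    have a1 : Y ≤2 * h * (s * h) := by
      rw [hY, div_le_iff₀ hL]
      have : 2 * π * b ≤ L * s := by rw [← div_le_iff₀ hs0]; linarith
      nlinarith only [mul_le_mul_of_nonneg_right this (sq_nonneg (h:ℝ))]
    have a2 : 2 * h * (s * h) ≤2 * h * (k:ℝ) := by gcongr
    nlinarith only [a1,a2,mul_pos hs0 hY0]
  have f3 : 3 * exp (-((1 -5 * s) * Y)) ≤ exp (-((1 - δ) * Y)) := by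
    have a1 : 2 ≤ s * Y := by
      rw [rpow_one, div_mul_eq_mul_div, one_mul, div_le_iff₀ hs0] at h6
      rw [hY, ← mul_div_assoc, le_div_iff₀ hL]
      have : n * s ≤ s * (h:ℝ) ^2 := by nlinarith only [mul_le_mul_of_nonneg_left hh hs0.le]
      have c1 : 2 ≤4 * π * b := by nlinarith only [hb,hpi]
      have c2 : 2 * (s * (h:ℝ) ^2) ≤4 * π * b * (s * h ^2) := by gcongr
      linarith
    have a2 : (3:ℝ) ≤ exp 2 := by have := add_one_le_exp (2:ℝ); linarith
    calc _ ≤ exp (s * Y) * exp (-((1 -5 * s) * Y)) := by gcongr; exact a2.trans (exp_le_exp.2 a1)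
      _ = _ := by rw [← exp_add]; congr 1; rw [hs]; ring
  have := exp_le_exp.2 f1
  linarith

lemma Rto (hb : 20 ≤ b) : ∀ᶠ n : ℕ in atTop, ∀ h : ℕ, (n:ℝ) ≤ (h:ℝ) ^2 → (n:ℝ) ^60 * q b (n ^2) (h +1) ≤ q b (n ^2) h := by
  have hpi := pi_gt_three
  filter_upwards [LBa hb (show (0:ℝ) <0.04 by norm_num) (by norm_num), ev_log 70 (show (0:ℝ) <0.45 by norm_num), ev_ll 400,
    ev_log 10 (show (0:ℝ) <1 /2 by norm_num)] with n h1 h2 h3 h4 h hh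
  replace h1 := h1 h hh
  have hn0 : (0:ℝ) < n := by
    rcases n.eq_zero_or_pos with rfl | h'
    · norm_num at h3
    · exact_mod_cast h'
  have hn1 : (1:ℝ) ≤ n := by exact_mod_cast (by exact_mod_cast hn0 : 0 < n)
  set L := log n with hL
  set P := (n:ℝ) ^ (0.45:ℝ)
  have hP1 : P ≤ (n:ℝ) ^ (2:ℝ) := Real.rpow_le_rpow_of_exponent_le hn1 (by norm_num)
  have hP : 1 ≤ P := Real.one_le_rpow hn1 (by norm_num)
  set r := ⌈P⌉₊
  have hr : P ≤ r := Nat.le_ceil _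
  have hr2 : (r:ℝ) ≤2 * P := by have := Nat.ceil_lt_add_one (show 0 ≤ P by linarith); linarith
  have hr1 : 1 ≤ r := by
    have : (1:ℝ) ≤ r := hP.trans hr
    exact_mod_cast this
  have hrn : r ≤ n ^2 := by
    refine Nat.ceil_le.2 ?_; push_cast; rw [← Real.rpow_two]; exact hP1
  have hnL : (n:ℝ) = exp L := (Real.exp_log hn0).symm
  have he : (n:ℝ) ^60 * eps (Bx 0 (n ^2)) r ≤1 /2 := by
    unfold eps; rw [Bx_card]; push_cast
    have a1 : (2 * (n:ℝ) ^2 +1) ^2 ≤9 * (n:ℝ) ^4 := by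
      have a3 : 1 ≤ (n:ℝ) ^2 := one_le_pow₀ hn1
      calc _ ≤ (3 * (n:ℝ) ^2) ^2 := by gcongr; linarith only [a3]
        _ = _ := by ring
    have a2 : exp (-4 * r) ≤ exp (-(64 * L) -200) := exp_le_exp.2 (by linarith)
    have a3 : (144:ℝ) ≤ exp 200 := by linarith [add_one_le_exp (200:ℝ)]
    calc _ ≤ (n:ℝ) ^60 * (8 * (9 * (n:ℝ) ^4) * exp (-(64 * L) -200)) := by gcongr
      _ =72 * exp (-200) := by
        rw [hnL, ← exp_nat_mul, ← exp_nat_mul, sub_eq_add_neg, exp_add,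
          show ∀ a c d e : ℝ, a * (8 * (9 * c) * (d * e)) =72 * (a * c * d) * e by intros; ring, ← exp_add, ← exp_add]
        norm_num; ring_nf
      _ ≤1 /2 := by
        rw [exp_neg, ← div_eq_mul_inv, div_le_iff₀ (exp_pos _)]; linarith
  have hp60 : 1 ≤ (n:ℝ) ^60 := one_le_pow₀ hn1
  have he1 : eps (Bx 0 (n ^2)) r ≤1 := by
    have := eps_nn (Bx 0 (n ^2)) r; nlinarith only [this,hp60,he]
  have key := Dq hb hr1 hrn he1 (j := (h:ℤ) +1) (by omega)
  rw [add_sub_cancel_right] at key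
  set Y := 4 * π * b * h ^2 / L with hY
  have hlr : log r +3 ≤0.46 * L := by
    have a1 := log_le_log (by exact_mod_cast hr1) hr2
    rw [Real.log_mul (by norm_num) (by positivity), Real.log_rpow hn0] at a1
    have := Real.log_two_lt_d9; linarith
  have hlr0 : 0 ≤ log r := log_natCast_nonneg r
  have f1 : exp (-b * (((h:ℤ) +1 : ℤ) : ℝ) ^2 * (2 * π / (log r +3))) ≤ exp (-(1.086 * Y)) := by
    refine exp_le_exp.2 ?_
    have a1 : b * (h:ℝ) ^2 * (2 * π / (0.46 * L)) ≤ b * (((h:ℤ) +1 : ℤ) : ℝ) ^2 * (2 * π / (log r +3)) := by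
      gcongr; push_cast; linarith
    have a2 : b * (h:ℝ) ^2 * (2 * π / (0.46 * L)) =1 /0.92 * Y := by rw [hY]; field_simp; ring
    have a3 : 0 ≤ Y := by positivity
    rw [a2] at a1; norm_num at a1 ⊢; linarith
  have f2 : 61 * L ≤0.046 * Y := by
    have a1 : 100 * (L +1) ^2 ≤ n := by
      have e : ((n:ℝ) ^ (1/2:ℝ)) ^2 = n := by rw [← Real.sqrt_eq_rpow, Real.sq_sqrt hn0.le]
      rw [← e]; calc _ = (10 * (L +1)) ^2 := by ring
        _ ≤ _ := by gcongr
    have a2 : 240 * (100 * L) ≤ Y := by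
      rw [hY, le_div_iff₀ (by linarith)]
      have c1 : 240 ≤4 * π * b := by nlinarith only [hb,hpi]
      calc _ ≤240 * (100 * (L +1) ^2) := by nlinarith only [h3]
        _ ≤4 * π * b * h ^2 := by gcongr; linarith
    linarith
  have f3 : (n:ℝ) ^60 * exp (-(1.086 * Y)) ≤1 /2 * q b (n ^2) h := by
    have a1 : exp (-1) ≤1 /2 := by
      have := add_one_le_exp (1:ℝ)
      rw [exp_neg, ← one_div]; exact one_div_le_one_div_of_le (by norm_num) (by linarith)
    calc _ ≤ exp (-1) * exp (-((1 +0.04) * Y)) := by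
          nth_rw 1 [hnL]; rw [← exp_nat_mul, ← exp_add, ← exp_add]; refine exp_le_exp.2 ?_
          push_cast; linarith
      _ ≤ _ := by gcongr
  have hq := q_nn (b := b) (n ^2) h
  calc _ ≤ (n:ℝ) ^60 * (exp (-(1.086 * Y)) + eps (Bx 0 (n ^2)) r * q b (n ^2) h) := by gcongr; exact key.trans (by gcongr)
    _ = (n:ℝ) ^60 * exp (-(1.086 * Y)) + (n:ℝ) ^60 * eps (Bx 0 (n ^2)) r * q b (n ^2) h := by ring
    _ ≤1 /2 * q b (n ^2) h +1 /2 * q b (n ^2) h := by gcongr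
    _ = _ := by ring
def KK (b : ℝ) (g n : ℕ) (x : ℝ) : ℕ := Nat.findGreatest (fun h => (n:ℝ) ^20 ≤ x ^ g * q b (n ^2) h) n
set_option maxHeartbeats 1000000 in
lemma KKa (hb : 20 ≤ b) {δ : ℝ} (hδ : 0 < δ) (hδ1 : δ ≤1 /3) {g : ℕ} (hg : 1 ≤ g) (hg2 : g ≤2) : ∀ᶠ n : ℕ in atTop, ∀ x : ℝ, exp (n -1) ≤ x → x ≤ exp n →
    (1 - δ) * sqrt (g * n * log n / (4 * π * b)) -1 ≤ KK b g n x ∧ KK b g n x ≤ (1 + δ) * sqrt (g * n * log n / (4 * π * b)) +1 ∧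
    (n:ℝ) ^20 ≤ x ^ g * q b (n ^2) (KK b g n x) ∧ x ^ g * q b (n ^2) (KK b g n x +1) ≤ (n:ℝ) ^20 ∧ (n:ℝ) ≤ (KK b g n x : ℝ) ^2 ∧ 4 * KK b g n x ≤ n := by
  have hpi := pi_gt_three
  have hpi4 := Real.pi_lt_four
  filter_upwards [LBa hb hδ (by linarith), UBa hb hδ (by linarith), ev_ll (64 * b +1), ev_log 100 one_pos, ev_pow (exp 2) 20 hδ,
    eventually_ge_atTop 100] with n h1 h2 h3 h4 h6 h7 x hx1 hx2
  have hgr : (1:ℝ) ≤ g := by exact_mod_cast hg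
  have hgr2 : (g:ℝ) ≤2 := by exact_mod_cast hg2
  have hn0 : (100:ℝ) ≤ n := by exact_mod_cast h7
  set L := log n with hL
  rw [rpow_one] at h4
  set v := sqrt (g * n * L / (4 * π * b)) with hv
  have hL0 : 0 < L := by linarith
  have hv2 : v ^2 = g * n * L / (4 * π * b) := Real.sq_sqrt (by positivity)
  have hv0 : 0 ≤ v := Real.sqrt_nonneg _
  have hvl : 4 * n ≤ v ^2 := by
    rw [hv2, le_div_iff₀ (by positivity)]
    have a1 : 16 * π * b ≤ L := by nlinarith only [hb,hpi4,h3]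
    have a2 : n * (16 * π * b) ≤ n * L := by gcongr
    have a3 : 1 * (n * L) ≤ g * (n * L) := by gcongr
    linarith
  have hvu : v ^2 ≤ n * L /100 := by
    rw [hv2, div_le_div_iff₀ (by positivity) (by positivity)]
    have a1 : 200 ≤4 * π * b := by nlinarith only [hb,hpi]
    have a2 : n * L *200 ≤ n * L * (4 * π * b) := by gcongr
    have a3 : g * (n * L) ≤2 * (n * L) := by gcongr
    linarith
  have hv20 : 20 ≤ v := by nlinarith only [hvl,hn0,hv0]
  have hx0 : 0 < x := (exp_pos _).trans_le hx1
  have hqY : ∀ y : ℝ, 4 * π * b * (y * v) ^2 / L = y ^2 * (g * n) := fun y => by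
    rw [mul_pow, hv2]; field_simp
  set p : ℕ → Prop := fun h => (n:ℝ) ^20 ≤ x ^ g * q b (n ^2) h with hp
  set h := ⌊(1 - δ) * v⌋₊
  have hh1 : (h:ℝ) ≤ (1 - δ) * v := Nat.floor_le (mul_nonneg (by linarith) hv0)
  have hh2 : (1 - δ) * v -1 < h := by have := Nat.lt_floor_add_one ((1 - δ) * v); linarith
  have hhn : (n:ℝ) ≤ (h:ℝ) ^2 := by
    have : 0.55 * v ≤ h := by linarith only [mul_le_mul_of_nonneg_right hδ1 hv0,hh2,hv20]
    nlinarith only [this,hv0,hvl]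
  have hph : p h := by
    have a1 := h1 h hhn
    have a2 : exp (-((1 - δ) * (g * n))) ≤ q b (n ^2) h := by
      refine le_trans (exp_le_exp.2 ?_) a1
      have c1 : 4 * π * b * (h:ℝ) ^2 / L ≤4 * π * b * ((1 - δ) * v) ^2 / L := by gcongr
      rw [hqY] at c1
      have c2 : (1 + δ) * (1 - δ) ^2 ≤1 - δ := by
        have : (1 - δ) - (1 + δ) * (1 - δ) ^2 = δ ^2 * (1 - δ) := by ring
        have : 0 ≤ δ ^2 * (1 - δ) := mul_nonneg (sq_nonneg _) (by linarith)
        linarith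
      have c3 : (1 + δ) * (1 - δ) ^2 * (g * n) ≤ (1 - δ) * ((g:ℝ) * n) := by gcongr
      have c4 := mul_le_mul_of_nonneg_left c1 (show 0 ≤1 + δ by linarith)
      linarith
    have a3 : exp (n -1) ^ g ≤ x ^ g := by gcongr
    have a4 : exp 2 * (n:ℝ) ^20 * exp (-g) ≤ exp (δ * n) * exp (-g) := by gcongr
    have a5 : (n:ℝ) ^20 ≤ exp 2 * (n:ℝ) ^20 * exp (-g) := by
      rw [mul_right_comm, ← exp_add]; refine le_mul_of_one_le_left (by positivity) (Real.one_le_exp (by linarith))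
    show (n:ℝ) ^20 ≤ _
    calc (n:ℝ) ^20 ≤ exp (δ * n) * exp (-g) := a5.trans a4
      _ ≤ exp (n -1) ^ g * exp (-((1 - δ) * (g * n))) := by
        rw [← exp_nat_mul, ← exp_add, ← exp_add]; refine exp_le_exp.2 ?_
        have : δ * n *1 ≤ δ * n * g := by gcongr
        linarith
      _ ≤ _ := by gcongr
  set h' := ⌈(1 + δ) * v⌉₊
  have hh1' : (1 + δ) * v ≤ h' := Nat.le_ceil _
  have hh2' : (h':ℝ) < (1 + δ) * v +1 := Nat.ceil_lt_add_one (by positivity)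
  have hh3' : (h':ℝ) ≤1.4 * v := by linarith only [mul_le_mul_of_nonneg_right hδ1 hv0,hh2',hv20]
  have hph' : ¬ p h' := by
    have a1 := h2 h' (by nlinarith only [hh1',hvl,hv0,hn0,mul_nonneg hδ.le hv0]) (by
      have c1 : (h':ℝ) ^2 ≤ (1.4 * v) ^2 := by gcongr
      have : n * L ≤ n * L ^2 := by rw [sq]; exact mul_le_mul_of_nonneg_left (by nlinarith only [h3,hb]) (by positivity)
      linarith only [this,c1,hvu,mul_nonneg (Nat.cast_nonneg n : (0:ℝ) ≤ n) hL0.le])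
    have a2 : q b (n ^2) h' ≤ exp (-((g * n))) := by
      refine a1.trans (exp_le_exp.2 ?_)
      have c1 : 4 * π * b * ((1 + δ) * v) ^2 / L ≤4 * π * b * (h':ℝ) ^2 / L := by gcongr
      rw [hqY] at c1
      have c2 : 1 ≤ (1 - δ) * (1 + δ) ^2 := by
        have : (1 - δ) * (1 + δ) ^2 -1 = δ * (1 - δ - δ ^2) := by ring
        have : 0 ≤ δ * (1 - δ - δ ^2) := mul_nonneg hδ.le (by nlinarith only [hδ,hδ1])
        linarith
      have c3 : 1 * ((g:ℝ) * n) ≤ (1 - δ) * (1 + δ) ^2 * (g * n) := by gcongr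
      have c4 := mul_le_mul_of_nonneg_left c1 (show 0 ≤1 - δ by linarith)
      linarith
    show ¬ _ ≤ _
    rw [not_le]
    calc _ ≤ exp n ^ g * exp (-((g * n))) := by gcongr; exact q_nn _ _
      _ =1 := by rw [← exp_nat_mul, ← exp_add]; simp
      _ < _ := one_lt_pow₀ (by linarith) (by norm_num)
  have hvn : 8 * v ≤ n := by
    have : v ^2 ≤ (n /8 : ℝ) ^2 := by nlinarith only [hvu,h4,hn0]
    have := (pow_le_pow_iff_left₀ hv0 (by positivity) (by norm_num)).1 this
    linarith
  have hhh : h ≤ n := by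
    have : (h:ℝ) ≤ n := by linarith only [hh1,hvn,hv0,mul_nonneg hδ.le hv0]
    exact_mod_cast this
  have hanti : ∀ i j : ℕ, i ≤ j → p j → p i := fun i j hij hj => by
    refine le_trans hj ?_
    have := q_anti (b := b) (by linarith) (n ^2) (show (i:ℤ) ≤ j by exact_mod_cast hij)
    gcongr
  have hK : KK b g n x = Nat.findGreatest p n := rfl
  rw [hK]
  have k1 : h ≤ Nat.findGreatest p n := Nat.le_findGreatest hhh hph
  have k2 : p (Nat.findGreatest p n) := Nat.findGreatest_spec hhh hph
  have k3 : Nat.findGreatest p n < h' := by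
    by_contra hc; exact hph' (hanti _ _ (not_lt.1 hc) k2)
  have k4 : 4 * h' ≤ n := by
    have : 4 * (h':ℝ) ≤ n := by linarith
    exact_mod_cast this
  have k1r : (h:ℝ) ≤ Nat.findGreatest p n := by exact_mod_cast k1
  have k3r : (Nat.findGreatest p n : ℝ) ≤ h' := by exact_mod_cast k3.le
  refine ⟨by linarith, by linarith, k2, ?_, ?_, by omega⟩
  · have := Nat.findGreatest_is_greatest (P := p) (n := n) (k := Nat.findGreatest p n +1) (by omega) (by omega)
    have := (not_le.1 this).le; push_cast at this; exact this
  · exact hhn.trans (by gcongr)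

def RR (L l : ℕ) : Finset Site := Finset.Icc (1 - l : ℤ) (L + l) ×ˢ Finset.Icc (1 - l : ℤ) (L + l)
lemma RR_card (L l : ℕ) : (RR L l).card = (L +2 * l) ^2 := by
  simp only [RR, Finset.card_product, Int.card_Icc]; rw [sq]; congr 1 <;> omega
lemma RR_UB (hb : 20 ≤ b) {L l : ℕ} (he : eps (RR L l) l ≤1) {j : ℤ} (hj : 1 ≤ j) :
    ∀ V ⊆ box L, ∀ y ∈ V, UB b V y j (q b l j + eps (RR L l) l) := fun V hV y hy => by
  have h2 : ∀ z ∈ box L, z ∈ RR L l := fun z => by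
    simp only [RR, box, mem_product, Finset.mem_Icc]; omega
  refine Bq hb ⟨_, _, _, _, rfl⟩ (fun z => ?_) he hj (fun z hz => h2 z (hV hz)) hy
  have := hV hy; revert this
  simp only [RR, box, Bx, mem_product, Finset.mem_Icc]; omega
lemma sm {a N : ℝ} (hN : 10 ≤ N) (h0 : 0 ≤ a) (h : a * N ^40 ≤2) : a * N ^5 ≤1 /1000 := by
  have h1 : (2000:ℝ) ≤ N ^35 := le_trans (by norm_num) (pow_le_pow_left₀ (by norm_num) hN 35)
  have h2 : a * N ^5 *2000 ≤ a * N ^5 * N ^35 := by gcongr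
  rw [show a * N ^5 * N ^35 = a * N ^40 by ring] at h2; linarith
lemma exi {y : ℝ} (hy : 0 < y) : exp (-y) ≤1 / y := by
  rw [exp_neg, ← one_div]; exact one_div_le_one_div_of_le hy (by linarith [add_one_le_exp y])
lemma powexp {q : ℝ} (h : q ≤1) (h0 : 0 ≤ q) (m : ℕ) : (1 - q /2) ^ m ≤ exp (-(m * q /2)) := by
  calc _ ≤ exp (-(q /2)) ^ m := by gcongr; linarith; exact Real.one_sub_le_exp_neg _
    _ = _ := by rw [← exp_nat_mul]; congr 1; ring
/-- arithmetic of the low term -/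
lemma lowA {b N X m qH qk t : ℝ} (hb : 20 ≤ b) (hN : 10 ≤ N) (hNb : 800 * (12 * b +100) ≤ N) (hX : 1 ≤ X) (hm : X ^2 ≤400 * N ^4 * m) (h1 : N ^20 ≤ X * qH)
    (h2 : N ^20 ≤ X ^2 * qk) (hH : 0 ≤ qH) (hk : 0 ≤ qk) (ht : t =32 * N * X) :
    3 * exp (b * (4 * X * (2 * N +1)) - b /2 * t) + (exp (-(m * qH /2)) * (2 * exp (b * (4 * X * (2 * N +1)))) + exp (-(m * qk /2))) ≤6 * (1 / (80 * N)) := by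
  have e0 : b * (4 * X * (2 * N +1)) ≤ b * (12 * N * X) := by
    have : X *1 ≤ X * N := by gcongr; linarith
    exact mul_le_mul_of_nonneg_left (by linarith) (by linarith)
  have g0 : 20 * N *1 ≤ b * N * X := by gcongr
  have p4 : 0 < N ^4 := by positivity
  have p16 : 800 * (12 * b +100) * N ≤ N ^16 := by
    have : (1:ℝ) ≤ N ^14 := one_le_pow₀ (by linarith)
    calc _ ≤ N * N := by gcongr
      _ = N * N *1 := by ring
      _ ≤ N * N * N ^14 := by gcongr
      _ = _ := by ring
  have hk' : N ^16 ≤400 * (m * qk) := by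
    have c1 : X ^2 * qk ≤400 * N ^4 * m * qk := by gcongr
    have : N ^4 * N ^16 ≤ N ^4 * (400 * (m * qk)) := by rw [← pow_add]; norm_num; linarith
    exact le_of_mul_le_mul_left this p4
  have hH' : N ^16 * X ≤400 * (m * qH) := by
    have c1 : X ^2 * qH ≤400 * N ^4 * m * qH := by gcongr
    have c2 : X * N ^20 ≤ X * (X * qH) := by gcongr
    have : N ^4 * (N ^16 * X) ≤ N ^4 * (400 * (m * qH)) := by
      rw [show N ^4 * (N ^16 * X) = X * N ^20 by ring]; linarith
    exact le_of_mul_le_mul_left this p4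
  have E : ∀ y : ℝ, 80 * N ≤ y → exp (-y) ≤1 / (80 * N) := fun y hy =>
    (exi (by linarith)).trans (one_div_le_one_div_of_le (by linarith) hy)
  have t1 : exp (b * (4 * X * (2 * N +1)) - b /2 * t) ≤1 / (80 * N) := by
    refine le_trans (exp_le_exp.2 ?_) (E (4 * (b * N * X)) (by linarith))
    rw [ht]; linarith
  have t2 : exp (-(m * qH /2)) * exp (b * (4 * X * (2 * N +1))) ≤1 / (80 * N) := by
    rw [← exp_add]
    refine le_trans (exp_le_exp.2 ?_) (E (80 * N) le_rfl)
    have c1 : 800 * (12 * b +100) * N * X ≤ N ^16 * X := by gcongr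
    have c2 : N *1 ≤ N * X := by gcongr
    linarith
  have t3 : exp (-(m * qk /2)) ≤1 / (80 * N) := by
    refine E _ ?_
    have : 0 ≤ b * N := by positivity
    linarith
  linarith
lemma MMa {n L : ℕ} (hn : 10 ≤ n) (hX : 10000 * (n:ℝ) ^5 ≤ L) :
    2 * (L ^2 / (200 * n ^4)) +32 * n * L ≤ (L / (4 * n ^2 +2)) ^2 ∧ (L:ℝ) ^2 ≤400 * (n:ℝ) ^4 * ((L ^2 / (200 * n ^4) : ℕ) : ℝ) := by
  have hN : (10:ℝ) ≤ n := by exact_mod_cast hn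
  set N := (n:ℝ) with hNd
  set X := (L:ℝ) with hXd
  have p0 : 0 < N := by linarith
  have p5 : N ^4 ≤ N ^5 := pow_le_pow_right₀ (by linarith) (by norm_num)
  have p2 : N ^2 ≤ N ^5 := pow_le_pow_right₀ (by linarith) (by norm_num)
  have p21 : 100 ≤ N ^2 := by nlinarith
  have p41 : 0 < N ^4 := by positivity
  have m1 : ((L ^2 / (200 * n ^4) : ℕ) : ℝ) ≤ X ^2 / (200 * N ^4) := by
    have := @Nat.cast_div_le ℝ _ _ _ (L ^2) (200 * n ^4); push_cast at this; exact this
  have m2 : X ^2 / (200 * N ^4) -1 < ((L ^2 / (200 * n ^4) : ℕ) : ℝ) := by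
    have := Nat.lt_div_mul_add (a := L ^2) (b := 200 * n ^4) (by positivity)
    have : ((L ^2 : ℕ):ℝ) < ((L ^2 / (200 * n ^4) * (200 * n ^4) +200 * n ^4 : ℕ) : ℝ) := by exact_mod_cast this
    rw [sub_lt_iff_lt_add, div_lt_iff₀ (by positivity)]; push_cast at this ⊢; linarith
  have m3 : X / (8 * N ^2) ≤ ((L / (4 * n ^2 +2) : ℕ) : ℝ) := by
    have := Nat.lt_div_mul_add (a := L) (b := 4 * n ^2 +2) (by positivity)
    have : (L:ℝ) < ((L / (4 * n ^2 +2) * (4 * n ^2 +2) + (4 * n ^2 +2) : ℕ) : ℝ) := by exact_mod_cast this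
    push_cast at this
    have h0 : (0:ℝ) ≤ ((L / (4 * n ^2 +2) : ℕ) : ℝ) := Nat.cast_nonneg _
    rw [div_le_iff₀ (by positivity)]; push_cast
    set y := ((L / (4 * n ^2 +2) : ℕ) : ℝ)
    have : y * (4 * N ^2 +2) ≤ y * (5 * N ^2) := by gcongr; linarith
    linarith
  have c1 : X ^2 = X ^2 / (200 * N ^4) * (200 * N ^4) := by field_simp
  have c2 : 10000 * N ^5 * X ≤ X * X := by gcongr
  have c3 : 400 * N ^4 ≤ X ^2 := by nlinarith
  set w := X ^2 / (200 * N ^4)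
  have hw : 2 ≤ w := by
    have : 2 * (200 * N ^4) ≤ w * (200 * N ^4) := by linarith
    exact le_of_mul_le_mul_right this (by positivity)
  constructor
  · have : (2 * ((L ^2 / (200 * n ^4) : ℕ) : ℝ) +32 * n * L) ≤ ((L / (4 * n ^2 +2) : ℕ) : ℝ) ^2 := by
      have d1 : (X / (8 * N ^2)) ^2 ≤ ((L / (4 * n ^2 +2) : ℕ) : ℝ) ^2 := by gcongr
      have d2 : (X / (8 * N ^2)) ^2 =200 /64 * w := by
        rw [div_pow, c1]; field_simp; ring
      have d3 : 32 * N * X ≤ w := by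
        have : 32 * N * X * (200 * N ^4) ≤ w * (200 * N ^4) := by
          rw [← c1, show 32 * N * X * (200 * N ^4) =6400 * N ^5 * X by ring]
          have : 0 ≤ N ^5 * X := by positivity
          nlinarith
        exact le_of_mul_le_mul_right this (by positivity)
      rw [d2] at d1; linarith
    exact_mod_cast this
  · have : 400 * N ^4 * (w /2) ≤400 * N ^4 * ((L ^2 / (200 * n ^4) : ℕ) : ℝ) := by gcongr; linarith
    linarith

set_option maxHeartbeats 1000000 in
lemma mainE (hb : 20 ≤ b) : ∀ᶠ n : ℕ in atTop, ∀ L : ℕ, exp (n -1) ≤ L → (L:ℝ) ≤ exp n →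
    S b (box L) 0 (ii (FV (box L) 0 ∩ {η | ∃ x ∈ box L, ((KK b 1 n L + KK b 2 n L : ℕ) : ℤ) +3 ≤ η x})) ≤ ofReal (1 / n) * S b (box L) 0 (ii (FV (box L) 0)) ∧
    S b (box L) 0 (ii {η | η ∈ FV (box L) 0 ∧ ∀ x ∈ box L, η x < ((KK b 1 n L + KK b 2 n L : ℕ) : ℤ)}) ≤ ofReal (1 / n) * S b (box L) 0 (ii (FV (box L) 0)) := by
  filter_upwards [KKa hb (δ := 1 /3) (by norm_num) le_rfl (g := 1) le_rfl (by norm_num), KKa hb (δ := 1 /3) (by norm_num) le_rfl (g := 2) (by norm_num) le_rfl,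
    Rto hb, ev_pow 72 60 one_pos, ev_pow (10000 * exp 1) 5 one_pos, eventually_ge_atTop 10,
    tendsto_natCast_atTop_atTop.eventually (eventually_ge_atTop (800 * (12 * b +100)))] with n hK1 hK2 hR hp1 hp2 hn hNb L hL1 hL2
  obtain ⟨-, -, u1, u2, u3, u4⟩ := hK1 L hL1 hL2
  obtain ⟨-, -, v1, v2, v3, v4⟩ := hK2 L hL1 hL2
  set H := KK b 1 n L
  set k := KK b 2 n L
  have hN : (10:ℝ) ≤ n := by exact_mod_cast hn
  have u5 := hR H u3
  have v5 := hR k v3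
  have u6 := hR (H +1) (u3.trans (pow_le_pow_left₀ (Nat.cast_nonneg _) (by push_cast; linarith) 2))
  have v6 := hR (k +1) (v3.trans (pow_le_pow_left₀ (Nat.cast_nonneg _) (by push_cast; linarith) 2))
  push_cast at u6 v6
  clear hK1 hK2 hR
  have hX : 10000 * (n:ℝ) ^5 ≤ L := by
    refine le_trans ?_ hL1
    rw [Real.exp_sub, le_div_iff₀ (exp_pos _)]; rw [one_mul] at hp2; linarith
  rw [one_mul] at hp1
  have hE : eps (RR L (n ^2)) (n ^2) * (L:ℝ) ^2 * (n:ℝ) ^60 ≤1 := by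
    unfold eps; rw [RR_card]; push_cast
    have a1 : (L +2 * (n:ℝ) ^2) ^2 ≤9 * (L:ℝ) ^2 := by
      have : (n:ℝ) ^2 ≤ (n:ℝ) ^5 := pow_le_pow_right₀ (by linarith) (by norm_num)
      have p : 0 ≤ (n:ℝ) ^5 := by positivity
      calc _ ≤ (3 * (L:ℝ)) ^2 := by gcongr; linarith
        _ = _ := by ring
    calc _ ≤8 * (9 * exp n ^2) * exp (-4 * n ^2) * exp n ^2 * (n:ℝ) ^60 := by
          gcongr; exact a1.trans (by gcongr)
      _ =72 * (n:ℝ) ^60 * (exp n ^2 * exp n ^2 * exp (-4 * n ^2)) := by ring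
      _ ≤ exp n * (exp n ^2 * exp n ^2 * exp (-4 * n ^2)) := by gcongr
      _ ≤1 := by
        rw [← exp_nat_mul, ← exp_add, ← exp_add, ← exp_add]
        refine Real.exp_le_one_iff.2 ?_
        push_cast; nlinarith only [hN]
  have hE0 := eps_nn (RR L (n ^2)) (n ^2)
  have hEb : eps (box L) (n ^2) ≤ eps (RR L (n ^2)) (n ^2) := by
    unfold eps; rw [RR_card, box_card]; gcongr; omega
  set E := eps (RR L (n ^2)) (n ^2)
  have hX0 : (1:ℝ) ≤ L := by
    have : (1:ℝ) ≤ (n:ℝ) ^5 := one_le_pow₀ (by linarith)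
    linarith
  have hm := MMa hn hX
  have q0 := q_nn (b := b) (n ^2)
  have hN60 : (1:ℝ) ≤ (n:ℝ) ^60 := one_le_pow₀ (by linarith)
  have hN40 : (1:ℝ) ≤ (n:ℝ) ^40 := one_le_pow₀ (by linarith)
  have hN40' : (n:ℝ) ^40 ≤ (n:ℝ) ^60 := pow_le_pow_right₀ (by linarith) (by norm_num)
  have hX2 : (L:ℝ) ≤ (L:ℝ) ^2 := by nlinarith only [hX0]
  have hE2 : (L:ℝ) ^2 * E * (n:ℝ) ^40 ≤1 := by
    rw [mul_comm _ E]; exact le_trans (by gcongr) hE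
  have hE1 : (L:ℝ) * E * (n:ℝ) ^40 ≤1 := le_trans (by gcongr) hE2
  have hE3 : E * (n:ℝ) ^40 ≤1 := by
    refine le_trans ?_ hE1
    rw [mul_assoc]; exact le_mul_of_one_le_left (by positivity) hX0
  have hEl : E ≤1 := le_trans (le_mul_of_one_le_right hE0 hN40) hE3
  set Q1 := q b (n ^2) (H +1 +1) + E with hQ1
  set Q2 := q b (n ^2) (k +1 +1) + E with hQ2
  have hP20 : (0:ℝ) < (n:ℝ) ^20 := by positivity
  have aux : ∀ {X q1 q2 : ℝ}, 0 ≤ X → X * q1 ≤ (n:ℝ) ^20 → (n:ℝ) ^60 * q2 ≤ q1 → X * q2 * (n:ℝ) ^40 ≤1 := fun {X q1 q2} h0 h1 h2 => by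
    have : X * ((n:ℝ) ^60 * q2) ≤ X * q1 := by gcongr
    refine le_of_mul_le_mul_right (a := (n:ℝ) ^20) ?_ hP20
    rw [show X * q2 * (n:ℝ) ^40 * (n:ℝ) ^20 = X * ((n:ℝ) ^60 * q2) by ring]; linarith
  have r1 : (L:ℝ) * Q1 * (n:ℝ) ^40 ≤2 := by
    rw [pow_one] at u2
    have := aux (by linarith) u2 u6
    rw [hQ1, mul_add, add_mul]; linarith
  have r2 : (L:ℝ) ^2 * Q2 * (n:ℝ) ^40 ≤2 := by
    have := aux (by positivity) v2 v6
    rw [hQ2, mul_add, add_mul]; linarith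
  have hQ10 : 0 ≤ Q1 := add_nonneg (q0 _) hE0
  have hQ20 : 0 ≤ Q2 := add_nonneg (q0 _) hE0
  have s1 := sm hN (by positivity) r1
  have s2 := sm hN (by positivity) r2
  have s3 := sm hN hE0 (hE3.trans one_le_two)
  have hp5 : (n:ℝ) ^4 *10 ≤ (n:ℝ) ^5 := by rw [pow_succ (n:ℝ) 4]; gcongr
  have hp4 : (1:ℝ) ≤ (n:ℝ) ^4 := one_le_pow₀ (by linarith)
  have hp5n : (n:ℝ) ≤ (n:ℝ) ^5 := le_self_pow₀ (by linarith) (by norm_num)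
  have hN0 : (0:ℝ) < n := by linarith
  have w2 : (L:ℝ) ^2 * Q2 ≤1 /1000 * (1 / n) := by
    rw [mul_one_div, le_div_iff₀ hN0]; exact le_trans (by gcongr) s2
  have w3 : E ≤1 /1000 * (1 / n) := by
    rw [mul_one_div, le_div_iff₀ hN0]; exact le_trans (by gcongr) s3
  have w1 : (L:ℝ) * Q1 ≤1 /1000 := le_trans (le_mul_of_one_le_right (by positivity) (by linarith)) s1
  have w1' : Q1 ≤ (L:ℝ) * Q1 := le_mul_of_one_le_left hQ10 hX0
  have w14 : (n:ℝ) ^4 * Q1 ≤1 /1000 := by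
    refine le_trans ?_ s1
    calc (n:ℝ) ^4 * Q1 ≤ (n:ℝ) ^5 * (L * Q1) := mul_le_mul (by linarith) w1' hQ10 (by positivity)
      _ = _ := by ring
  have n2 : (1:ℝ) ≤ (n:ℝ) ^2 := one_le_pow₀ (by linarith)
  set θ := (L:ℝ) ^2 * (2 * Q2) + eps (box L) (n ^2) with hθd
  have hi : 1 / (n:ℝ) ≤1 := by rw [div_le_one hN0]; linarith
  have hθ : θ ≤3 /1000 * (1 / n) := by linarith
  have hUp := up hb (L := L) (l := n ^2) (c := H +1) (j := k +1 +1) (by omega) (by omega) hQ10 hQ20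
    (RR_UB hb hEl (by omega)) (RR_UB hb hEl (by omega)) (by linarith) (by
      push_cast
      have : (2 * (n:ℝ) ^2 +1) ^2 ≤9 * (n:ℝ) ^4 := by
        calc _ ≤ (3 * (n:ℝ) ^2) ^2 := by gcongr; linarith
          _ = _ := by ring
      calc _ ≤2 * (9 * (n:ℝ) ^4) * Q1 := by gcongr
        _ ≤ _ := by linarith) (by linarith) (hEb.trans hEl)
  have hUp2 : ∀ a : ℤ, a ≤0 → ∀ j : ℤ, (H:ℤ) + k +3 ≤ j → S b (box L) 0 (ii (FV (box L) a ∩ {η | ∃ x ∈ box L, j ≤ η x})) ≤ ofReal θ * S b (box L) 0 (ii (FV (box L) a)) := fun a ha j hj =>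
    le_trans (S_ii_mono (B := FV (box L) a ∩ {η | ∃ x ∈ box L, (k:ℤ) +1 +1 + (H +1) ≤ η x}) fun η _ h => ⟨h.1, by obtain ⟨x, hx, h2⟩ := h.2; exact ⟨x, hx, by show (k:ℤ) +1 +1 + (H +1) ≤ _; have : j ≤ η x := h2; omega⟩⟩)
      (up2 (by linarith) (by omega) ha hUp)
  constructor
  · refine (hUp2 0 le_rfl _ (by push_cast; linarith)).trans (mul_le_mul_left (ofReal_le_ofReal ?_) _)
    have : 0 ≤1 / (n:ℝ) := by positivity
    linarith
  have hθ0 : 0 ≤ θ := by have := eps_nn (box L) (n ^2); positivity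
  have hqH1 := q_one (b := b) (by linarith) (n ^2) H
  have hqk1 := q_one (b := b) (by linarith) (n ^2) k
  rw [pow_one] at u1
  have hQH : (q b (n ^2) (H +1) + E) * (n:ℝ) ^60 ≤2 * q b (n ^2) H := by
    have c1 : (L:ℝ) * (E * (n:ℝ) ^60) ≤ L * q b (n ^2) H := by
      have : (1:ℝ) ≤ (n:ℝ) ^20 := one_le_pow₀ (by linarith)
      refine le_trans (le_trans ?_ hE) (this.trans u1)
      calc _ = L * E * (n:ℝ) ^60 := by ring
        _ ≤ E * (L:ℝ) ^2 * (n:ℝ) ^60 := by rw [mul_comm _ E]; gcongr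
    have c2 := le_of_mul_le_mul_left c1 (by linarith)
    rw [add_mul]; linarith
  have hQH0 : 0 ≤ q b (n ^2) (H +1) + E := add_nonneg (q0 _) hE0
  have hLow := low hb (L := L) (l := n ^2) (M := L / (4 * n ^2 +2)) (n := n) (t := 32 * n * L) (m := L ^2 / (200 * n ^4)) (H := H) (k := k)
    (by have : 0 < H := by
          by_contra hc
          have : H =0 := by omega
          rw [this] at u3; norm_num at u3; linarith
        omega) (by have : 0 < k := by
                     by_contra hc
                     have : k =0 := by omega
                     rw [this] at v3; norm_num at v3; linarith
                   omega) (Nat.one_le_pow _ _ (by omega)) (hEb.trans hEl) (Nat.div_mul_le_self _ _) hm.1 (θ := θ)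
    hQH0 (RR_UB hb hEl (by omega)) (by
      push_cast
      have c0 : (4 * (n:ℝ) ^2 +1) ^2 ≤25 * (n:ℝ) ^4 := by
        calc _ ≤ (5 * (n:ℝ) ^2) ^2 := by gcongr; linarith
          _ = _ := by ring
      have c1 : (100:ℝ) ≤ (n:ℝ) ^56 := le_trans (by norm_num) (pow_le_pow_left₀ (by norm_num) hN 56)
      have c2 : (q b (n ^2) (H +1) + E) * ((n:ℝ) ^4 *100) ≤ (q b (n ^2) (H +1) + E) * ((n:ℝ) ^4 * (n:ℝ) ^56) := by gcongr
      rw [← pow_add] at c2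
      calc _ ≤25 * (n:ℝ) ^4 * (q b (n ^2) (H +1) + E) := by gcongr
        _ ≤ _ := by norm_num at c2; linarith) hθ0 (by linarith) (fun a _ ha => hUp2 a ha _ (by omega))
  rw [Nat.cast_add]
  refine hLow.trans (mul_le_mul_left (ofReal_le_ofReal ?_) _)
  have hA := lowA hb hN hNb hX0 hm.2 u1 v1 (q0 _) (q0 _) (t := ((32 * n * L : ℕ) : ℝ)) (by push_cast; ring)
  have e1 := powexp hqH1 (q0 _) (L ^2 / (200 * n ^4))
  have e2 := powexp hqk1 (q0 _) (L ^2 / (200 * n ^4))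
  have e3 : (1 - q b (n ^2) H /2) ^ (L ^2 / (200 * n ^4)) * (2 * exp (b * (4 * L * (2 * n +1)))) ≤
    exp (-(((L ^2 / (200 * n ^4) : ℕ) : ℝ) * q b (n ^2) H /2)) * (2 * exp (b * (4 * L * (2 * n +1)))) := by gcongr
  have e4 : 1 / (80 * (n:ℝ)) =1 /80 * (1 / n) := by field_simp
  rw [e4] at hA
  have : 0 ≤1 / (n:ℝ) := by positivity
  linarith

def nL (L : ℕ) : ℕ := ⌈log L⌉₊
lemma tlog : Tendsto (fun L : ℕ => log L) atTop atTop := Real.tendsto_log_atTop.comp tendsto_natCast_atTop_atTop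
lemma tnL : Tendsto nL atTop atTop := (tendsto_nat_ceil_atTop (α := ℝ)).comp tlog
lemma nL_b {L : ℕ} (h : 1 ≤ L) : exp (nL L -1) ≤ L ∧ (L:ℝ) ≤ exp (nL L) := by
  have hL : (0:ℝ) < L := by exact_mod_cast h
  have h1 := Nat.ceil_lt_add_one (log_natCast_nonneg L)
  have h2 := Nat.le_ceil (log L)
  rw [← Real.le_log_iff_exp_le hL, ← Real.log_le_iff_le_exp hL]
  exact ⟨by unfold nL; linarith, h2⟩
def MM (b : ℝ) (L : ℕ) : ℕ := KK b 1 (nL L) L + KK b 2 (nL L) L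
lemma asy1 : Tendsto (fun x : ℝ => sqrt (⌈x⌉₊ * log ⌈x⌉₊) / sqrt (x * log x)) atTop (𝓝 1) := by
  have h1 : Tendsto (fun x : ℝ => (⌈x⌉₊ : ℝ) / x) atTop (𝓝 1) := tendsto_nat_ceil_div_atTop
  have h2 : Tendsto (fun x : ℝ => log ((⌈x⌉₊ : ℝ) / x) / log x) atTop (𝓝 0) :=
    ((Real.continuousAt_log one_ne_zero).tendsto.comp h1).div_atTop Real.tendsto_log_atTop
  have h3 : Tendsto (fun x : ℝ => (⌈x⌉₊ : ℝ) / x * (1 + log ((⌈x⌉₊ : ℝ) / x) / log x)) atTop (𝓝 (1 * (1 +0))) :=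
    h1.mul (tendsto_const_nhds.add h2)
  have h4 := (Real.continuous_sqrt.tendsto _).comp h3
  norm_num at h4
  refine h4.congr' ?_
  filter_upwards [eventually_gt_atTop 1] with x hx
  have hx0 : 0 < x := by linarith
  have hl := Real.log_pos hx
  have hc : (0:ℝ) < ⌈x⌉₊ := hx0.trans_le (Nat.le_ceil x)
  rw [← Real.sqrt_div' _ (by positivity)]
  show sqrt ((⌈x⌉₊ : ℝ) / x * (1 + log ((⌈x⌉₊ : ℝ) / x) / log x)) = _
  rw [Real.log_div hc.ne' hx0.ne']; congr 1; field_simp; ring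
lemma asy2 (hb : 20 ≤ b) : Tendsto (fun L : ℕ => (MM b L : ℝ) / ((1 + sqrt 2) * sqrt (nL L * log (nL L) / (4 * π * b)))) atTop (𝓝 1) := by
  have hpi := Real.pi_pos
  have hw : Tendsto (fun n : ℕ => sqrt (n * log n / (4 * π * b))) atTop atTop :=
    Real.tendsto_sqrt_atTop.comp ((Tendsto.atTop_mul_atTop₀ tendsto_natCast_atTop_atTop tlog).atTop_div_const (by positivity))
  rw [Metric.tendsto_nhds]
  intro ε hε
  set δ := min (ε /2) (1 /3)
  have hδ : 0 < δ := by positivity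
  have hδ1 : δ ≤1 /3 := min_le_right _ _
  have hδ2 : δ ≤ ε /2 := min_le_left _ _
  filter_upwards [tnL.eventually (KKa hb hδ hδ1 (g := 1) le_rfl (by norm_num)), tnL.eventually (KKa hb hδ hδ1 (g := 2) (by norm_num) le_rfl),
    tnL.eventually (hw.eventually (eventually_gt_atTop (4 / ε))), eventually_ge_atTop 1] with L h1 h2 h3 h4
  obtain ⟨a1, a2, -⟩ := h1 L (nL_b h4).1 (nL_b h4).2
  obtain ⟨c1, c2, -⟩ := h2 L (nL_b h4).1 (nL_b h4).2
  have e2 : ∀ y : ℝ, sqrt ((2:ℕ) * nL L * y / (4 * π * b)) = sqrt 2 * sqrt (nL L * y / (4 * π * b)) := fun y => by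
    rw [← Real.sqrt_mul (by norm_num)]; congr 1; push_cast; ring
  rw [e2] at c1 c2
  rw [Nat.cast_one, one_mul] at a1 a2
  set w := sqrt (nL L * log (nL L) / (4 * π * b))
  have hs := Real.sqrt_nonneg 2
  have hw0 : 0 < w := lt_trans (by positivity) h3
  have hs1 : 0 < (1 + sqrt 2) * w := by positivity
  have h3' : 4 < ε * w := by rwa [div_lt_iff₀' hε] at h3
  have h5 : ε * w ≤ ε * ((1 + sqrt 2) * w) := by
    rw [add_mul, one_mul]; gcongr; have := mul_nonneg hs hw0.le; linarith
  have h6 : δ * ((1 + sqrt 2) * w) ≤ ε /2 * ((1 + sqrt 2) * w) := by gcongr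
  rw [Real.dist_eq, div_sub_one hs1.ne', abs_div, abs_of_pos hs1, div_lt_iff₀ hs1, abs_lt]
  unfold MM; push_cast
  constructor <;> linarith
lemma asy (hb : 20 ≤ b) : Tendsto (fun L : ℕ => ((max 1 (MM b L) : ℕ) : ℝ) / (((1 + sqrt 2) / (2 * sqrt (π * b))) *
    sqrt (log L * log (log L)))) atTop (𝓝 1) := by
  have hpi := Real.pi_pos
  have h := (asy2 hb).mul (asy1.comp tlog)
  rw [mul_one] at h
  refine h.congr' ?_
  have hm : ∀ᶠ L in atTop, (0:ℝ) < (MM b L : ℝ) / ((1 + sqrt 2) * sqrt (nL L * log (nL L) / (4 * π * b))) :=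
    (asy2 hb).eventually (eventually_gt_nhds one_pos)
  filter_upwards [hm, tnL.eventually (eventually_gt_atTop 1)] with L hL h2
  have h1 : 1 ≤ MM b L := by
    by_contra hc
    have : MM b L =0 := by omega
    rw [this] at hL; norm_num at hL
  rw [max_eq_right h1]
  have e : sqrt (nL L * log (nL L) / (4 * π * b)) = sqrt (nL L * log (nL L)) / (2 * sqrt (π * b)) := by
    rw [Real.sqrt_div' _ (by positivity), mul_assoc, Real.sqrt_mul (show (0:ℝ) ≤4 by norm_num), show (4:ℝ) =2 ^2 by norm_num, Real.sqrt_sq (by norm_num)]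
  have hp : 0 < sqrt (nL L * log (nL L)) := by
    have : (1:ℝ) < nL L := by exact_mod_cast h2
    have := Real.log_pos this
    positivity
  rw [e]
  show _ * (sqrt (nL L * log (nL L)) / _) = _
  set s := sqrt (nL L * log (nL L))
  have := Real.sqrt_nonneg 2
  have hpb : 0 < sqrt (π * b) := Real.sqrt_pos.2 (by positivity)
  field_simp

def ph (p : Edge × Bool) : Site × Site := if p.2 then (p.1.1, tg p.1) else (tg p.1, p.1.1)
lemma ph_inj : Function.Injective ph := by
  rintro ⟨⟨⟨a, c⟩, d⟩, e⟩ ⟨⟨⟨a', c'⟩, d'⟩, e'⟩ h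
  cases d <;> cases e <;> cases d' <;> cases e' <;> simp [ph, tg] at h ⊢ <;> omega
lemma ph_range {p : Site × Site} (h : adjP p.1 p.2) : p ∈ Set.range ph := by
  obtain ⟨⟨a, c⟩, ⟨a', c'⟩⟩ := p
  simp only [adjP] at h
  have : (a' = a +1 ∧ c' = c) ∨ (a' = a ∧ c' = c +1) ∨ (a = a' +1 ∧ c = c') ∨ (a = a' ∧ c = c' +1) := by
    rcases abs_cases (a - a') with h1 | h1 <;> rcases abs_cases (c - c') with h2 | h2 <;> omega
  rcases this with ⟨rfl, rfl⟩ | ⟨rfl, rfl⟩ | ⟨rfl, rfl⟩ | ⟨rfl, rfl⟩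
  · exact ⟨(((a, c'), true), true), by simp [ph, tg]⟩
  · exact ⟨(((a', c), false), true), by simp [ph, tg]⟩
  · exact ⟨(((a', c), true), false), by simp [ph, tg]⟩
  · exact ⟨(((a, c'), false), false), by simp [ph, tg]⟩
lemma ph_adj (p : Edge × Bool) : adjP (ph p).1 (ph p).2 := by
  obtain ⟨⟨⟨a, c⟩, d⟩, e⟩ := p
  cases d <;> cases e <;> simp [ph, tg, adjP]
lemma dgH_en (h : ∀ x ∉ W, η x =0) : dgH η = en (ed W) η := by
  unfold dgH
  rw [← ph_inj.tsum_eq (by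
    intro p hp
    by_contra hc
    exact hp (if_neg fun h' => hc (ph_range h')))]
  have h1 : ∀ p : Edge × Bool, (if adjP (ph p).1 (ph p).2 then ((η (ph p).1 - η (ph p).2 : ℤ) : ℝ) ^2 else 0) = (gr η p.1 : ℝ) ^2 := fun p => by
    rw [if_pos (ph_adj p)]
    obtain ⟨e, d⟩ := p
    cases d <;> simp [ph, gr]; ring
  simp only [h1]
  rw [tsum_eq_sum (s := ed W ×ˢ Finset.univ), sum_product]
  · simp [en, ← Finset.mul_sum]
  · intro p hp
    have : p.1 ∉ ed W := fun h' => hp (by simp [h'])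
    rw [mem_ed, not_or] at this
    simp [gr, h _ this.1, h _ this.2]
lemma dgW_S (A : Om → Prop) : dgW b W A = (S b W 0 (ii {η | A η})).toReal := by
  unfold S dgW
  rw [ENNReal.tsum_toReal_eq]
  · refine tsum_congr fun η => ?_
    by_cases h : ∀ x ∉ W, η x =0
    · rw [if_pos (c := ∀ x ∉ W, η x = (0 : Om) x) h]
      by_cases hA : A η
      · rw [if_pos ⟨h, hA⟩, dgH_en h]; simp [ii, hA, wt, Real.exp_nonneg]
      · rw [if_neg fun h' => hA h'.2]; simp [ii, hA]
    · rw [if_neg fun h' => h h'.1, if_neg (c := ∀ x ∉ W, η x = (0 : Om) x) h]; simp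
  · intro η
    by_cases hA : A η <;> split_ifs <;> simp [ii, hA, wt]
lemma prob (hb : 20 ≤ b) : ∀ᶠ L : ℕ in atTop, 1 -2 * (1 / (nL L : ℝ)) ≤ dgProbFloor b (box L) (fun η =>
            (∀ x ∈ box L, η x ≤ ((max 1 (MM b L) : ℕ) : ℤ) +2) ∧ ∃ x ∈ box L, ((max 1 (MM b L) : ℕ) : ℤ) ≤ η x) := by
  have hm : ∀ᶠ L in atTop, (0:ℝ) < (MM b L : ℝ) / ((1 + sqrt 2) * sqrt (nL L * log (nL L) / (4 * π * b))) :=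
    (asy2 hb).eventually (eventually_gt_nhds one_pos)
  filter_upwards [tnL.eventually (mainE hb), eventually_ge_atTop 1, hm] with L h h1 hL
  obtain ⟨u, v⟩ := h L (nL_b h1).1 (nL_b h1).2
  have h1 : 1 ≤ MM b L := by
    by_contra hc
    have : MM b L =0 := by omega
    rw [this] at hL; norm_num at hL
  rw [max_eq_right h1]
  change S b (box L) 0 (ii (FV (box L) 0 ∩ {η | ∃ x ∈ box L, (MM b L : ℤ) +3 ≤ η x})) ≤ _ at u
  change S b (box L) 0 (ii {η | η ∈ FV (box L) 0 ∧ ∀ x ∈ box L, η x < (MM b L : ℤ)}) ≤ _ at v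
  have hb0 : 0 < b := by linarith
  have hZ : S b (box L) 0 (ii {η | ∀ x, 0 ≤ η x}) = S b (box L) 0 (ii (FV (box L) 0)) := by
    refine le_antisymm (S_ii_mono fun η _ h x _ => h x) (S_ii_mono fun η h' h x => ?_)
    by_cases hx : x ∈ box L
    · exact h x hx
    · exact (h' x hx).ge
  unfold dgProbFloor
  rw [dgW_S, dgW_S, hZ]
  have hp : 0 < (S b (box L) 0 (ii (FV (box L) 0))).toReal :=
    ENNReal.toReal_pos (S_pos (η := 0) (fun _ _ => le_rfl) fun _ _ => rfl) (S_fin' hb0)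
  rw [le_div_iff₀ hp]
  have key : S b (box L) 0 (ii (FV (box L) 0)) ≤ S b (box L) 0 (ii {η | ((∀ x ∈ box L, η x ≤ (MM b L : ℤ) +2) ∧ ∃ x ∈ box L, (MM b L : ℤ) ≤ η x) ∧ ∀ x, 0 ≤ η x}) +
      (ofReal (1 / nL L) * S b (box L) 0 (ii (FV (box L) 0)) + ofReal (1 / nL L) * S b (box L) 0 (ii (FV (box L) 0))) := by
    rw [← hZ] at u v ⊢
    refine (S_or (E := {η | η ∈ FV (box L) 0 ∩ {η | ∃ x ∈ box L, (MM b L : ℤ) +3 ≤ η x} ∨ η ∈ {η | η ∈ FV (box L) 0 ∧ ∀ x ∈ box L, η x < (MM b L : ℤ)}}) ?_).trans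
      (add_le_add le_rfl ((S_or fun η _ h => h).trans (add_le_add u v)))
    intro η _ hη
    by_cases c1 : ∃ x ∈ box L, (MM b L : ℤ) +3 ≤ η x
    · exact Or.inr (Or.inl ⟨fun x _ => hη x, c1⟩)
    by_cases c2 : ∀ x ∈ box L, η x < (MM b L : ℤ)
    · exact Or.inr (Or.inr ⟨fun x _ => hη x, c2⟩)
    push Not at c1 c2
    exact Or.inl ⟨⟨fun x hx => by have := c1 x hx; omega, c2⟩, hη⟩
  have f1 : S b (box L) 0 (ii (FV (box L) 0)) ≠ ⊤ := S_fin' hb0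
  have f2 : S b (box L) 0 (ii {η | ((∀ x ∈ box L, η x ≤ (MM b L : ℤ) +2) ∧ ∃ x ∈ box L, (MM b L : ℤ) ≤ η x) ∧ ∀ x, 0 ≤ η x}) ≠ ⊤ := S_fin' hb0
  have f3 : ofReal (1 / nL L) * S b (box L) 0 (ii (FV (box L) 0)) ≠ ⊤ := ENNReal.mul_ne_top ENNReal.ofReal_ne_top f1
  have := ENNReal.toReal_mono (ENNReal.add_ne_top.2 ⟨f2, ENNReal.add_ne_top.2 ⟨f3, f3⟩⟩) key
  rw [ENNReal.toReal_add f2 (ENNReal.add_ne_top.2 ⟨f3, f3⟩), ENNReal.toReal_add f3 f3, ENNReal.toReal_mul, ENNReal.toReal_ofReal (by positivity)] at this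
  linarith
/-- **Theorem 3 (maximum of the DG model above a floor).** -/
theorem dg_floor_three_point_maximum :
    ∃ β₀ > (0 : ℝ), ∀ β ≥ β₀, ∃ Mstar : ℕ → ℕ,
      (∀ L, 0 < Mstar L) ∧
      Tendsto (fun L : ℕ =>
          (Mstar L : ℝ) /
            (((1 + Real.sqrt 2) / (2 * Real.sqrt (Real.pi * β))) *
              Real.sqrt (Real.log L * Real.log (Real.log L))))
        atTop (𝓝 1) ∧
      Tendsto (fun L : ℕ =>
          dgProbFloor β (box L) fun η =>
            (∀ x ∈ box L, η x ≤ (Mstar L : ℤ) + 2) ∧ ∃ x ∈ box L, (Mstar L : ℤ) ≤ η x)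
        atTop (𝓝 1) := by
  refine ⟨20, by norm_num, fun β hβ => ⟨fun L => max 1 (MM β L), fun L => by positivity, asy hβ, ?_⟩⟩
  have h1 : Tendsto (fun L : ℕ => 1 - 2 * (1 / (nL L : ℝ))) atTop (𝓝 1) := by
    have := (tendsto_one_div_atTop_nhds_zero_nat (𝕜 := ℝ)).comp tnL
    simpa using (tendsto_const_nhds (x := (1:ℝ))).sub (this.const_mul 2)
  refine tendsto_of_tendsto_of_tendsto_of_le_of_le' h1 tendsto_const_nhds (prob hβ) (Eventually.of_forall fun L => ?_)
  unfold dgProbFloor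
  rw [dgW_S, dgW_S]
  refine div_le_one_of_le₀ (ENNReal.toReal_mono (S_fin' (by linarith)) (S_ii_mono fun η _ h => h.2)) ENNReal.toReal_nonneg
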